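/- Let f ∈ C²(S¹×ℝ×ℝ, ℝ) and let u and v be two classical solutions on S¹×[0,T] of the scalar reaction–diffusion equation u_t = u_xx + f(x,u,u_x) (which are continuous on S¹×[0,T] and, by parabolic regularity, C¹ in t and C² in x on S¹×(0,T]). If u is not identically equal to v, then the difference w = u − v satisfies the Sturm lap-number properties on (0,T]: z(w(·,t)) is finite for each t ∈ (0,T], the map t ↦ z(w(·,t)) is nonincreasing, and it strictly decreases at t = t₀ if and only if x ↦ w(x,t₀) has a multiple zero. The same conclusions hold for w = u_t, provided u is not independent of t. -/

import Mathlib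

open Set

/-- The zero number of a function `φ : ℝ → ℝ` viewed as a function on the circle
`S¹ = ℝ/ℤ` (i.e. a `1`-periodic function): the number of strict sign changes of `φ`. -/
noncomputable def zeroNumber (φ : ℝ → ℝ) : ℕ∞ :=
  ⨆ k ∈ {k : ℕ | ∃ x : Fin k → ℝ, StrictMono x ∧ (∀ i j : Fin k, x j < x i + 1) ∧
      ∀ i : Fin k, φ (x i) * φ (x (finRotate k i)) < 0}, (k : ℕ∞)

/-- A multiple zero of a (C¹) function `φ : ℝ → ℝ`. -/
def HasMultipleZero (φ : ℝ → ℝ) : Prop := ∃ x, φ x = 0 ∧ deriv φ x = 0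

/-- The Sturm lap-number properties for a two-parameter family `w t = w(·,t)` on the
time interval `(0,T]`: finiteness of the zero number, monotonicity in time, and the
characterization of the times of strict decrease by multiple zeros. -/
def SturmProperties (T : ℝ) (w : ℝ → ℝ → ℝ) : Prop :=
  (∀ t ∈ Ioc 0 T, zeroNumber (w t) ≠ ⊤)
  ∧ (∀ t₁ ∈ Ioc 0 T, ∀ t₂ ∈ Ioc 0 T, t₁ ≤ t₂ → zeroNumber (w t₂) ≤ zeroNumber (w t₁))
  ∧ (∀ t₀ ∈ Ioo 0 T,
      ((∀ t₁ ∈ Ioc 0 T, ∀ t₂ ∈ Ioc 0 T, t₁ < t₀ → t₀ < t₂ →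
          zeroNumber (w t₂) < zeroNumber (w t₁))
        ↔ HasMultipleZero (w t₀)))

/-- `u` (written `u t x` for `u(x,t)`) is a classical solution on `S¹ × [0,T]` of the
scalar reaction-diffusion equation `u_t = u_xx + f(x,u,u_x)`, continuous on `S¹ × [0,T]`
and (by parabolic regularity) `C¹` in `t` and `C²` in `x` on `S¹ × (0,T]`. -/
def IsSolutionOn (f : ℝ → ℝ → ℝ → ℝ) (T : ℝ) (u : ℝ → ℝ → ℝ) : Prop :=
  (∀ t, Function.Periodic (u t) 1)
  ∧ ContinuousOn (fun p : ℝ × ℝ => u p.1 p.2) (Icc 0 T ×ˢ (univ : Set ℝ))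
  ∧ (∀ t ∈ Ioc 0 T, ∀ x : ℝ, DifferentiableAt ℝ (fun s => u s x) t)
  ∧ (∀ t ∈ Ioc 0 T, ContDiff ℝ 2 (u t))
  ∧ ContinuousOn (fun p : ℝ × ℝ => deriv (fun s => u s p.2) p.1)
      (Ioc 0 T ×ˢ (univ : Set ℝ))
  ∧ ContinuousOn (fun p : ℝ × ℝ => deriv (u p.1) p.2) (Ioc 0 T ×ˢ (univ : Set ℝ))
  ∧ ContinuousOn (fun p : ℝ × ℝ => deriv (deriv (u p.1)) p.2) (Ioc 0 T ×ˢ (univ : Set ℝ))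
  ∧ ∀ t ∈ Ioc 0 T, ∀ x : ℝ,
      deriv (fun s => u s x) t
        = deriv (deriv (u t)) x + f x (u t x) (deriv (u t) x)

namespace SturmPf
open Filter Topology

lemma second_deriv_max {h h1 : ℝ → ℝ} {c x : ℝ}
    (h' : ∀ᶠ y in 𝓝 x, HasDerivAt h (h1 y) y) (h1' : HasDerivAt h1 c x)
    (hm : IsLocalMax h x) : c ≤ 0 := by
  by_contra hc
  push Not at hc
  have h0 : h1 x = 0 := hm.hasDerivAt_eq_zero h'.self_of_nhds
  have hs := h1'.tendsto_slope
  have hpos : ∀ᶠ y in 𝓝[≠] x, 0 < slope h1 x y := hs.eventually (lt_mem_nhds hc)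
  rw [eventually_nhdsWithin_iff] at hpos
  obtain ⟨δ, hδ, hb⟩ := Metric.eventually_nhds_iff.1 (hpos.and (h'.and hm))
  have hder : ∀ y ∈ Icc x (x + δ / 2), HasDerivAt h (h1 y) y := by
    intro y hy
    refine (hb (y := y) ?_).2.1
    rw [Real.dist_eq, abs_lt]; constructor <;> linarith [hy.1, hy.2]
  have hmono : StrictMonoOn h (Icc x (x + δ / 2)) := by
    apply strictMonoOn_of_deriv_pos (convex_Icc _ _)
    · intro y hy; exact (hder y hy).continuousAt.continuousWithinAt
    · intro y hy
      rw [interior_Icc] at hy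
      rw [(hder y ⟨hy.1.le, hy.2.le⟩).deriv]
      have := (hb (y := y) (by rw [Real.dist_eq, abs_lt]; constructor <;> linarith [hy.1, hy.2])).1
        (ne_of_gt hy.1)
      rw [slope_def_field, h0, sub_zero] at this
      have h3 : 0 < y - x := by linarith [hy.1]
      exact (div_pos_iff_of_pos_right h3).1 this
  have h1 := hmono (left_mem_Icc.2 (by linarith)) (right_mem_Icc.2 (by linarith : x ≤ x + δ / 2))
    (by linarith)
  have h2 : h (x + δ / 2) ≤ h x := (hb (y := x + δ / 2) (by
    rw [Real.dist_eq, abs_lt]; constructor <;> linarith)).2.2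
  linarith

lemma left_max_deriv {h : ℝ → ℝ} {c s s0 : ℝ} (hs : s0 < s) (hd : HasDerivAt h c s)
    (hm : ∀ r ∈ Icc s0 s, h r ≤ h s) : 0 ≤ c := by
  have h1 : Tendsto (slope h s) (𝓝[<] s) (𝓝 c) :=
    hd.tendsto_slope.mono_left (nhdsWithin_mono _ (fun y hy => ne_of_lt hy))
  refine ge_of_tendsto h1 ?_
  filter_upwards [Ioo_mem_nhdsLT hs] with r hr
  rw [slope_def_field]
  apply div_nonneg_of_nonpos
  · linarith [hm r ⟨hr.1.le, hr.2.le⟩]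
  · linarith [hr.2]

set_option maxHeartbeats 2000000 in
/-- Interior gradient bound by doubling variables. -/
lemma grad_bound_one {g gs gy gyy : ℝ → ℝ → ℝ} {s₁ y₀ δ C η : ℝ} (hδ : 0 < δ) (hC : 0 ≤ C)
    (hη : 0 < η)
    (hcont : ContinuousOn (fun p : ℝ × ℝ => g p.1 p.2) (Icc (s₁ - δ) s₁ ×ˢ Icc (y₀ - 1) (y₀ + 1)))
    (hds : ∀ s ∈ Icc (s₁ - δ) s₁, ∀ y ∈ Icc (y₀ - 1) (y₀ + 1),
      HasDerivAt (fun r => g r y) (gs s y) s)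
    (hdy : ∀ s ∈ Icc (s₁ - δ) s₁, ∀ y ∈ Icc (y₀ - 1) (y₀ + 1), HasDerivAt (g s) (gy s y) y)
    (hdyy : ∀ s ∈ Icc (s₁ - δ) s₁, ∀ y ∈ Icc (y₀ - 1) (y₀ + 1), HasDerivAt (gy s) (gyy s y) y)
    (hb : ∀ s ∈ Icc (s₁ - δ) s₁, ∀ y ∈ Icc (y₀ - 1) (y₀ + 1), |g s y| ≤ η)
    (he : ∀ s ∈ Icc (s₁ - δ) s₁, ∀ y ∈ Icc (y₀ - 1) (y₀ + 1),
      |gs s y - gyy s y| ≤ η + C * |gy s y|) :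
    gy s₁ y₀ ≤ (40 * (C + 1) + 2 / δ) * η := by
  set K : ℝ := 40 * (C + 1) + 2 / δ with hK
  set N : ℝ := C + 1 with hN
  have hNpos : 1 ≤ N := by linarith
  have hδ2 : 0 < 2 / δ := by positivity
  have hK40 : 40 * N ≤ K := by linarith
  have hKpos : 0 < K := by linarith
  set r0 : ℝ := 1 / (4 * N) with hr0
  have hr0pos : 0 < r0 := by positivity
  have hr0le : r0 ≤ 1 / 4 := by
    rw [hr0]; apply one_div_le_one_div_of_le <;> linarith
  have hNr : N * r0 = 1 / 4 := by rw [hr0]; field_simp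
  -- the penalty
  let P : ℝ × ℝ × ℝ → ℝ := fun z => η * (K * ((z.2.1 - z.2.2) - N * (z.2.1 - z.2.2) ^ 2)
    + 8 * (z.2.1 - y₀) ^ 2 + 2 / δ * (s₁ - z.1))
  let Φ : ℝ × ℝ × ℝ → ℝ := fun z => g z.1 z.2.1 - g z.1 z.2.2 - P z
  let S : Set (ℝ × ℝ × ℝ) := (Icc (s₁ - δ) s₁ ×ˢ (Icc (y₀ - 1/2) (y₀ + 1/2) ×ˢ
    Icc (y₀ - 1) (y₀ + 1))) ∩ {z | 0 ≤ z.2.1 - z.2.2 ∧ z.2.1 - z.2.2 ≤ r0}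
  have hScomp : IsCompact S := by
    refine (isCompact_Icc.prod (isCompact_Icc.prod isCompact_Icc)).inter_right ?_
    have c1 : Continuous (fun z : ℝ × ℝ × ℝ => z.2.1 - z.2.2) := by fun_prop
    exact (isClosed_le continuous_const c1).inter (isClosed_le c1 continuous_const)
  have hΦc : ContinuousOn Φ S := by
    have e1 : ContinuousOn (fun z : ℝ × ℝ × ℝ => g z.1 z.2.1) S := by
      refine hcont.comp (f := fun z : ℝ × ℝ × ℝ => (z.1, z.2.1)) (by fun_prop) ?_
      rintro ⟨s, p, q⟩ ⟨⟨h1, h2, h3⟩, -⟩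
      exact ⟨h1, ⟨by linarith [h2.1], by linarith [h2.2]⟩⟩
    have e2 : ContinuousOn (fun z : ℝ × ℝ × ℝ => g z.1 z.2.2) S := by
      refine hcont.comp (f := fun z : ℝ × ℝ × ℝ => (z.1, z.2.2)) (by fun_prop) ?_
      rintro ⟨s, p, q⟩ ⟨⟨h1, h2, h3⟩, -⟩
      exact ⟨h1, h3⟩
    have e3 : ContinuousOn P S := by
      apply Continuous.continuousOn; fun_prop
    exact (e1.sub e2).sub e3
  have hmem0 : (s₁, y₀, y₀) ∈ S := by
    refine ⟨⟨⟨by simp; linarith, le_refl _⟩, ⟨by simp, by simp⟩, ⟨by simp, by simp⟩⟩, ?_⟩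
    simp; exact hr0pos.le
  obtain ⟨⟨s, p, q⟩, hzS, hmax⟩ := hScomp.exists_isMaxOn ⟨_, hmem0⟩ hΦc
  have key : Φ (s, p, q) ≤ 0 := by
    by_contra hpos
    push Not at hpos
    obtain ⟨⟨hs, hp, hq⟩, hpq0, hpq1⟩ := hzS
    simp only at hs hp hq hpq0 hpq1
    have hp' : p ∈ Icc (y₀ - 1) (y₀ + 1) := ⟨by linarith [hp.1], by linarith [hp.2]⟩
    have hbp := abs_le.1 (hb s hs p hp')
    have hbq := abs_le.1 (hb s hs q hq)
    have hposd : 0 < g s p - g s q - η * (K * ((p - q) - N * (p - q) ^ 2)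
      + 8 * (p - y₀) ^ 2 + 2 / δ * (s₁ - s)) := hpos
    have hlt2 : K * ((p - q) - N * (p - q) ^ 2) + 8 * (p - y₀) ^ 2 + 2 / δ * (s₁ - s) < 2 := by
      by_contra hcon
      push Not at hcon
      have := mul_le_mul_of_nonneg_left hcon hη.le
      linarith [hbp.2, hbq.1]
    have hψ : 3 / 4 * (p - q) ≤ (p - q) - N * (p - q) ^ 2 := by
      have e1 := mul_le_mul_of_nonneg_left hpq1 (by linarith : 0 ≤ N)
      rw [hNr] at e1
      have e2 := mul_le_mul_of_nonneg_right e1 hpq0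
      linarith
    have t1 : 0 ≤ K * ((p - q) - N * (p - q) ^ 2) := by
      apply mul_nonneg hKpos.le; linarith
    have t2 : 0 ≤ 8 * (p - y₀) ^ 2 := by positivity
    have t3 : 0 ≤ 2 / δ * (s₁ - s) := mul_nonneg hδ2.le (by linarith [hs.2])
    have hp1 : |p - y₀| < 1 / 2 := by
      apply abs_lt_of_sq_lt_sq _ (by norm_num)
      linarith
    rw [abs_lt] at hp1
    have hpq_lt : p - q < r0 := by
      rcases hpq1.lt_or_eq with h | h
      · exact h
      · exfalso
        have : 40 * N * (3 / 4 * r0) ≤ K * ((p - q) - N * (p - q) ^ 2) := by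
          rw [h] at hψ ⊢
          apply mul_le_mul hK40 hψ (by positivity) hKpos.le
        have h40 : 40 * N * (3 / 4 * r0) = 30 * (N * r0) := by ring
        rw [h40, hNr] at this
        linarith
    have hs1 : s₁ - δ < s := by
      rcases hs.1.lt_or_eq with h | h
      · exact h
      · exfalso
        have : 2 / δ * (s₁ - s) = 2 := by rw [← h]; field_simp; ring
        linarith
    have hpq_pos : 0 < p - q := by
      rcases hpq0.lt_or_eq with h | h
      · exact h
      · exfalso
        have : p = q := by linarith
        rw [this] at hposd t1 hlt2
        have : 0 ≤ η * (K * ((q - q) - N * (q - q) ^ 2) + 8 * (q - y₀) ^ 2 + 2 / δ * (s₁ - s)) := by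
          rw [this] at t2
          exact mul_nonneg hη.le (by linarith)
        linarith
    -- time derivative
    have htime : 0 ≤ gs s p - gs s q + η * (2 / δ) := by
      have hd : HasDerivAt (fun r => g r p - g r q - η * (K * ((p - q) - N * (p - q) ^ 2)
          + 8 * (p - y₀) ^ 2 + 2 / δ * (s₁ - r))) (gs s p - gs s q - η * (2 / δ * (0 - 1))) s := by
        refine ((hds s hs p hp').sub (hds s hs q hq)).sub ?_
        exact ((((hasDerivAt_const s s₁).sub (hasDerivAt_id s)).const_mul (2/δ)).const_add _).const_mul η
      have := left_max_deriv hs1 hd (fun r hr => hmax (a := (r, p, q))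
        ⟨⟨⟨hr.1, hr.2.trans hs.2⟩, hp, hq⟩, hpq0, hpq1⟩)
      linarith
    have hq1 : y₀ - 1 < q ∧ q < y₀ + 1 := ⟨by linarith, by linarith⟩
    have hpn : p ∈ Ioo (y₀ - 1/2) (y₀ + 1/2) := ⟨by linarith, by linarith⟩
    -- derivative in p
    have hgp : gy s p = η * (K * (1 - 2 * N * (p - q)) + 16 * (p - y₀)) := by
      have hd : HasDerivAt (fun r => g s r - g s q - η * (K * ((r - q) - N * (r - q) ^ 2)
          + 8 * (r - y₀) ^ 2 + 2 / δ * (s₁ - s)))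
          (gy s p - 0 - η * (K * (1 - N * (2 * (p - q))) + 8 * (2 * (p - y₀)) + 0)) p := by
        refine ((hdy s hs p hp').sub (hasDerivAt_const p _)).sub ?_
        have e1 : HasDerivAt (fun r : ℝ => r - q) 1 p := (hasDerivAt_id p).sub_const q
        have e2 : HasDerivAt (fun r : ℝ => (r - q) ^ 2) (2 * (p - q)) p := by
          simpa using e1.fun_pow 2
        have e3 : HasDerivAt (fun r : ℝ => (r - y₀) ^ 2) (2 * (p - y₀)) p := by
          simpa using ((hasDerivAt_id' p).sub_const y₀).fun_pow 2
        exact ((((e1.sub (e2.const_mul N)).const_mul K).add (e3.const_mul 8)).add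
          (hasDerivAt_const p _)).const_mul η
      have hloc : IsLocalMax (fun r => g s r - g s q - η * (K * ((r - q) - N * (r - q) ^ 2)
          + 8 * (r - y₀) ^ 2 + 2 / δ * (s₁ - s))) p := by
        have n1 : ∀ᶠ r in 𝓝 p, r ∈ Ioo (y₀ - 1/2) (y₀ + 1/2) := isOpen_Ioo.mem_nhds hpn
        have n2 : ∀ᶠ r in 𝓝 p, r ∈ Ioo q (q + r0) := isOpen_Ioo.mem_nhds ⟨by linarith, by linarith⟩
        filter_upwards [n1, n2] with r hr1 hr2
        exact hmax (a := (s, r, q)) ⟨⟨hs, ⟨hr1.1.le, hr1.2.le⟩, hq⟩, by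
          constructor <;> simp only <;> linarith [hr2.1, hr2.2]⟩
      have := hloc.hasDerivAt_eq_zero hd
      linarith
    have hgq : gy s q = η * (K * (1 - 2 * N * (p - q))) := by
      have hd : HasDerivAt (fun r => g s p - g s r - η * (K * ((p - r) - N * (p - r) ^ 2)
          + 8 * (p - y₀) ^ 2 + 2 / δ * (s₁ - s)))
          (0 - gy s q - η * (K * ((0-1) - N * (2 * (p - q) * (0-1))) + 0 + 0)) q := by
        refine ((hasDerivAt_const q _).sub (hdy s hs q hq)).sub ?_
        have e1 : HasDerivAt (fun r : ℝ => p - r) (0-1) q := (hasDerivAt_const q p).sub (hasDerivAt_id q)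
        have e2 : HasDerivAt (fun r : ℝ => (p - r) ^ 2) (2 * (p - q) * (0-1)) q := by
          simpa using e1.fun_pow 2
        exact ((((e1.sub (e2.const_mul N)).const_mul K).add (hasDerivAt_const q _)).add
          (hasDerivAt_const q _)).const_mul η
      have hloc : IsLocalMax (fun r => g s p - g s r - η * (K * ((p - r) - N * (p - r) ^ 2)
          + 8 * (p - y₀) ^ 2 + 2 / δ * (s₁ - s))) q := by
        have n1 : ∀ᶠ r in 𝓝 q, r ∈ Ioo (y₀ - 1) (y₀ + 1) := isOpen_Ioo.mem_nhds hq1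
        have n2 : ∀ᶠ r in 𝓝 q, r ∈ Ioo (p - r0) p := isOpen_Ioo.mem_nhds ⟨by linarith, by linarith⟩
        filter_upwards [n1, n2] with r hr1 hr2
        exact hmax (a := (s, p, r)) ⟨⟨hs, hp, ⟨hr1.1.le, hr1.2.le⟩⟩, by
          constructor <;> simp only <;> linarith [hr2.1, hr2.2]⟩
      have := hloc.hasDerivAt_eq_zero hd
      linarith
    -- second derivative along (1,-1)
    have hsec : gyy s p - gyy s q - η * (K * (-8 * N) + 16) ≤ 0 := by
      let h1 : ℝ → ℝ := fun τ => gy s (p + τ) + gy s (q - τ)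
        - η * (K * (2 - N * (4 * (p - q + 2 * τ))) + 16 * (p + τ - y₀))
      have hcp : ContinuousAt (fun τ : ℝ => p + τ) 0 := by fun_prop
      have hcq : ContinuousAt (fun τ : ℝ => q - τ) 0 := by fun_prop
      have n1 : ∀ᶠ τ in 𝓝 (0:ℝ), p + τ ∈ Ioo (y₀ - 1/2) (y₀ + 1/2) :=
        hcp.eventually_mem (isOpen_Ioo.mem_nhds (by simpa using hpn))
      have n2 : ∀ᶠ τ in 𝓝 (0:ℝ), q - τ ∈ Ioo (y₀ - 1) (y₀ + 1) :=
        hcq.eventually_mem (isOpen_Ioo.mem_nhds (by simpa using hq1))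
      have hcpq : ContinuousAt (fun τ : ℝ => (p + τ) - (q - τ)) 0 := by fun_prop
      have n3 : ∀ᶠ τ in 𝓝 (0:ℝ), (p + τ) - (q - τ) ∈ Ioo 0 r0 :=
        hcpq.eventually_mem (isOpen_Ioo.mem_nhds (by rw [add_zero, sub_zero]; exact ⟨hpq_pos, hpq_lt⟩))
      have hder : ∀ᶠ τ in 𝓝 (0:ℝ), HasDerivAt (fun τ => g s (p + τ) - g s (q - τ)
          - η * (K * (((p + τ) - (q - τ)) - N * ((p + τ) - (q - τ)) ^ 2)
          + 8 * ((p + τ) - y₀) ^ 2 + 2 / δ * (s₁ - s))) (h1 τ) τ := by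
        filter_upwards [n1, n2] with τ h1' h2'
        have a1 : HasDerivAt (fun τ : ℝ => p + τ) 1 τ := (hasDerivAt_id τ).const_add p
        have a2 : HasDerivAt (fun τ : ℝ => q - τ) (-1) τ := (hasDerivAt_id τ).const_sub q
        have b1 := (hdy s hs (p + τ) ⟨by linarith [h1'.1], by linarith [h1'.2]⟩).comp τ a1
        have b2 := (hdy s hs (q - τ) ⟨h2'.1.le, h2'.2.le⟩).comp τ a2
        have e1 := a1.fun_sub a2
        have e2 := e1.fun_pow 2
        have e3 := (a1.sub_const y₀).fun_pow 2
        have := (b1.fun_sub b2).fun_sub (((((e1.fun_sub (e2.const_mul N)).const_mul K).fun_add (e3.const_mul 8)).fun_add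
          (hasDerivAt_const τ (2 / δ * (s₁ - s)))).const_mul η)
        refine this.congr_deriv ?_
        simp only [h1]; push_cast; ring
      have hder2 : HasDerivAt h1 (gyy s p - gyy s q - η * (K * (-8 * N) + 16)) 0 := by
        have a1 : HasDerivAt (fun τ : ℝ => p + τ) 1 0 := (hasDerivAt_id _).const_add p
        have a2 : HasDerivAt (fun τ : ℝ => q - τ) (-1) 0 := (hasDerivAt_id _).const_sub q
        have b1 : HasDerivAt (fun τ => gy s (p + τ)) (gyy s p * 1) 0 :=
          HasDerivAt.comp (h₂ := gy s) 0 (by simpa using hdyy s hs p hp') a1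
        have b2 : HasDerivAt (fun τ => gy s (q - τ)) (gyy s q * (-1)) 0 :=
          HasDerivAt.comp (h₂ := gy s) 0 (by simpa using hdyy s hs q hq) a2
        have e1 : HasDerivAt (fun τ : ℝ => η * (K * (2 - N * (4 * (p - q + 2 * τ))) + 16 * (p + τ - y₀)))
            (η * (K * (-(N * (4 * (2 * 1)))) + 16 * 1)) 0 := by
          refine HasDerivAt.const_mul η (HasDerivAt.add (HasDerivAt.const_mul K ?_) (HasDerivAt.const_mul 16 (a1.sub_const y₀)))
          refine HasDerivAt.const_sub _ (HasDerivAt.const_mul N (HasDerivAt.const_mul 4 ?_))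
          exact ((hasDerivAt_id _).const_mul 2).const_add _
        refine ((b1.fun_add b2).fun_sub e1).congr_deriv ?_
        ring
      refine second_deriv_max hder hder2 ?_
      filter_upwards [n1, n2, n3] with τ h1' h2' h3'
      have := hmax (a := (s, p + τ, q - τ)) ⟨⟨hs, ⟨h1'.1.le, h1'.2.le⟩, ⟨h2'.1.le, h2'.2.le⟩⟩, ⟨h3'.1.le, h3'.2.le⟩⟩
      have h0 : Φ (s, p + 0, q - 0) = Φ (s, p, q) := by rw [add_zero, sub_zero]
      exact (le_of_le_of_eq this h0.symm)
    have ep := abs_le.1 (he s hs p hp')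
    have eq := abs_le.1 (he s hs q hq)
    have hψ1 : |1 - 2 * N * (p - q)| ≤ 1 := by
      have e1 := mul_le_mul_of_nonneg_left hpq1 (by linarith : 0 ≤ N)
      have e2 := mul_nonneg (by linarith : 0 ≤ N) hpq0
      rw [abs_le]; constructor <;> linarith
    have hKψ : |K * (1 - 2 * N * (p - q))| ≤ K := by
      rw [abs_mul, abs_of_pos hKpos]; exact mul_le_of_le_one_right hKpos.le hψ1
    have agp : |gy s p| ≤ η * (K + 8) := by
      rw [hgp, abs_mul, abs_of_pos hη]
      refine mul_le_mul_of_nonneg_left ?_ hη.le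
      refine (abs_add_le _ _).trans (add_le_add hKψ ?_)
      rw [abs_le]; constructor <;> linarith
    have agq : |gy s q| ≤ η * K := by
      rw [hgq, abs_mul, abs_of_pos hη]
      exact mul_le_mul_of_nonneg_left hKψ hη.le
    have c1 := mul_le_mul_of_nonneg_left agp hC
    have c2 := mul_le_mul_of_nonneg_left agq hC
    have fin : 0 ≤ η * (-8 * N * K + 16 + 2 + C * (2 * K + 8) + 2 / δ) := by
      have : 0 ≤ η * (K * (-8 * N) + 16) + 2 * η + C * (η * (K + 8)) + C * (η * K) + η * (2 / δ) := by
        linarith [ep.2, eq.1]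
      linarith
    have : -8 * N * K + 16 + 2 + C * (2 * K + 8) + 2 / δ < 0 := by
      have : C * K ≥ 0 := mul_nonneg hC hKpos.le
      have h8 : N * K = C * K + K := by rw [hN]; ring
      linarith
    exact absurd fin (not_le.2 (mul_neg_of_pos_of_neg hη this))
  -- conclusion
  have hfin : ∀ z ∈ Ioo (y₀ - r0) y₀, g s₁ y₀ - g s₁ z ≤ K * η * (y₀ - z) := by
    intro z hz
    have := (hmax (a := (s₁, y₀, z)) ⟨⟨⟨by simp; linarith, le_refl _⟩, ⟨by simp, by simp⟩,
      ⟨by simp; linarith [hz.1], by simp; linarith [hz.2]⟩⟩, by constructor <;> simp <;> linarith [hz.1, hz.2]⟩)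
    have h2 : Φ (s₁, y₀, z) ≤ 0 := le_trans this key
    have h3 : g s₁ y₀ - g s₁ z - η * (K * ((y₀ - z) - N * (y₀ - z) ^ 2)
      + 8 * (y₀ - y₀) ^ 2 + 2 / δ * (s₁ - s₁)) ≤ 0 := h2
    have h4 : 0 ≤ η * K * N * (y₀ - z) ^ 2 := by positivity
    have h5 : η * (K * ((y₀ - z) - N * (y₀ - z) ^ 2) + 8 * (y₀ - y₀) ^ 2 + 2 / δ * (s₁ - s₁))
      = K * η * (y₀ - z) - η * K * N * (y₀ - z) ^ 2 := by ring
    linarith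
  have hd := hdy s₁ (right_mem_Icc.2 (by linarith)) y₀ ⟨by linarith, by linarith⟩
  have h1 : Tendsto (slope (g s₁) y₀) (𝓝[<] y₀) (𝓝 (gy s₁ y₀)) :=
    hd.tendsto_slope.mono_left (nhdsWithin_mono _ (fun y hy => ne_of_lt hy))
  refine le_of_tendsto h1 ?_
  filter_upwards [Ioo_mem_nhdsLT (by linarith : y₀ - r0 < y₀)] with r hr
  have := hfin r hr
  rw [slope_def_field, div_le_iff_of_neg (by linarith [hr.2])]
  linarith

lemma grad_bound {g gs gy gyy : ℝ → ℝ → ℝ} {s₁ y₀ δ C η : ℝ} (hδ : 0 < δ) (hC : 0 ≤ C)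
    (hη : 0 < η)
    (hcont : ContinuousOn (fun p : ℝ × ℝ => g p.1 p.2) (Icc (s₁ - δ) s₁ ×ˢ Icc (y₀ - 1) (y₀ + 1)))
    (hds : ∀ s ∈ Icc (s₁ - δ) s₁, ∀ y ∈ Icc (y₀ - 1) (y₀ + 1),
      HasDerivAt (fun r => g r y) (gs s y) s)
    (hdy : ∀ s ∈ Icc (s₁ - δ) s₁, ∀ y ∈ Icc (y₀ - 1) (y₀ + 1), HasDerivAt (g s) (gy s y) y)
    (hdyy : ∀ s ∈ Icc (s₁ - δ) s₁, ∀ y ∈ Icc (y₀ - 1) (y₀ + 1), HasDerivAt (gy s) (gyy s y) y)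
    (hb : ∀ s ∈ Icc (s₁ - δ) s₁, ∀ y ∈ Icc (y₀ - 1) (y₀ + 1), |g s y| ≤ η)
    (he : ∀ s ∈ Icc (s₁ - δ) s₁, ∀ y ∈ Icc (y₀ - 1) (y₀ + 1),
      |gs s y - gyy s y| ≤ η + C * |gy s y|) :
    |gy s₁ y₀| ≤ (40 * (C + 1) + 2 / δ) * η := by
  rw [abs_le']
  refine ⟨grad_bound_one hδ hC hη hcont hds hdy hdyy hb he, ?_⟩
  refine grad_bound_one (g := fun s y => - g s y) (gs := fun s y => - gs s y)
    (gy := fun s y => - gy s y) (gyy := fun s y => - gyy s y) hδ hC hη hcont.neg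
    (fun s hs y hy => (hds s hs y hy).neg) (fun s hs y hy => (hdy s hs y hy).neg)
    (fun s hs y hy => (hdyy s hs y hy).neg) ?_ ?_
  · intro s hs y hy; rw [abs_neg]; exact hb s hs y hy
  · intro s hs y hy
    have := he s hs y hy
    rw [abs_neg, show -gs s y - -gyy s y = -(gs s y - gyy s y) by ring, abs_neg]; exact this

end SturmPf

namespace SturmPf
open Filter Topology

noncomputable def bar (s y : ℝ) : ℝ := Real.exp (y ^ 2 / (7 / 2 - 5 * s) + 8 * s)

lemma bar_pos (s y : ℝ) : 0 < bar s y := Real.exp_pos _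

lemma bar_one {g gs gy gyy : ℝ → ℝ → ℝ} {η R0 : ℝ} (hη : 0 < η)
    (hcont : ContinuousOn (fun p : ℝ × ℝ => g p.1 p.2) (Icc 0 (5 / 8) ×ˢ univ))
    (hds : ∀ s ∈ Icc (0:ℝ) (5 / 8), ∀ y, HasDerivAt (fun r => g r y) (gs s y) s)
    (hdy : ∀ s ∈ Icc (0:ℝ) (5 / 8), ∀ y, HasDerivAt (g s) (gy s y) y)
    (hdyy : ∀ s ∈ Icc (0:ℝ) (5 / 8), ∀ y, HasDerivAt (gy s) (gyy s y) y)
    (h0 : ∀ y, |g 0 y| ≤ η * bar 0 y)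
    (hgrow : ∀ s ∈ Icc (0:ℝ) (5 / 8), ∀ y, R0 ≤ |y| → |g s y| ≤ η * bar s y)
    (he : ∀ s ∈ Icc (0:ℝ) (5 / 8), ∀ y, |gs s y - gyy s y| ≤ |g s y| + |gy s y| + η * bar s y) :
    ∀ s ∈ Icc (0:ℝ) (5 / 8), ∀ y, g s y ≤ Real.exp (2 * s) * (η * bar s y) := by
  let Z : ℝ × ℝ → ℝ := fun p => Real.exp (-2 * p.1) * g p.1 p.2 - η * bar p.1 p.2
  have hexp : ∀ s ∈ Icc (0:ℝ) (5/8), Real.exp (-2 * s) ≤ 1 := by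
    intro s hs; rw [Real.exp_le_one_iff]; linarith [hs.1]
  have small : ∀ s ∈ Icc (0:ℝ) (5/8), ∀ y, |g s y| ≤ η * bar s y → Z (s, y) ≤ 0 := by
    intro s hs y h
    have h1 : Real.exp (-2 * s) * g s y ≤ |g s y| := by
      calc Real.exp (-2 * s) * g s y ≤ Real.exp (-2 * s) * |g s y| :=
            mul_le_mul_of_nonneg_left (le_abs_self _) (Real.exp_pos _).le
        _ ≤ 1 * |g s y| := mul_le_mul_of_nonneg_right (hexp s hs) (abs_nonneg _)
        _ = |g s y| := one_mul _
    simp only [Z]; linarith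
  suffices hZ : ∀ s ∈ Icc (0:ℝ) (5/8), ∀ y, Z (s, y) ≤ 0 by
    intro s hs y
    have h1 : Real.exp (-2 * s) * g s y ≤ η * bar s y := by
      have := hZ s hs y; simp only [Z] at this; linarith
    have h2 := mul_le_mul_of_nonneg_left h1 (Real.exp_pos (2 * s)).le
    rw [← mul_assoc, ← Real.exp_add] at h2
    rw [show 2 * s + -2 * s = 0 by ring, Real.exp_zero, one_mul] at h2
    exact h2
  intro s0 hs0 y0
  set R := max R0 |y0| with hR
  have hcomp : IsCompact (Icc (0:ℝ) (5/8) ×ˢ Icc (-R) R) := isCompact_Icc.prod isCompact_Icc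
  have hbarc : ContinuousOn (fun p : ℝ × ℝ => bar p.1 p.2) (Icc (0:ℝ) (5/8) ×ˢ Icc (-R) R) := by
    refine Real.continuous_exp.comp_continuousOn ?_
    refine ContinuousOn.add (ContinuousOn.div (by fun_prop) (by fun_prop) ?_) (by fun_prop)
    rintro ⟨s, y⟩ ⟨hs, -⟩
    simp only at hs ⊢
    have := hs.2
    have : 0 < 7 / 2 - 5 * s := by linarith
    exact this.ne'
  have hZc : ContinuousOn Z (Icc (0:ℝ) (5/8) ×ˢ Icc (-R) R) := by
    refine ContinuousOn.sub (ContinuousOn.mul (by fun_prop) (hcont.mono (prod_mono_right (subset_univ _)))) (hbarc.const_mul η)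
  have hy0 : y0 ∈ Icc (-R) R := abs_le.1 (le_max_right _ _)
  obtain ⟨⟨s, y⟩, ⟨hs, hy⟩, hmax⟩ := hcomp.exists_isMaxOn ⟨(s0, y0), hs0, hy0⟩ hZc
  refine (hmax (a := (s0, y0)) ⟨hs0, hy0⟩).trans ?_
  simp only at hs hy
  change Z (s, y) ≤ 0
  by_contra hpos
  push Not at hpos
  have hs1 : 0 < s := by
    rcases hs.1.lt_or_eq with h | h
    · exact h
    · exfalso; rw [← h] at hpos
      linarith [small 0 (by norm_num) y (h0 y)]
  have hyR : |y| < R := by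
    rcases (abs_le.2 hy).lt_or_eq with h | h
    · exact h
    · exfalso
      linarith [small s hs y (hgrow s hs y (by rw [h]; exact le_max_left _ _))]
  have hden : 0 < 7 / 2 - 5 * s := by linarith [hs.2]
  set θ : ℝ := 1 / (7 / 2 - 5 * s) with hθ
  have hθpos : 0 < θ := by positivity
  have hθle : θ ≤ 8 / 3 := by
    rw [hθ, div_le_iff₀ hden]; linarith [hs.2]
  -- derivatives of bar
  have hbs : HasDerivAt (fun r => bar r y) (bar s y * (5 * θ ^ 2 * y ^ 2 + 8)) s := by
    have a1 : HasDerivAt (fun r : ℝ => 7 / 2 - 5 * r) (-(5 * 1)) s :=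
      ((hasDerivAt_id' s).const_mul 5).const_sub _
    have a2 := (((hasDerivAt_const s (y ^ 2)).fun_div a1 hden.ne').fun_add ((hasDerivAt_id' s).const_mul 8)).exp
    refine a2.congr_deriv ?_
    simp only [bar]
    congr 1
    rw [hθ]; field_simp; ring
  have hby : ∀ z, HasDerivAt (fun r => bar s r) (bar s z * (2 * θ * z)) z := by
    intro z
    have a2 := (((((hasDerivAt_id' z).fun_pow 2).div_const (7 / 2 - 5 * s)).add_const (8 * s))).exp
    refine a2.congr_deriv ?_
    simp only [bar]
    congr 1
    rw [hθ]; field_simp; ring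
  have hbyy : HasDerivAt (fun r => bar s r * (2 * θ * r)) (bar s y * (2 * θ * y) * (2 * θ * y) + bar s y * (2 * θ * 1)) y :=
    (hby y).fun_mul ((hasDerivAt_id' y).const_mul (2 * θ))
  have hE : HasDerivAt (fun r : ℝ => Real.exp (-2 * r)) (Real.exp (-2 * s) * (-2 * 1)) s :=
    ((hasDerivAt_id' s).const_mul (-2)).exp
  set E := Real.exp (-2 * s) with hEdef
  have hEpos : 0 < E := Real.exp_pos _
  have htime : 0 ≤ E * (-2 * 1) * g s y + E * gs s y - η * (bar s y * (5 * θ ^ 2 * y ^ 2 + 8)) := by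
    have := (hE.fun_mul (hds s hs y)).fun_sub (hbs.const_mul η)
    exact left_max_deriv hs1 this (fun r hr => hmax (a := (r, y)) ⟨⟨hr.1, hr.2.trans hs.2⟩, hy⟩)
  have hd1 : ∀ z, HasDerivAt (fun r => E * g s r - η * bar s r) (E * gy s z - η * (bar s z * (2 * θ * z))) z :=
    fun z => ((hdy s hs z).const_mul E).fun_sub ((hby z).const_mul η)
  have hd2 := ((hdyy s hs y).const_mul E).fun_sub (hbyy.const_mul η)
  have hloc : IsLocalMax (fun r => E * g s r - η * bar s r) y := by
    rw [abs_lt] at hyR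
    have : ∀ᶠ r in 𝓝 y, r ∈ Ioo (-R) R := isOpen_Ioo.mem_nhds hyR
    filter_upwards [this] with r hr
    exact hmax (a := (s, r)) ⟨hs, hr.1.le, hr.2.le⟩
  have f1 := hloc.hasDerivAt_eq_zero (hd1 y)
  have f2 := second_deriv_max (Eventually.of_forall hd1) hd2 hloc
  have hgpos : 0 < E * g s y := by
    have : 0 < E * g s y - η * bar s y := hpos
    have := mul_pos hη (bar_pos s y)
    linarith
  have hg : 0 < g s y := (pos_iff_pos_of_mul_pos hgpos).1 hEpos
  have ee := (abs_le.1 (he s hs y)).2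
  rw [abs_of_pos hg] at ee
  have hBp := bar_pos s y
  have hgy : E * |gy s y| = η * (bar s y * (2 * θ * |y|)) := by
    rw [← abs_of_pos hEpos, ← abs_mul, show E * gy s y = η * (bar s y * (2 * θ * y)) by linarith,
      abs_mul, abs_mul, abs_mul, abs_of_pos hη, abs_of_pos hBp, abs_of_pos (by positivity : 0 < 2 * θ)]
  have e2 := mul_le_mul_of_nonneg_left ee hEpos.le
  have hE1 : E * (η * bar s y) ≤ 1 * (η * bar s y) :=
    mul_le_mul_of_nonneg_right (hexp s hs) (mul_pos hη hBp).le
  have fin : η * bar s y * (5 * θ ^ 2 * y ^ 2 + 8) ≤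
      η * bar s y * ((2 * θ * y) * (2 * θ * y) + 2 * θ + 2 * θ * |y| + 1) := by
    linarith
  have fin2 := le_of_mul_le_mul_left fin (mul_pos hη hBp)
  have : 0 ≤ (θ * |y| - 1) ^ 2 := sq_nonneg _
  have hy2 : |y| ^ 2 = y ^ 2 := sq_abs y
  have : (θ * |y| - 1) ^ 2 = θ ^ 2 * y ^ 2 - 2 * θ * |y| + 1 := by rw [← hy2]; ring
  linarith

lemma bar_bound {g gs gy gyy : ℝ → ℝ → ℝ} {η R0 : ℝ} (hη : 0 < η)
    (hcont : ContinuousOn (fun p : ℝ × ℝ => g p.1 p.2) (Icc 0 (5 / 8) ×ˢ univ))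
    (hds : ∀ s ∈ Icc (0:ℝ) (5 / 8), ∀ y, HasDerivAt (fun r => g r y) (gs s y) s)
    (hdy : ∀ s ∈ Icc (0:ℝ) (5 / 8), ∀ y, HasDerivAt (g s) (gy s y) y)
    (hdyy : ∀ s ∈ Icc (0:ℝ) (5 / 8), ∀ y, HasDerivAt (gy s) (gyy s y) y)
    (h0 : ∀ y, |g 0 y| ≤ η * bar 0 y)
    (hgrow : ∀ s ∈ Icc (0:ℝ) (5 / 8), ∀ y, R0 ≤ |y| → |g s y| ≤ η * bar s y)
    (he : ∀ s ∈ Icc (0:ℝ) (5 / 8), ∀ y, |gs s y - gyy s y| ≤ |g s y| + |gy s y| + η * bar s y) :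
    ∀ s ∈ Icc (0:ℝ) (5 / 8), ∀ y, |g s y| ≤ Real.exp (2 * s) * (η * bar s y) := by
  intro s hs y
  rw [abs_le']
  refine ⟨bar_one hη hcont hds hdy hdyy h0 hgrow he s hs y, ?_⟩
  refine bar_one (g := fun s y => - g s y) (gs := fun s y => - gs s y)
    (gy := fun s y => - gy s y) (gyy := fun s y => - gyy s y) (R0 := R0) hη hcont.neg
    (fun s hs y => (hds s hs y).neg) (fun s hs y => (hdy s hs y).neg)
    (fun s hs y => (hdyy s hs y).neg) ?_ ?_ ?_ s hs y
  · intro y; rw [abs_neg]; exact h0 y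
  · intro s hs y hy; rw [abs_neg]; exact hgrow s hs y hy
  · intro s hs y
    have := he s hs y
    rw [abs_neg, abs_neg, show -gs s y - -gyy s y = -(gs s y - gyy s y) by ring, abs_neg]; exact this

end SturmPf

namespace SturmPf
open Filter Topology MeasureTheory ProbabilityTheory

noncomputable abbrev gam : Measure ℝ := gaussianReal 0 1

/-- continuous functions of polynomial growth -/
def GC (g : ℝ → ℝ) : Prop := Continuous g ∧ ∃ (C : ℝ) (k : ℕ), 0 ≤ C ∧ ∀ y, |g y| ≤ C * (1 + |y|) ^ k

lemma one_le_w (y : ℝ) : 1 ≤ 1 + |y| := by linarith [abs_nonneg y]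

lemma GC.mul {f g : ℝ → ℝ} (hf : GC f) (hg : GC g) : GC (fun y => f y * g y) := by
  obtain ⟨hfc, C, k, hC, hk⟩ := hf
  obtain ⟨hgc, D, l, hD, hl⟩ := hg
  refine ⟨hfc.mul hgc, C * D, k + l, mul_nonneg hC hD, fun y => ?_⟩
  rw [abs_mul, pow_add]
  calc |f y| * |g y| ≤ (C * (1 + |y|) ^ k) * (D * (1 + |y|) ^ l) :=
        mul_le_mul (hk y) (hl y) (abs_nonneg _) (by positivity)
    _ = _ := by ring

lemma GC.add {f g : ℝ → ℝ} (hf : GC f) (hg : GC g) : GC (fun y => f y + g y) := by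
  obtain ⟨hfc, C, k, hC, hk⟩ := hf
  obtain ⟨hgc, D, l, hD, hl⟩ := hg
  refine ⟨hfc.add hgc, C + D, k + l, add_nonneg hC hD, fun y => ?_⟩
  have h1 : (1 + |y|) ^ k ≤ (1 + |y|) ^ (k + l) := pow_le_pow_right₀ (one_le_w y) (by omega)
  have h2 : (1 + |y|) ^ l ≤ (1 + |y|) ^ (k + l) := pow_le_pow_right₀ (one_le_w y) (by omega)
  calc |f y + g y| ≤ |f y| + |g y| := abs_add_le _ _
    _ ≤ C * (1 + |y|) ^ k + D * (1 + |y|) ^ l := add_le_add (hk y) (hl y)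
    _ ≤ C * (1 + |y|) ^ (k + l) + D * (1 + |y|) ^ (k + l) :=
        add_le_add (mul_le_mul_of_nonneg_left h1 hC) (mul_le_mul_of_nonneg_left h2 hD)
    _ = _ := by ring

lemma GC.const (c : ℝ) : GC (fun _ => c) :=
  ⟨continuous_const, |c|, 0, abs_nonneg _, fun y => by simp⟩

lemma GC.id : GC (fun y => y) :=
  ⟨continuous_id, 1, 1, zero_le_one, fun y => by simp⟩

lemma GC.neg {f : ℝ → ℝ} (hf : GC f) : GC (fun y => - f y) := by
  simpa using (GC.const (-1)).mul hf

lemma GC.sub {f g : ℝ → ℝ} (hf : GC f) (hg : GC g) : GC (fun y => f y - g y) := by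
  simpa [sub_eq_add_neg] using hf.add hg.neg

lemma GC.smul {f : ℝ → ℝ} (c : ℝ) (hf : GC f) : GC (fun y => c * f y) := (GC.const c).mul hf

lemma GC.pow {f : ℝ → ℝ} (hf : GC f) (n : ℕ) : GC (fun y => f y ^ n) := by
  induction n with
  | zero => simpa using GC.const 1
  | succ n ih => simpa [pow_succ] using ih.mul hf

lemma integrable_wpow (k : ℕ) : Integrable (fun y : ℝ => (1 + |y|) ^ k) gam := by
  have h1 : MemLp (fun y : ℝ => 1 + |y|) (k : ENNReal) gam := by
    refine MemLp.add (memLp_const 1) ?_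
    exact (memLp_id_gaussianReal' (μ := 0) (v := 1) (k : ENNReal) (by simp)).norm
  have h2 := h1.integrable_norm_pow'
  refine h2.congr (Eventually.of_forall fun y => ?_)
  simp only [Real.norm_eq_abs]
  rw [abs_of_pos (by linarith [one_le_w y])]

lemma GC.integrable {g : ℝ → ℝ} (hg : GC g) : Integrable g gam := by
  obtain ⟨hc, C, k, hC, hk⟩ := hg
  refine ((integrable_wpow k).const_mul C).mono' hc.aestronglyMeasurable (Eventually.of_forall fun y => ?_)
  simpa using hk y

lemma GC.memLp {g : ℝ → ℝ} (hg : GC g) : MemLp g 2 gam := by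
  rw [memLp_two_iff_integrable_sq hg.1.aestronglyMeasurable]
  exact (hg.pow 2).integrable

lemma pdf_eq (y : ℝ) : gaussianPDFReal 0 1 y = (√(2 * Real.pi))⁻¹ * Real.exp (-(y ^ 2) / 2) := by
  simp [gaussianPDFReal_def]

lemma pdf_deriv (y : ℝ) :
    HasDerivAt (gaussianPDFReal 0 1) (-(y * gaussianPDFReal 0 1 y)) y := by
  have h : gaussianPDFReal 0 1 = fun y => (√(2 * Real.pi))⁻¹ * Real.exp (-(y ^ 2) / 2) :=
    funext pdf_eq
  rw [h]
  have := ((((((hasDerivAt_id' y).fun_pow 2).fun_neg).div_const 2).exp).const_mul ((√(2 * Real.pi))⁻¹))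
  refine this.congr_deriv ?_
  push_cast; ring

lemma integrable_gam_iff {g : ℝ → ℝ} :
    Integrable g gam ↔ Integrable (fun y => gaussianPDFReal 0 1 y * g y) volume := by
  rw [gam, gaussianReal_of_var_ne_zero 0 (one_ne_zero)]
  rw [integrable_withDensity_iff_integrable_smul' (measurable_gaussianPDF 0 1)
    (Eventually.of_forall fun x => gaussianPDF_lt_top)]
  simp [toReal_gaussianPDF]

lemma integral_gam {g : ℝ → ℝ} : ∫ y, g y ∂gam = ∫ y, gaussianPDFReal 0 1 y * g y := by
  rw [integral_gaussianReal_eq_integral_smul (one_ne_zero)]; rfl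

lemma stein {g g' : ℝ → ℝ} (hd : ∀ y, HasDerivAt g (g' y) y) (hg : GC g) (hg' : GC g') :
    ∫ y, g' y ∂gam = ∫ y, y * g y ∂gam := by
  have h1 := integrable_gam_iff.1 hg.integrable
  have h2 := integrable_gam_iff.1 (hg'.sub (GC.id.mul hg)).integrable
  have h3 : ∫ y, gaussianPDFReal 0 1 y * (g' y - y * g y) = 0 := by
    refine integral_eq_zero_of_hasDerivAt_of_integrable (fun y => ?_) h2 h1
    exact ((pdf_deriv y).fun_mul (hd y)).congr_deriv (by ring)
  rw [← integral_gam (g := fun y => g' y - y * g y),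
    integral_sub hg'.integrable (GC.id.mul hg).integrable] at h3
  linarith

lemma ibp {u u' v' v'' : ℝ → ℝ} (hu : ∀ y, HasDerivAt u (u' y) y)
    (hv : ∀ y, HasDerivAt v' (v'' y) y) (gu : GC u) (gu' : GC u') (gv' : GC v') (gv'' : GC v'') :
    ∫ y, u' y * v' y ∂gam = ∫ y, u y * (y * v' y - v'' y) ∂gam := by
  have := stein (g := fun y => u y * v' y) (g' := fun y => u' y * v' y + u y * v'' y)
    (fun y => (hu y).fun_mul (hv y)) (gu.mul gv') ((gu'.mul gv').add (gu.mul gv''))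
  rw [integral_add (gu'.mul gv').integrable (gu.mul gv'').integrable] at this
  have e : ∫ y, u y * (y * v' y - v'' y) ∂gam = ∫ y, y * (u y * v' y) ∂gam - ∫ y, u y * v'' y ∂gam := by
    rw [← integral_sub (GC.id.mul (gu.mul gv')).integrable (gu.mul gv'').integrable]
    congr 1; ext y; ring
  rw [e]; linarith

/-- pointwise bound from Gaussian Sobolev norm -/
lemma sobolev {g g' : ℝ → ℝ} (hd : ∀ y, HasDerivAt g (g' y) y) (hg : GC g) (hg' : GC g') (y : ℝ) :
    |g y| ≤ 25 * √(∫ z, (g z ^ 2 + g' z ^ 2) ∂gam) * bar 0 y := by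
  set N := ∫ z, (g z ^ 2 + g' z ^ 2) ∂gam with hN
  have hcg := hg.1
  have hcg' := hg'.1
  have hNn : 0 ≤ N := integral_nonneg fun z => by positivity
  -- FTC
  have ftc : ∫ z in y..(y+1), (2 * g z * g' z * (1 - (z - y)) + g z ^ 2 * (-1))
      = g (y+1) ^ 2 * (1 - ((y + 1) - y)) - g y ^ 2 * (1 - (y - y)) := by
    refine intervalIntegral.integral_eq_sub_of_hasDerivAt (f := fun z => g z ^ 2 * (1 - (z - y))) (fun z _ => ?_) ?_
    · have := ((hd z).fun_pow 2).fun_mul (((hasDerivAt_id' z).sub_const y).const_sub 1)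
      refine this.congr_deriv ?_
      push_cast; ring
    · apply Continuous.intervalIntegrable; fun_prop
  have h1 : g y ^ 2 = ∫ z in y..(y+1), (g z ^ 2 - 2 * g z * g' z * (1 - (z - y))) := by
    have e : ∫ z in y..(y+1), (g z ^ 2 - 2 * g z * g' z * (1 - (z - y)))
      = - ∫ z in y..(y+1), (2 * g z * g' z * (1 - (z - y)) + g z ^ 2 * (-1)) := by
      rw [← intervalIntegral.integral_neg]; congr 1; ext z; ring
    rw [e, ftc]; ring
  set K := √(2 * Real.pi) * Real.exp ((|y| + 1) ^ 2 / 2) with hK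
  have hsp : 0 < √(2 * Real.pi) := Real.sqrt_pos.2 (by positivity)
  have h2 : g y ^ 2 ≤ ∫ z in y..(y+1), 2 * K * (gaussianPDFReal 0 1 z * (g z ^ 2 + g' z ^ 2)) := by
    rw [h1]
    have hpc : Continuous (gaussianPDFReal 0 1) := by
      rw [show gaussianPDFReal 0 1 = fun y => (√(2 * Real.pi))⁻¹ * Real.exp (-(y ^ 2) / 2) from
        funext pdf_eq]
      fun_prop
    refine intervalIntegral.integral_mono_on (by linarith) ?_ ?_ ?_
    · apply Continuous.intervalIntegrable; fun_prop
    · apply Continuous.intervalIntegrable; fun_prop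
    · intro z hz
      have a1 : 1 ≤ K * gaussianPDFReal 0 1 z := by
        rw [pdf_eq, hK, show √(2 * Real.pi) * Real.exp ((|y| + 1) ^ 2 / 2) * ((√(2 * Real.pi))⁻¹ * Real.exp (-(z ^ 2) / 2))
          = (√(2 * Real.pi) * (√(2 * Real.pi))⁻¹) * (Real.exp ((|y| + 1) ^ 2 / 2) * Real.exp (-(z ^ 2) / 2)) by ring,
          mul_inv_cancel₀ hsp.ne', one_mul, ← Real.exp_add]
        apply Real.one_le_exp
        have hz' : |z| ≤ |y| + 1 := by
          rw [abs_le]; constructor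
          · linarith [neg_abs_le y, hz.1]
          · linarith [le_abs_self y, hz.2]
        have := pow_le_pow_left₀ (abs_nonneg z) hz' 2
        rw [sq_abs] at this
        linarith
      have a2 : g z ^ 2 - 2 * g z * g' z * (1 - (z - y)) ≤ 2 * (g z ^ 2 + g' z ^ 2) := by
        have t0 : 0 ≤ 1 - (z - y) := by linarith [hz.2]
        have t1 : 1 - (z - y) ≤ 1 := by linarith [hz.1]
        have : -(2 * g z * g' z) ≤ g z ^ 2 + g' z ^ 2 := by nlinarith [sq_nonneg (g z + g' z)]
        have h5 := mul_le_mul_of_nonneg_right this t0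
        have h6 := mul_le_mul_of_nonneg_left t1 (by positivity : 0 ≤ g z ^ 2 + g' z ^ 2)
        nlinarith [sq_nonneg (g' z)]
      have a3 := mul_le_mul_of_nonneg_right a1 (by positivity : 0 ≤ g z ^ 2 + g' z ^ 2)
      linarith
  have h3 : ∫ z in y..(y+1), 2 * K * (gaussianPDFReal 0 1 z * (g z ^ 2 + g' z ^ 2)) ≤ 2 * K * N := by
    rw [intervalIntegral.integral_const_mul]
    refine mul_le_mul_of_nonneg_left ?_ (by positivity)
    rw [hN, integral_gam, intervalIntegral.integral_of_le (by linarith)]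
    refine setIntegral_le_integral (integrable_gam_iff.1 ((hg.pow 2).add (hg'.pow 2)).integrable) ?_
    exact Eventually.of_forall fun z => mul_nonneg (gaussianPDFReal_nonneg _ _ _) (by positivity)
  have h4 : g y ^ 2 ≤ 2 * K * N := h2.trans h3
  refine abs_le_of_sq_le_sq (h4.trans ?_) (by have := bar_pos 0 y; positivity)
  rw [mul_pow, mul_pow, Real.sq_sqrt hNn]
  have h5 : 2 * √(2 * Real.pi) ≤ 8 := by
    have : √(2 * Real.pi) ≤ 4 := by
      rw [Real.sqrt_le_left (by norm_num)]; linarith [Real.pi_le_four]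
    linarith
  have h6 : Real.exp ((|y| + 1) ^ 2 / 2) ≤ Real.exp 4 * bar 0 y ^ 2 := by
    rw [bar, ← Real.exp_nat_mul, ← Real.exp_add]
    apply Real.exp_le_exp.2
    have : y ^ 2 = |y| ^ 2 := (sq_abs y).symm
    rw [this]; push_cast
    have e2 : |y| ^ 2 / (7 / 2 - 5 * 0) = 2 / 7 * |y| ^ 2 := by ring
    rw [e2]
    linarith [sq_nonneg (|y| - 7)]
  have h7 : Real.exp 4 ≤ 78 := by
    have := Real.exp_one_lt_d9
    have h : Real.exp 4 = Real.exp 1 ^ 4 := by rw [← Real.exp_nat_mul]; norm_num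
    rw [h]
    calc Real.exp 1 ^ 4 ≤ 2.7182818286 ^ 4 := pow_le_pow_left₀ (Real.exp_pos _).le this.le 4
      _ ≤ 78 := by norm_num
  have hb2 : 0 ≤ bar 0 y ^ 2 := by positivity
  calc 2 * K * N = 2 * √(2 * Real.pi) * Real.exp ((|y| + 1) ^ 2 / 2) * N := by rw [hK]; ring
    _ ≤ 8 * (78 * bar 0 y ^ 2) * N := by
        refine mul_le_mul_of_nonneg_right (mul_le_mul h5 (h6.trans ?_) (Real.exp_pos _).le (by norm_num)) hNn
        exact mul_le_mul_of_nonneg_right h7 hb2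
    _ ≤ 25 ^ 2 * N * bar 0 y ^ 2 := by nlinarith [mul_nonneg hb2 hNn]

end SturmPf

namespace SturmPf
open Filter Topology MeasureTheory ProbabilityTheory

/-- heat polynomials -/
noncomputable def V : ℕ → ℝ → ℝ → ℝ
  | 0, _, _ => 1
  | 1, _, y => y
  | (m + 2), τ, y => y * V (m + 1) τ y + 2 * τ * (m + 1) * V m τ y

lemma V_zero (τ y : ℝ) : V 0 τ y = 1 := rfl
lemma V_one (τ y : ℝ) : V 1 τ y = y := rfl
lemma V_two (m : ℕ) (τ y : ℝ) :
    V (m + 2) τ y = y * V (m + 1) τ y + 2 * τ * (m + 1) * V m τ y := rfl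

lemma V_rec (m : ℕ) (τ y : ℝ) : V (m + 1) τ y = y * V m τ y + 2 * τ * m * V (m - 1) τ y := by
  cases m with
  | zero => simp [V_zero, V_one]
  | succ m => simp [V_two]

lemma V_dy (m : ℕ) (τ y : ℝ) : HasDerivAt (V m τ) (m * V (m - 1) τ y) y := by
  induction m using Nat.twoStepInduction with
  | zero =>
    simp only [Nat.cast_zero, zero_mul]
    exact hasDerivAt_const y 1
  | one =>
    simp only [Nat.cast_one, one_mul, Nat.sub_self, V_zero]
    exact hasDerivAt_id' y
  | more m ih1 ih2 =>
    have h := ((hasDerivAt_id' y).fun_mul ih2).fun_add (ih1.const_mul (2 * τ * (m + 1)))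
    refine HasDerivAt.congr_deriv (f := V (m + 2) τ) h ?_
    have e := V_rec m τ y
    simp only [Nat.add_sub_cancel, Nat.cast_add, Nat.cast_one, Nat.cast_ofNat,
      show m + 2 - 1 = m + 1 by omega] at *
    rw [e]; ring

lemma V_dt (m : ℕ) (τ y : ℝ) : HasDerivAt (fun t => V m t y) (m * (m - 1) * V (m - 2) τ y) τ := by
  induction m using Nat.twoStepInduction with
  | zero =>
    simp only [Nat.cast_zero, zero_mul]
    exact hasDerivAt_const τ 1
  | one =>
    simp only [Nat.cast_one, sub_self, mul_zero, zero_mul]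
    exact hasDerivAt_const τ y
  | more m ih1 ih2 =>
    have h := (ih2.const_mul y).fun_add ((((hasDerivAt_id' τ).const_mul 2).mul_const ((m:ℝ) + 1)).fun_mul ih1)
    refine HasDerivAt.congr_deriv (f := fun t => V (m + 2) t y) h ?_
    have e := V_rec m τ y
    cases m with
    | zero => simp [V_zero]; norm_num
    | succ n =>
      have e2 := V_rec n τ y
      simp only [Nat.add_sub_cancel, Nat.cast_add, Nat.cast_one, Nat.cast_ofNat,
        show n + 1 + 2 - 2 = n + 1 by omega, show n + 1 + 1 - 2 = n by omega,
        show n + 1 - 2 = n - 1 by omega] at *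
      rw [e2]; ring

/-- second derivative in y -/
lemma V_dyy (m : ℕ) (τ y : ℝ) :
    HasDerivAt (fun y => (m:ℝ) * V (m - 1) τ y) (m * (m - 1) * V (m - 2) τ y) y := by
  cases m with
  | zero => simpa using hasDerivAt_const y (0:ℝ)
  | succ n =>
    have := (V_dy n τ y).const_mul ((n:ℝ) + 1)
    simp only [Nat.add_sub_cancel, Nat.cast_add, Nat.cast_one, show n + 1 - 2 = n - 1 by omega]
    refine this.congr_deriv ?_
    ring

lemma V_bound (m : ℕ) : ∃ c, 0 ≤ c ∧ ∀ τ, |τ| ≤ 1/2 → ∀ y, |V m τ y| ≤ c * (1 + |y|) ^ m := by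
  induction m using Nat.twoStepInduction with
  | zero => exact ⟨1, zero_le_one, fun τ _ y => by simp [V_zero]⟩
  | one => exact ⟨1, zero_le_one, fun τ _ y => by simp [V_one]⟩
  | more m ih1 ih2 =>
    obtain ⟨c1, h1, b1⟩ := ih1
    obtain ⟨c2, h2, b2⟩ := ih2
    refine ⟨c2 + (m + 1) * c1, by positivity, fun τ hτ y => ?_⟩
    have hw := one_le_w y
    rw [V_two]
    have a1 : |y * V (m + 1) τ y| ≤ c2 * (1 + |y|) ^ (m + 2) := by
      rw [abs_mul]
      calc |y| * |V (m + 1) τ y| ≤ (1 + |y|) * (c2 * (1 + |y|) ^ (m + 1)) :=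
            mul_le_mul (by linarith) (b2 τ hτ y) (abs_nonneg _) (by linarith)
        _ = _ := by ring
    have a2 : |2 * τ * (m + 1) * V m τ y| ≤ (m + 1) * c1 * (1 + |y|) ^ (m + 2) := by
      rw [abs_mul, abs_mul]
      have t1 : |2 * τ| ≤ 1 := by rw [abs_mul]; norm_num; linarith
      have t2 : |(m:ℝ) + 1| = m + 1 := abs_of_pos (by positivity)
      rw [t2]
      calc |2 * τ| * ((m:ℝ) + 1) * |V m τ y| ≤ 1 * (m + 1) * (c1 * (1 + |y|) ^ m) :=
            mul_le_mul (mul_le_mul_of_nonneg_right t1 (by positivity)) (b1 τ hτ y) (abs_nonneg _) (by positivity)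
        _ = (m + 1) * c1 * (1 + |y|) ^ m := by ring
        _ ≤ (m + 1) * c1 * (1 + |y|) ^ (m + 2) :=
            mul_le_mul_of_nonneg_left (pow_le_pow_right₀ hw (by omega)) (by positivity)
    calc _ ≤ _ := abs_add_le _ _
      _ ≤ _ := add_le_add a1 a2
      _ = _ := by ring

lemma V_cont (m : ℕ) (τ : ℝ) : Continuous (V m τ) :=
  continuous_iff_continuousAt.2 fun y => (V_dy m τ y).continuousAt

lemma V_cont2 (m : ℕ) : Continuous (fun p : ℝ × ℝ => V m p.1 p.2) := by
  induction m using Nat.twoStepInduction with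
  | zero => exact continuous_const
  | one => exact continuous_snd
  | more m ih1 ih2 =>
    simp only [V_two]
    fun_prop

lemma V_GC (m : ℕ) (τ : ℝ) (h : |τ| ≤ 1/2) : GC (V m τ) := by
  obtain ⟨c, hc, hb⟩ := V_bound m
  exact ⟨V_cont m τ, c, m, hc, fun y => hb τ h y⟩

lemma V_scale (m : ℕ) (c τ y : ℝ) : V m (c ^ 2 * τ) (c * y) = c ^ m * V m τ y := by
  induction m using Nat.twoStepInduction with
  | zero => simp [V_zero]
  | one => simp [V_one]
  | more m ih1 ih2 => rw [V_two, V_two, ih1, ih2]; ring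

lemma V_neg (m : ℕ) (τ y : ℝ) : V m τ (-y) = (-1) ^ m * V m τ y := by
  have := V_scale m (-1) τ y
  simpa using this

lemma V_simple (m : ℕ) (τ y : ℝ) (hτ : τ ≠ 0) : ¬ (V (m + 1) τ y = 0 ∧ V m τ y = 0) := by
  induction m with
  | zero => simp [V_zero]
  | succ m ih =>
    rintro ⟨h1, h2⟩
    refine ih ⟨h2, ?_⟩
    rw [V_two, h2, mul_zero, zero_add] at h1
    have : 2 * τ * ((m:ℝ) + 1) ≠ 0 := by positivity
    exact (mul_eq_zero.1 h1).resolve_left this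

/-- growth: V_{m+1} ≥ V_m ≥ 1 far out -/
lemma V_large (m : ℕ) (τ y : ℝ) (hτ : -1/2 ≤ τ) (hy : (m:ℝ) + 1 ≤ y) :
    1 ≤ V m τ y ∧ V m τ y ≤ V (m + 1) τ y := by
  induction m with
  | zero => simp [V_zero, V_one] at *; linarith
  | succ m ih =>
    push_cast at hy
    obtain ⟨h1, h2⟩ := ih (by linarith)
    refine ⟨h1.trans h2, ?_⟩
    rw [V_two]
    have hm : (0:ℝ) ≤ (m:ℝ) + 1 := by positivity
    have e1 : -((m:ℝ) + 1) * V m τ y ≤ 2 * τ * (m + 1) * V m τ y := by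
      refine mul_le_mul_of_nonneg_right ?_ (by linarith)
      nlinarith
    have e2 := mul_le_mul_of_nonneg_left h2 hm
    have e3 := mul_le_mul_of_nonneg_right hy (by linarith : 0 ≤ V (m + 1) τ y)
    nlinarith

/-- positivity for positive times -/
lemma V_pos (k : ℕ) (τ y : ℝ) (hτ : 0 < τ) : 0 < V (2 * k) τ y ∧ 0 ≤ y * V (2 * k + 1) τ y := by
  induction k with
  | zero => simp [V_zero, V_one]; nlinarith [sq_nonneg y]
  | succ k ih =>
    obtain ⟨h1, h2⟩ := ih
    have a : 0 < V (2 * (k + 1)) τ y := by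
      rw [show 2 * (k + 1) = 2 * k + 2 by ring, V_two]
      have : 0 < 2 * τ * (((2 * k : ℕ):ℝ) + 1) * V (2 * k) τ y := by positivity
      linarith
    refine ⟨a, ?_⟩
    rw [show 2 * (k + 1) + 1 = (2 * k + 1) + 2 by ring, V_two, mul_add]
    have e : 2 * k + 1 + 1 = 2 * (k + 1) := by ring
    rw [e]
    have t1 : 0 ≤ y * (y * V (2 * (k + 1)) τ y) := by
      rw [← mul_assoc]; exact mul_nonneg (mul_self_nonneg y) a.le
    have t2 : 0 ≤ 2 * τ * (((2 * k + 1 : ℕ):ℝ) + 1) * (y * V (2 * k + 1) τ y) := by positivity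
    linarith

noncomputable def hm (m : ℕ) : ℝ → ℝ := V m (-1/2)

lemma hm_GC (m : ℕ) : GC (hm m) := V_GC m _ (by rw [abs_le]; constructor <;> norm_num)
lemma hm_dy (m : ℕ) (y : ℝ) : HasDerivAt (hm m) (m * hm (m - 1) y) y := V_dy m _ y
lemma hm_rec (m : ℕ) (y : ℝ) : hm (m + 1) y = y * hm m y - m * hm (m - 1) y := by
  unfold hm; rw [V_rec]; ring
lemma hm_dyy (m : ℕ) (y : ℝ) :
    HasDerivAt (fun y => (m:ℝ) * hm (m - 1) y) (m * (m - 1) * hm (m - 2) y) y := V_dyy m _ y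

/-- Hermite eigenvalue equation -/
lemma hm_eig (m : ℕ) (y : ℝ) : y * (m * hm (m - 1) y) - m * (m - 1) * hm (m - 2) y = m * hm m y := by
  cases m with
  | zero => simp
  | succ n =>
    rw [hm_rec]
    simp only [Nat.add_sub_cancel, Nat.cast_add, Nat.cast_one, show n + 1 - 2 = n - 1 by omega]
    ring

/-- creation operator -/
lemma hm_ibp (m : ℕ) {g g' : ℝ → ℝ} (hd : ∀ y, HasDerivAt g (g' y) y) (hg : GC g) (hg' : GC g') :
    ∫ y, hm (m + 1) y * g y ∂gam = ∫ y, hm m y * g' y ∂gam := by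
  have := ibp hd (hm_dy m) hg hg' (hm_GC m) ((hm_GC (m - 1)).smul m)
  have e1 : ∫ y, hm m y * g' y ∂gam = ∫ y, g' y * hm m y ∂gam := by congr 1; ext y; ring
  rw [e1, this]
  congr 1; ext y; rw [hm_rec]; ring

lemma hm_orth (m n : ℕ) : ∫ y, hm m y * hm n y ∂gam = if m = n then (m.factorial : ℝ) else 0 := by
  induction m generalizing n with
  | zero =>
    cases n with
    | zero => simp [hm, V_zero]
    | succ n =>
      have := hm_ibp n (g := fun _ => 1) (g' := fun _ => 0) (fun y => hasDerivAt_const y 1)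
        (GC.const 1) (GC.const 0)
      simp at this
      simp [hm, V_zero] at *
      exact this
  | succ m ih =>
    rw [hm_ibp m (hm_dy n) (hm_GC n) ((hm_GC (n - 1)).smul n)]
    have : ∫ y, hm m y * (n * hm (n - 1) y) ∂gam = n * ∫ y, hm m y * hm (n - 1) y ∂gam := by
      rw [← integral_const_mul]; congr 1; ext y; ring
    rw [this, ih]
    cases n with
    | zero => simp
    | succ n =>
      simp only [Nat.add_sub_cancel, add_left_inj]
      split_ifs with h
      · rw [h, Nat.factorial_succ]; push_cast; ring
      · simp

lemma ypow_span (k : ℕ) : (fun y : ℝ => y ^ k) ∈ Submodule.span ℝ (Set.range hm) := by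
  induction k with
  | zero =>
    refine Submodule.subset_span ⟨0, ?_⟩
    ext y; simp [hm, V_zero]
  | succ k ih =>
    have key : ∀ f ∈ Submodule.span ℝ (Set.range hm), (fun y => y * f y) ∈ Submodule.span ℝ (Set.range hm) := by
      intro f hf
      induction hf using Submodule.span_induction with
      | mem f hf =>
        obtain ⟨m, rfl⟩ := hf
        have : (fun y => y * hm m y) = hm (m + 1) + (m:ℝ) • hm (m - 1) := by
          ext y; simp [hm_rec]
        rw [this]
        exact Submodule.add_mem _ (Submodule.subset_span ⟨_, rfl⟩)
          (Submodule.smul_mem _ _ (Submodule.subset_span ⟨_, rfl⟩))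
      | zero =>
        have := Submodule.zero_mem (Submodule.span ℝ (Set.range hm))
        convert this using 1
        ext y; simp
      | add f g _ _ h1 h2 =>
        have := Submodule.add_mem _ h1 h2
        convert this using 1
        ext y; simp [mul_add]
      | smul c f _ h1 =>
        have := Submodule.smul_mem _ c h1
        convert this using 1
        ext y; simp; ring
    have := key _ ih
    convert this using 1
    ext y; ring

end SturmPf

namespace SturmPf
open Filter Topology MeasureTheory ProbabilityTheory

lemma moments_zero {g : ℝ → ℝ} (hm : Measurable g) (hg : MemLp g 2 gam)
    (h0 : ∀ k : ℕ, ∫ y, g y * y ^ k ∂gam = 0) : g =ᵐ[gam] 0 := by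
  have hgint : Integrable g gam := hg.integrable (by norm_num)
  have hexp : ∀ t : ℝ, Integrable (fun y => |g y| * Real.exp (|t| * |y|)) gam := by
    intro t
    have h1 : Integrable (fun y => Real.exp ((2 * |t|) * |y|)) gam :=
      integrable_exp_mul_abs (integrable_exp_mul_gaussianReal _) (integrable_exp_mul_gaussianReal _)
    have h2 : Integrable (fun y => g y ^ 2) gam := hg.integrable_sq
    refine (h2.add h1).mono' (by fun_prop) (Eventually.of_forall fun y => ?_)
    have : Real.exp ((2 * |t|) * |y|) = Real.exp (|t| * |y|) ^ 2 := by
      rw [← Real.exp_nat_mul]; congr 1; push_cast; ring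
    simp only [Pi.add_apply, this, Real.norm_eq_abs, abs_mul, abs_abs, Real.abs_exp]
    nlinarith [sq_nonneg (|g y| - Real.exp (|t| * |y|)), sq_abs (g y), sq_nonneg (|g y|), sq_nonneg (Real.exp (|t| * |y|))]
  have hcf : ∀ t : ℝ, ∫ y, (g y : ℂ) * Complex.exp (t * y * Complex.I) ∂gam = 0 := by
    intro t
    have key : HasSum (fun k : ℕ => ∫ y, (g y : ℂ) * ((t * y * Complex.I) ^ k / (k.factorial : ℂ)) ∂gam)
        (∫ y, (g y : ℂ) * Complex.exp (t * y * Complex.I) ∂gam) := by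
      have hs : ∀ y : ℝ, HasSum (fun k : ℕ => |g y| * ((|t| * |y|) ^ k / (k.factorial : ℝ))) (|g y| * Real.exp (|t| * |y|)) := by
        intro y
        have := NormedSpace.expSeries_div_hasSum_exp (𝔸 := ℝ) (|t| * |y|)
        rw [← Real.exp_eq_exp_ℝ] at this
        exact this.mul_left _
      refine hasSum_integral_of_dominated_convergence
        (fun k y => |g y| * ((|t| * |y|) ^ k / (k.factorial : ℝ))) ?_ ?_ ?_ ?_ ?_
      · intro k
        exact (by fun_prop : Measurable _).aestronglyMeasurable
      · intro k
        refine Eventually.of_forall fun y => ?_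
        simp [mul_pow]
      · exact Eventually.of_forall fun y => (hs y).summable
      · simp_rw [fun y => (hs y).tsum_eq]
        exact hexp t
      · refine Eventually.of_forall fun y => ?_
        have := NormedSpace.expSeries_div_hasSum_exp (𝔸 := ℂ) (t * y * Complex.I)
        rw [← Complex.exp_eq_exp_ℂ] at this
        exact this.mul_left _
    have hz : ∀ k : ℕ, ∫ y, (g y : ℂ) * ((t * y * Complex.I) ^ k / (k.factorial : ℂ)) ∂gam = 0 := by
      intro k
      have : ∀ y : ℝ, (g y : ℂ) * ((t * y * Complex.I) ^ k / (k.factorial : ℂ))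
          = ((t * Complex.I) ^ k / (k.factorial : ℂ)) * ((g y * y ^ k : ℝ) : ℂ) := by
        intro y; push_cast; rw [mul_pow, mul_pow, mul_pow]; ring
      simp_rw [this]
      rw [integral_const_mul, integral_complex_ofReal, h0 k]; simp
    simp_rw [hz] at key
    exact key.unique hasSum_zero
  have hfin1 : IsFiniteMeasure (gam.withDensity fun x => ENNReal.ofReal (g x)) :=
    isFiniteMeasure_withDensity_ofReal hgint.2
  have hfin2 : IsFiniteMeasure (gam.withDensity fun x => ENNReal.ofReal (- g x)) :=
    isFiniteMeasure_withDensity_ofReal hgint.neg.2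
  have heq : (gam.withDensity fun x => ENNReal.ofReal (g x)) = gam.withDensity fun x => ENNReal.ofReal (- g x) := by
    apply Measure.ext_of_charFun
    ext t
    rw [charFun_apply_real, charFun_apply_real, integral_withDensity_eq_integral_toReal_smul (by fun_prop) (by simp),
      integral_withDensity_eq_integral_toReal_smul (by fun_prop) (by simp), ← sub_eq_zero, ← integral_sub]
    · rw [← hcf t]
      congr 1; ext y
      rw [← sub_smul]
      have : (ENNReal.ofReal (g y)).toReal - (ENNReal.ofReal (- g y)).toReal = g y := by
        rcases le_total 0 (g y) with h | h
        · rw [ENNReal.toReal_ofReal h, ENNReal.ofReal_of_nonpos (by linarith)]; simp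
        · rw [ENNReal.toReal_ofReal (r := - g y) (by linarith), ENNReal.ofReal_of_nonpos h]; simp
      rw [this]; simp
    · refine hgint.mono (by
        exact (by fun_prop : Measurable _).aestronglyMeasurable) (Eventually.of_forall fun y => ?_)
      have e : ((t:ℂ) * y * Complex.I) = ((t * y : ℝ) : ℂ) * Complex.I := by push_cast; ring
      rw [norm_smul, e, Complex.norm_exp_ofReal_mul_I, mul_one]
      rcases le_total 0 (g y) with h | h
      · rw [ENNReal.toReal_ofReal h]
      · rw [ENNReal.ofReal_of_nonpos h]; simp
    · refine hgint.mono (by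
        exact (by fun_prop : Measurable _).aestronglyMeasurable) (Eventually.of_forall fun y => ?_)
      have e : ((t:ℂ) * y * Complex.I) = ((t * y : ℝ) : ℂ) * Complex.I := by push_cast; ring
      rw [norm_smul, e, Complex.norm_exp_ofReal_mul_I, mul_one]
      rcases le_total 0 (g y) with h | h
      · rw [ENNReal.ofReal_of_nonpos (by linarith)]; simp
      · rw [ENNReal.toReal_ofReal (by linarith)]; simp
  have h3 := (withDensity_eq_iff (by fun_prop) (by fun_prop) (by
    have := hgint.lintegral_lt_top; exact this.ne)).1 heq
  filter_upwards [h3] with y hy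
  have := congrArg ENNReal.toReal hy
  rcases le_total 0 (g y) with h | h
  · rw [ENNReal.toReal_ofReal h, ENNReal.ofReal_of_nonpos (by linarith)] at this; simpa using this
  · rw [ENNReal.toReal_ofReal (r := - g y) (by linarith), ENNReal.ofReal_of_nonpos h] at this
    simp at this; simpa using this

noncomputable def hl (m : ℕ) : Lp ℝ 2 gam := (hm_GC m).memLp.toLp _

lemma inner_toLp {u v : ℝ → ℝ} (hu : MemLp u 2 gam) (hv : MemLp v 2 gam) :
    inner ℝ (hu.toLp u) (hv.toLp v) = ∫ y, u y * v y ∂gam := by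
  rw [L2.inner_def]
  apply integral_congr_ae
  filter_upwards [hu.coeFn_toLp, hv.coeFn_toLp] with y h1 h2
  rw [h1, h2]; simp [mul_comm]

noncomputable def hn (m : ℕ) : Lp ℝ 2 gam := (√(m.factorial : ℝ))⁻¹ • hl m

lemma hn_orthonormal : Orthonormal ℝ hn := by
  rw [orthonormal_iff_ite]
  intro i j
  rw [hn, hn, inner_smul_left, inner_smul_right, hl, hl, inner_toLp, hm_orth]
  split_ifs with h
  · subst h
    have : (0:ℝ) < i.factorial := by exact_mod_cast i.factorial_pos
    have h2 := Real.mul_self_sqrt this.le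
    have h3 := Real.sqrt_pos.2 this
    simp only [conj_trivial]
    field_simp
    nlinarith
  · simp

lemma hn_total : (Submodule.span ℝ (Set.range hn))ᗮ = ⊥ := by
  rw [eq_bot_iff]
  intro F hF
  rw [Submodule.mem_orthogonal] at hF
  have hFm : MemLp F 2 gam := Lp.memLp F
  have hFe : hFm.toLp F = F := Lp.toLp_coeFn F hFm
  have h1 : ∀ m, ∫ y, hm m y * F y ∂gam = 0 := by
    intro m
    have h := hF (hn m) (Submodule.subset_span ⟨m, rfl⟩)
    have h0 : (0:ℝ) < m.factorial := by exact_mod_cast m.factorial_pos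
    have h3 := Real.sqrt_pos.2 h0
    rw [hn, inner_smul_left, ← hFe, hl, inner_toLp] at h
    simp only [conj_trivial, mul_eq_zero, inv_eq_zero] at h
    rcases h with h | h
    · linarith
    · exact h
  have h2 : ∀ f ∈ Submodule.span ℝ (Set.range hm), GC f ∧ ∫ y, f y * F y ∂gam = 0 := by
    intro f hf
    induction hf using Submodule.span_induction with
    | mem f hf =>
      obtain ⟨m, rfl⟩ := hf
      exact ⟨hm_GC m, h1 m⟩
    | zero => exact ⟨GC.const 0, by simp⟩
    | add f g _ _ h1 h2 =>
      refine ⟨h1.1.add h2.1, ?_⟩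
      simp only [Pi.add_apply, add_mul]
      have e := integral_add (h1.1.memLp.integrable_mul hFm) (h2.1.memLp.integrable_mul hFm)
      simp only [Pi.mul_apply] at e
      rw [e, h1.2, h2.2]; simp
    | smul c f _ h1 =>
      refine ⟨h1.1.smul c, ?_⟩
      simp only [Pi.smul_apply, smul_eq_mul, mul_assoc]
      rw [integral_const_mul, h1.2]; simp
  have h3 := moments_zero (Lp.stronglyMeasurable F).measurable hFm (fun k => by
    rw [← (h2 _ (ypow_span k)).2]; congr 1; ext y; ring)
  rw [Submodule.mem_bot]
  exact (Lp.eq_zero_iff_ae_eq_zero).2 h3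

/-- Parseval identity for the Hermite expansion. -/
lemma parseval {v : ℝ → ℝ} (hv : GC v) :
    HasSum (fun m : ℕ => (∫ y, v y * hm m y ∂gam) ^ 2 / m.factorial) (∫ y, v y ^ 2 ∂gam) := by
  have h := (HilbertBasis.mkOfOrthogonalEqBot hn_orthonormal hn_total).hasSum_inner_mul_inner
    (hv.memLp.toLp v) (hv.memLp.toLp v)
  simp only [HilbertBasis.coe_mkOfOrthogonalEqBot] at h
  rw [inner_toLp] at h
  have e0 : ∫ y, v y ^ 2 ∂gam = ∫ y, v y * v y ∂gam := by congr 1; ext y; ring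
  rw [e0]
  suffices hh : ∀ m : ℕ, (∫ y, v y * hm m y ∂gam) ^ 2 / (m.factorial : ℝ)
      = inner ℝ (hv.memLp.toLp v) (hn m) * inner ℝ (hn m) (hv.memLp.toLp v) by
    simp_rw [hh]; exact h
  · intro m
    have h0 : (0:ℝ) < m.factorial := by exact_mod_cast m.factorial_pos
    have h3 := Real.sqrt_pos.2 h0
    have h2 := Real.sq_sqrt h0.le
    rw [hn, inner_smul_left, inner_smul_right, hl, inner_toLp, inner_toLp]
    have : ∫ y, hm m y * v y ∂gam = ∫ y, v y * hm m y ∂gam := by congr 1; ext y; ring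
    rw [this]
    simp only [conj_trivial]
    field_simp
    rw [h2]

lemma coef_A {v v' v'' : ℝ → ℝ} (hd : ∀ y, HasDerivAt v (v' y) y) (hd' : ∀ y, HasDerivAt v' (v'' y) y)
    (hv : GC v) (hv' : GC v') (hv'' : GC v'') (m : ℕ) :
    ∫ y, (y * v' y - v'' y) * hm m y ∂gam = m * ∫ y, v y * hm m y ∂gam := by
  have h1 := ibp (hm_dy m) hd' (hm_GC m) ((hm_GC (m - 1)).smul m) hv' hv''
  have h2 := ibp hd (hm_dyy m) hv hv' ((hm_GC (m - 1)).smul m) (by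
    have := (hm_GC (m - 2)).smul (m * (m - 1) : ℝ)
    exact this)
  have e1 : ∫ y, (y * v' y - v'' y) * hm m y ∂gam = ∫ y, hm m y * (y * v' y - v'' y) ∂gam := by
    congr 1; ext y; ring
  have e2 : ∫ y, (m * hm (m - 1) y) * v' y ∂gam = ∫ y, v' y * (m * hm (m - 1) y) ∂gam := by
    congr 1; ext y; ring
  rw [e1, ← h1, e2, h2, ← integral_const_mul]
  congr 1; ext y; rw [hm_eig]; ring

lemma spec {v v' v'' : ℝ → ℝ} (hd : ∀ y, HasDerivAt v (v' y) y) (hd' : ∀ y, HasDerivAt v' (v'' y) y)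
    (hv : GC v) (hv' : GC v') (hv'' : GC v'') (L d : ℝ) (hd0 : 0 ≤ d)
    (h : ∀ m : ℕ, d ≤ |(m:ℝ) - L| ∨ ∫ y, v y * hm m y ∂gam = 0) :
    d ^ 2 * ∫ y, v y ^ 2 ∂gam ≤ ∫ y, (y * v' y - v'' y - L * v y) ^ 2 ∂gam := by
  have hA : GC (fun y => y * v' y - v'' y) := (GC.id.mul hv').sub hv''
  have h1 := (parseval hv).mul_left (d ^ 2)
  have h2 := parseval (hA.sub (hv.smul L))
  refine hasSum_le ?_ h1 h2
  intro m
  have e : ∫ y, (y * v' y - v'' y - L * v y) * hm m y ∂gam = (m - L) * ∫ y, v y * hm m y ∂gam := by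
    rw [sub_mul, ← coef_A hd hd' hv hv' hv'' m, ← integral_const_mul, ← integral_sub]
    · congr 1; ext y; ring
    · exact (hA.mul (hm_GC m)).integrable
    · exact ((hv.mul (hm_GC m)).smul L).integrable
  simp only [e]
  rw [mul_pow, mul_div_assoc]
  have h0 : 0 ≤ (∫ y, v y * hm m y ∂gam) ^ 2 / (m.factorial : ℝ) := by positivity
  rcases h m with h | h
  · apply mul_le_mul_of_nonneg_right _ h0
    rw [← sq_abs ((m:ℝ) - L)]
    exact pow_le_pow_left₀ hd0 h 2
  · simp [h]

lemma spec2 {v v' v'' : ℝ → ℝ} (hd : ∀ y, HasDerivAt v (v' y) y) (hd' : ∀ y, HasDerivAt v' (v'' y) y)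
    (hv : GC v) (hv' : GC v') (hv'' : GC v'') (m : ℕ) :
    ∃ a : ℝ, (∀ y, |v y - a * hm m y| ≤
        25 * √((m + 2) * ∫ y, (y * v' y - v'' y - m * v y) ^ 2 ∂gam) * bar 0 y) ∧
      ∫ y, v y ^ 2 ∂gam ≤ a ^ 2 * m.factorial + ∫ y, (y * v' y - v'' y - m * v y) ^ 2 ∂gam := by
  have h0 : (0:ℝ) < m.factorial := by exact_mod_cast m.factorial_pos
  set c := ∫ y, v y * hm m y ∂gam with hc
  set a := c / m.factorial with ha
  set ρ := ∫ y, (y * v' y - v'' y - m * v y) ^ 2 ∂gam with hρ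
  have hca : c = a * m.factorial := by rw [ha]; field_simp
  have hg : GC (fun y => v y - a * hm m y) := hv.sub ((hm_GC m).smul a)
  have hg' : GC (fun y => v' y - a * (m * hm (m - 1) y)) := hv'.sub (((hm_GC (m-1)).smul m).smul a)
  have hg'' : GC (fun y => v'' y - a * (m * (m - 1) * hm (m - 2) y)) :=
    hv''.sub (((hm_GC (m-2)).smul (m * (m - 1) : ℝ)).smul a)
  have hdg : ∀ y, HasDerivAt (fun y => v y - a * hm m y) (v' y - a * (m * hm (m - 1) y)) y :=
    fun y => (hd y).fun_sub ((hm_dy m y).const_mul a)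
  have hdg' : ∀ y, HasDerivAt (fun y => v' y - a * (m * hm (m - 1) y)) (v'' y - a * (m * (m - 1) * hm (m - 2) y)) y :=
    fun y => (hd' y).fun_sub ((hm_dyy m y).const_mul a)
  have hgm : ∫ y, (v y - a * hm m y) * hm m y ∂gam = 0 := by
    have : ∀ y, (v y - a * hm m y) * hm m y = v y * hm m y - a * (hm m y * hm m y) := fun y => by ring
    simp_rw [this]
    rw [integral_sub (hv.mul (hm_GC m)).integrable (((hm_GC m).mul (hm_GC m)).smul a).integrable,
      integral_const_mul, hm_orth, if_pos rfl, ← hc, hca]; ring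
  have heq : ∀ y, y * (v' y - a * (m * hm (m - 1) y)) - (v'' y - a * (m * (m - 1) * hm (m - 2) y))
      - m * (v y - a * hm m y) = y * v' y - v'' y - m * v y := by
    intro y
    have := hm_eig m y
    linear_combination (-a) * this
  have hs := spec hdg hdg' hg hg' hg'' m 1 (by norm_num) (by
    intro n
    by_cases hnm : n = m
    · right; rw [hnm]; exact hgm
    · left
      have : (1:ℤ) ≤ |(n:ℤ) - m| := Int.one_le_abs (by omega)
      exact_mod_cast this)
  simp_rw [heq] at hs
  rw [← hρ, one_pow, one_mul] at hs
  have hq : GC (fun y => y * v' y - v'' y - m * v y) := ((GC.id.mul hv').sub hv'').sub (hv.smul m)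
  have hs' : ∫ y, (v' y - a * (m * hm (m - 1) y)) ^ 2 ∂gam ≤ (m + 1) * ρ := by
    have h1 := ibp hdg hdg' hg hg' hg' hg''
    have h2 : ∫ y, (v y - a * hm m y) * (y * (v' y - a * (m * hm (m - 1) y)) - (v'' y - a * (m * (m - 1) * hm (m - 2) y))) ∂gam
      ≤ ∫ y, ((1/2) * (y * v' y - v'' y - m * v y) ^ 2 + (m + 1/2) * (v y - a * hm m y) ^ 2) ∂gam := by
      refine integral_mono (hg.mul ((GC.id.mul hg').sub hg'')).integrable
        (((hq.pow 2).smul _).add ((hg.pow 2).smul _)).integrable fun y => ?_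
      have h3 := heq y
      have h4 : y * (v' y - a * (m * hm (m - 1) y)) - (v'' y - a * (m * (m - 1) * hm (m - 2) y))
        = (y * v' y - v'' y - m * v y) + m * (v y - a * hm m y) := by linarith
      simp only [h4]
      nlinarith [sq_nonneg ((y * v' y - v'' y - m * v y) - (v y - a * hm m y))]
    rw [integral_add ((hq.pow 2).smul _).integrable ((hg.pow 2).smul _).integrable, integral_const_mul,
      integral_const_mul, ← h1, ← hρ] at h2
    have h5 : ∫ y, (v' y - a * (m * hm (m - 1) y)) ^ 2 ∂gam = ∫ y, (v' y - a * (m * hm (m - 1) y)) * (v' y - a * (m * hm (m - 1) y)) ∂gam := by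
      congr 1; ext y; ring
    rw [h5]
    have := mul_le_mul_of_nonneg_left hs (by positivity : (0:ℝ) ≤ m + 1/2)
    linarith
  refine ⟨a, fun y => ?_, ?_⟩
  · refine (sobolev hdg hg hg' y).trans ?_
    apply mul_le_mul_of_nonneg_right _ (bar_pos _ _).le
    apply mul_le_mul_of_nonneg_left _ (by norm_num)
    apply Real.sqrt_le_sqrt
    rw [integral_add (hg.pow 2).integrable (hg'.pow 2).integrable]
    linarith
  · have : ∀ y, v y ^ 2 = (v y - a * hm m y) ^ 2 + (2 * a) * ((v y - a * hm m y) * hm m y) + a ^ 2 * (hm m y * hm m y) := fun y => by ring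
    simp_rw [this]
    rw [integral_add ((hg.pow 2).add ((hg.mul (hm_GC m)).smul _)).integrable (((hm_GC m).mul (hm_GC m)).smul _).integrable,
      integral_add (hg.pow 2).integrable ((hg.mul (hm_GC m)).smul _).integrable, integral_const_mul, integral_const_mul, hgm, hm_orth, if_pos rfl]
    linarith

end SturmPf

namespace SturmPf
open Filter Topology MeasureTheory ProbabilityTheory

/-- abstract rescaled flow -/
structure Fr (σ₀ c₁ K : ℝ) (v vs v1 v2 : ℝ → ℝ → ℝ) : Prop where
  ds : ∀ σ, σ₀ < σ → ∀ y, HasDerivAt (fun s => v s y) (vs σ y) σ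
  d1 : ∀ σ, σ₀ ≤ σ → ∀ y, HasDerivAt (v σ) (v1 σ y) y
  d2 : ∀ σ, σ₀ ≤ σ → ∀ y, HasDerivAt (v1 σ) (v2 σ y) y
  c0 : ∀ y, ContinuousOn (fun s => v s y) (Ici σ₀)
  c1 : ∀ y, ContinuousOn (fun s => v1 s y) (Ici σ₀)
  c2 : ∀ y, ContinuousOn (fun s => v2 s y) (Ici σ₀)
  cy2 : ∀ σ, σ₀ ≤ σ → Continuous (v2 σ)
  cys : ∀ σ, σ₀ ≤ σ → Continuous (vs σ)
  b0 : ∀ σ, σ₀ ≤ σ → ∀ y, |v σ y| ≤ K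
  b1 : ∀ σ, σ₀ ≤ σ → ∀ y, |v1 σ y| ≤ K
  b2 : ∀ σ, σ₀ ≤ σ → ∀ y, |v2 σ y| ≤ K
  bs : ∀ σ, σ₀ ≤ σ → ∀ y, |vs σ y| ≤ K * (1 + |y|)
  hK : 0 ≤ K
  hc : 0 ≤ c₁
  eq : ∀ σ, σ₀ ≤ σ → ∀ y, |vs σ y + (y * v1 σ y - v2 σ y)| ≤ c₁ * Real.exp (-σ) * (|v σ y| + |v1 σ y|)

variable {σ₀ c₁ K : ℝ} {v vs v1 v2 : ℝ → ℝ → ℝ}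

lemma GC_of_bdd {g : ℝ → ℝ} (hg : Continuous g) {K : ℝ} (hK : 0 ≤ K) (h : ∀ y, |g y| ≤ K) : GC g :=
  ⟨hg, K, 0, hK, by simpa using h⟩

lemma Fr.g0 (h : Fr σ₀ c₁ K v vs v1 v2) {σ : ℝ} (hσ : σ₀ ≤ σ) : GC (v σ) :=
  GC_of_bdd (continuous_iff_continuousAt.2 fun y => (h.d1 σ hσ y).continuousAt) h.hK (h.b0 σ hσ)
lemma Fr.g1 (h : Fr σ₀ c₁ K v vs v1 v2) {σ : ℝ} (hσ : σ₀ ≤ σ) : GC (v1 σ) :=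
  GC_of_bdd (continuous_iff_continuousAt.2 fun y => (h.d2 σ hσ y).continuousAt) h.hK (h.b1 σ hσ)
lemma Fr.g2 (h : Fr σ₀ c₁ K v vs v1 v2) {σ : ℝ} (hσ : σ₀ ≤ σ) : GC (v2 σ) :=
  GC_of_bdd (h.cy2 σ hσ) h.hK (h.b2 σ hσ)
lemma Fr.gs (h : Fr σ₀ c₁ K v vs v1 v2) {σ : ℝ} (hσ : σ₀ ≤ σ) : GC (vs σ) :=
  ⟨h.cys σ hσ, K, 1, h.hK, by simpa using h.bs σ hσ⟩
lemma Fr.gA (h : Fr σ₀ c₁ K v vs v1 v2) {σ : ℝ} (hσ : σ₀ ≤ σ) : GC (fun y => y * v1 σ y - v2 σ y) :=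
  (GC.id.mul (h.g1 hσ)).sub (h.g2 hσ)

lemma Fr.two_time (h : Fr σ₀ c₁ K v vs v1 v2) {σ : ℝ} (hσ : σ₀ < σ) {F : ℝ → ℝ} {P : ℝ → ℝ → ℝ} {B : ℝ}
    (hF : ∀ s, σ₀ < s → F s - F σ = ∫ y, (v s y - v σ y) * P s y ∂gam)
    (hPc : ∀ y, ContinuousAt (fun s => P s y) σ) (hPy : ∀ s, σ₀ < s → Continuous (P s))
    (hPb : ∀ s, σ₀ < s → ∀ y, |P s y| ≤ B * (1 + |y|)) :
    HasDerivAt F (∫ y, vs σ y * P σ y ∂gam) σ := by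
  rw [hasDerivAt_iff_tendsto_slope]
  have hev : ∀ᶠ s in 𝓝[≠] σ, σ₀ < s := nhdsWithin_le_nhds (lt_mem_nhds hσ)
  have e : (fun s => ∫ y, slope (fun r => v r y) σ s * P s y ∂gam) =ᶠ[𝓝[≠] σ] slope F σ := by
    filter_upwards [hev] with s hs
    rw [slope_def_field, hF s hs, div_eq_inv_mul, ← integral_const_mul]
    congr 1; ext y; rw [slope_def_field]; ring
  refine Tendsto.congr' e ?_
  refine tendsto_integral_filter_of_dominated_convergence (fun y => (K * B) * (1 + |y|) ^ 2) ?_ ?_ ?_ ?_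
  · filter_upwards [hev] with s hs
    simp_rw [slope_def_field]
    have a1 := (h.g0 hs.le).1
    have a2 := (h.g0 hσ.le).1
    have a3 := hPy s hs
    exact (by fun_prop : Continuous _).aestronglyMeasurable
  · filter_upwards [hev, self_mem_nhdsWithin] with s hs hne
    refine Eventually.of_forall fun y => ?_
    have h1 : |slope (fun r => v r y) σ s| ≤ K * (1 + |y|) := by
      have := Convex.norm_image_sub_le_of_norm_hasDerivWithin_le (f := fun r => v r y) (f' := fun r => vs r y)
        (s := Ioi σ₀) (C := K * (1 + |y|)) (x := σ) (y := s)
        (fun r hr => (h.ds r hr y).hasDerivWithinAt) (fun r hr => h.bs r (le_of_lt hr) y)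
        (convex_Ioi _) hσ hs
      rw [slope_def_field, abs_div]
      rw [Real.norm_eq_abs, Real.norm_eq_abs] at this
      exact div_le_of_le_mul₀ (abs_nonneg _) (by have := h.hK; positivity) this
    rw [Real.norm_eq_abs, abs_mul]
    have := mul_le_mul h1 (hPb s hs y) (abs_nonneg _) (by have := h.hK; positivity)
    linarith
  · exact (integrable_wpow 2).const_mul _
  · refine Eventually.of_forall fun y => ?_
    exact (hasDerivAt_iff_tendsto_slope.1 (h.ds σ hσ y)).mul ((hPc y).tendsto.mono_left nhdsWithin_le_nhds)

noncomputable def HH (v : ℝ → ℝ → ℝ) (σ : ℝ) : ℝ := ∫ y, v σ y ^ 2 ∂gam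

lemma Fr.cv (h : Fr σ₀ c₁ K v vs v1 v2) {σ : ℝ} (hσ : σ₀ < σ) (y : ℝ) : ContinuousAt (fun s => v s y) σ :=
  (h.ds σ hσ y).continuousAt

lemma Fr.dH (h : Fr σ₀ c₁ K v vs v1 v2) {σ : ℝ} (hσ : σ₀ < σ) :
    HasDerivAt (HH v) (∫ y, vs σ y * (v σ y + v σ y) ∂gam) σ := by
  refine h.two_time (P := fun s y => v s y + v σ y) (B := 2 * K) hσ ?_ ?_ ?_ ?_
  · intro s hs
    rw [HH, HH, ← integral_sub ((h.g0 hs.le).pow 2).integrable ((h.g0 hσ.le).pow 2).integrable]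
    congr 1; ext y; ring
  · intro y
    exact (h.cv hσ y).add continuousAt_const
  · intro s hs
    exact (h.g0 hs.le).1.add (h.g0 hσ.le).1
  · intro s hs y
    have h1 := h.b0 s hs.le y
    have h2 := h.b0 σ hσ.le y
    have h3 := mul_nonneg h.hK (abs_nonneg y)
    have := abs_add_le (v s y) (v σ y)
    linarith

lemma Fr.dD (h : Fr σ₀ c₁ K v vs v1 v2) {σ : ℝ} (hσ : σ₀ < σ) :
    HasDerivAt (HH v1) (∫ y, vs σ y * ((y * v1 σ y - v2 σ y) + (y * v1 σ y - v2 σ y)) ∂gam) σ := by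
  refine h.two_time (P := fun s y => (y * v1 s y - v2 s y) + (y * v1 σ y - v2 σ y)) (B := 2 * K) hσ ?_ ?_ ?_ ?_
  · intro s hs
    rw [HH, HH, ← integral_sub ((h.g1 hs.le).pow 2).integrable ((h.g1 hσ.le).pow 2).integrable]
    have := ibp (u := fun y => v s y - v σ y) (u' := fun y => v1 s y - v1 σ y)
      (v' := fun y => v1 s y + v1 σ y) (v'' := fun y => v2 s y + v2 σ y)
      (fun y => (h.d1 s hs.le y).fun_sub (h.d1 σ hσ.le y)) (fun y => (h.d2 s hs.le y).fun_add (h.d2 σ hσ.le y))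
      ((h.g0 hs.le).sub (h.g0 hσ.le)) ((h.g1 hs.le).sub (h.g1 hσ.le))
      ((h.g1 hs.le).add (h.g1 hσ.le)) ((h.g2 hs.le).add (h.g2 hσ.le))
    have e1 : ∫ y, (v1 s y ^ 2 - v1 σ y ^ 2) ∂gam = ∫ y, (v1 s y - v1 σ y) * (v1 s y + v1 σ y) ∂gam := by
      congr 1; ext y; ring
    rw [e1, this]
    congr 1; ext y; ring
  · intro y
    have a1 := (h.c1 y).continuousAt (Ici_mem_nhds hσ)
    have a2 := (h.c2 y).continuousAt (Ici_mem_nhds hσ)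
    fun_prop
  · intro s hs
    exact (h.gA hs.le).1.add (h.gA hσ.le).1
  · intro s hs y
    have key : ∀ r, σ₀ < r → |y * v1 r y - v2 r y| ≤ K * (1 + |y|) := by
      intro r hr
      have h1 := h.b1 r hr.le y
      have h2 := h.b2 r hr.le y
      have h4 := mul_le_mul_of_nonneg_left h1 (abs_nonneg y)
      have := abs_sub (y * v1 r y) (v2 r y)
      rw [abs_mul] at this
      linarith
    have := abs_add_le (y * v1 s y - v2 s y) (y * v1 σ y - v2 σ y)
    have h1 := key s hs
    have h2 := key σ hσ
    linarith

lemma HH_cont {K : ℝ} {v : ℝ → ℝ → ℝ} {σ₀ : ℝ} (hc : ∀ y, ContinuousOn (fun s => v s y) (Ici σ₀))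
    (hy : ∀ s, σ₀ ≤ s → Continuous (v s)) (hb : ∀ s, σ₀ ≤ s → ∀ y, |v s y| ≤ K) :
    ContinuousOn (HH v) (Ici σ₀) := by
  refine continuousOn_of_dominated (bound := fun _ => K ^ 2) ?_ ?_ (integrable_const _) ?_
  · intro s hs
    have := hy s hs
    exact (by fun_prop : Continuous _).aestronglyMeasurable
  · intro s hs
    refine Eventually.of_forall fun y => ?_
    rw [Real.norm_eq_abs, abs_pow]
    exact pow_le_pow_left₀ (abs_nonneg _) (hb s hs y) 2
  · exact Eventually.of_forall fun y => (hc y).pow 2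

lemma Fr.cH (h : Fr σ₀ c₁ K v vs v1 v2) : ContinuousOn (HH v) (Ici σ₀) :=
  HH_cont (K := K) h.c0 (fun _ hs => (h.g0 hs).1) h.b0
lemma Fr.cD (h : Fr σ₀ c₁ K v vs v1 v2) : ContinuousOn (HH v1) (Ici σ₀) :=
  HH_cont (K := K) h.c1 (fun _ hs => (h.g1 hs).1) h.b1

lemma HH_nonneg (v : ℝ → ℝ → ℝ) (σ : ℝ) : 0 ≤ HH v σ := integral_nonneg fun y => sq_nonneg _

/-- frequency-type quantity -/
noncomputable def MM (c₁ ε : ℝ) (v v1 : ℝ → ℝ → ℝ) (σ : ℝ) : ℝ :=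
  (HH v1 σ / (HH v σ + ε) + 1) * Real.exp (c₁ ^ 2 * Real.exp (-2 * σ))

lemma Fr.cM (h : Fr σ₀ c₁ K v vs v1 v2) {ε : ℝ} (hε : 0 < ε) : ContinuousOn (MM c₁ ε v v1) (Ici σ₀) := by
  have h1 := h.cH
  have h2 := h.cD
  unfold MM
  refine ContinuousOn.mul (ContinuousOn.add (h2.div (h1.add continuousOn_const) ?_) continuousOn_const) (by fun_prop)
  intro s hs
  have := HH_nonneg v s
  positivity

lemma Fr.dM (h : Fr σ₀ c₁ K v vs v1 v2) {ε : ℝ} (hε : 0 < ε) {σ : ℝ} (hσ : σ₀ < σ) :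
    ∃ M', HasDerivAt (MM c₁ ε v v1) M' σ ∧
      ∫ y, (y * v1 σ y - v2 σ y - (HH v1 σ / (HH v σ + ε)) * v σ y) ^ 2 ∂gam ≤ (- M') * (HH v σ + ε) := by
  have hH := HH_nonneg v σ
  have hD := HH_nonneg v1 σ
  have hp : 0 < HH v σ + ε := by linarith
  have d1 := ((h.dD hσ).fun_div ((h.dH hσ).add_const ε) hp.ne').add_const 1
  have d2 : HasDerivAt (fun s => Real.exp (c₁ ^ 2 * Real.exp (-2 * s)))
      (Real.exp (c₁ ^ 2 * Real.exp (-2 * σ)) * (c₁ ^ 2 * (Real.exp (-2 * σ) * (-2)))) σ := by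
    have := (((hasDerivAt_id' σ).const_mul (-2)).exp.const_mul (c₁ ^ 2)).exp
    exact this.congr_deriv (by ring)
  have d3 := d1.fun_mul d2
  refine ⟨_, d3, ?_⟩
  set H := HH v σ with hHd
  set D := HH v1 σ with hDd
  set L := D / (H + ε) with hL
  have hL0 : 0 ≤ L := by positivity
  have hLD : L * (H + ε) = D := by rw [hL]; field_simp
  set A := fun y => y * v1 σ y - v2 σ y with hA
  have gA : GC A := h.gA hσ.le
  have g0 := h.g0 hσ.le
  have g1 := h.g1 hσ.le
  have gs := h.gs hσ.le
  set E := fun y => vs σ y + A y with hE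
  have gE : GC E := gs.add gA
  set c := c₁ * Real.exp (-σ) with hc
  have hc2 : c₁ ^ 2 * Real.exp (-2 * σ) = c ^ 2 := by
    rw [hc, mul_pow, ← Real.exp_nat_mul]; congr 2; push_cast; ring
  -- basic integrals
  set Q := ∫ y, (A y - L * v σ y) ^ 2 ∂gam with hQ
  set e2 := ∫ y, E y ^ 2 ∂gam with he2
  have i1 : ∫ y, v σ y * A y ∂gam = D := by
    have := ibp (h.d1 σ hσ.le) (h.d2 σ hσ.le) g0 g1 g1 (h.g2 hσ.le)
    rw [← this, hDd, HH]; congr 1; ext y; ring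
  have he2b : e2 ≤ 2 * c ^ 2 * (H + D) := by
    have : ∫ y, E y ^ 2 ∂gam ≤ ∫ y, (2 * c ^ 2) * (v σ y ^ 2 + v1 σ y ^ 2) ∂gam := by
      refine integral_mono (gE.pow 2).integrable (((g0.pow 2).add (g1.pow 2)).smul _).integrable fun y => ?_
      have h1 := h.eq σ hσ.le y
      have h2 := pow_le_pow_left₀ (abs_nonneg _) h1 2
      rw [sq_abs] at h2
      have h3 : (|v σ y| + |v1 σ y|) ^ 2 ≤ 2 * (v σ y ^ 2 + v1 σ y ^ 2) := by
        nlinarith [sq_nonneg (|v σ y| - |v1 σ y|), sq_abs (v σ y), sq_abs (v1 σ y)]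
      have h4 := mul_le_mul_of_nonneg_left h3 (sq_nonneg c)
      simp only [hE, hA]
      rw [mul_pow] at h2
      linarith
    rw [integral_const_mul, integral_add (g0.pow 2).integrable (g1.pow 2).integrable] at this
    exact this
  have keyI : (∫ y, vs σ y * (A y + A y) ∂gam) - L * (∫ y, vs σ y * (v σ y + v σ y) ∂gam) ≤ - Q + e2 := by
    have i2 : (∫ y, vs σ y * (A y + A y) ∂gam) - L * (∫ y, vs σ y * (v σ y + v σ y) ∂gam)
        - ((2 * L ^ 2) * ∫ y, v σ y ^ 2 ∂gam) + (2 * L) * (∫ y, v σ y * A y ∂gam)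
        = ∫ y, (2 * ((vs σ y) * (A y - L * v σ y)) + 2 * L * (v σ y * A y - L * v σ y ^ 2)) ∂gam := by
      rw [integral_add ((gs.mul (gA.sub (g0.smul L))).smul 2).integrable
        (((g0.mul gA).sub ((g0.pow 2).smul L)).smul (2 * L)).integrable, integral_const_mul, integral_const_mul,
        integral_sub (g0.mul gA).integrable ((g0.pow 2).smul L).integrable, integral_const_mul]
      have : ∫ y, vs σ y * (A y - L * v σ y) ∂gam = ∫ y, vs σ y * A y ∂gam - L * ∫ y, vs σ y * v σ y ∂gam := by
        rw [← integral_const_mul, ← integral_sub (gs.mul gA).integrable ((gs.mul g0).smul L).integrable]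
        congr 1; ext y; ring
      rw [this]
      have e3 : ∫ y, vs σ y * (A y + A y) ∂gam = 2 * ∫ y, vs σ y * A y ∂gam := by
        rw [← integral_const_mul]; congr 1; ext y; ring
      have e4 : ∫ y, vs σ y * (v σ y + v σ y) ∂gam = 2 * ∫ y, vs σ y * v σ y ∂gam := by
        rw [← integral_const_mul]; congr 1; ext y; ring
      rw [e3, e4]; ring
    have i3 : ∫ y, (2 * ((vs σ y) * (A y - L * v σ y)) + 2 * L * (v σ y * A y - L * v σ y ^ 2)) ∂gam
        ≤ ∫ y, (E y ^ 2 - (A y - L * v σ y) ^ 2) ∂gam := by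
      refine integral_mono (((gs.mul (gA.sub (g0.smul L))).smul 2).add
        (((g0.mul gA).sub ((g0.pow 2).smul L)).smul (2 * L))).integrable
        ((gE.pow 2).sub ((gA.sub (g0.smul L)).pow 2)).integrable fun y => ?_
      simp only [hE]
      nlinarith [sq_nonneg (vs σ y + A y - (A y - L * v σ y))]
    rw [integral_sub (gE.pow 2).integrable ((gA.sub (g0.smul L)).pow 2).integrable] at i3
    rw [← hQ, ← he2] at i3
    have i4 : ∫ y, v σ y ^ 2 ∂gam = H := rfl
    rw [i1, i4] at i2
    have i5 : 0 ≤ 2 * L * (L * ε) := by positivity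
    have : L * H = D - L * ε := by linarith
    have : 2 * L ^ 2 * H = 2 * L * (D - L * ε) := by rw [← this]; ring
    linarith
  set DD := ∫ y, vs σ y * (A y + A y) ∂gam with hDD
  set dH := ∫ y, vs σ y * (v σ y + v σ y) ∂gam with hdH
  have hx : 1 ≤ Real.exp (c ^ 2) := Real.one_le_exp (sq_nonneg c)
  rw [hc2]
  have e5 : -((DD * (H + ε) - D * dH) / (H + ε) ^ 2 * Real.exp (c ^ 2) +
      (L + 1) * (Real.exp (c ^ 2) * (c₁ ^ 2 * (Real.exp (-2 * σ) * -2)))) * (H + ε)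
      = Real.exp (c ^ 2) * (- (DD - L * dH) + 2 * c ^ 2 * (L + 1) * (H + ε)) := by
    rw [← hc2, hL]
    field_simp
    ring
  change Q ≤ -((DD * (H + ε) - D * dH) / (H + ε) ^ 2 * Real.exp (c ^ 2) +
      (L + 1) * (Real.exp (c ^ 2) * (c₁ ^ 2 * (Real.exp (-2 * σ) * -2)))) * (H + ε)
  rw [e5]
  have hQ0 : 0 ≤ Q := integral_nonneg fun y => sq_nonneg _
  have h6 : Q ≤ - (DD - L * dH) + 2 * c ^ 2 * (L + 1) * (H + ε) := by
    have : 2 * c ^ 2 * (L + 1) * (H + ε) = 2 * c ^ 2 * (H + D) + 2 * c ^ 2 * ε := by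
      rw [← hLD]; ring
    have : 0 ≤ 2 * c ^ 2 * ε := by positivity
    linarith
  have h7 := mul_le_mul_of_nonneg_left h6 (by linarith : 0 ≤ Real.exp (c ^ 2))
  have h8 := mul_le_mul_of_nonneg_right hx hQ0
  linarith

end SturmPf

namespace SturmPf
open Filter Topology MeasureTheory ProbabilityTheory

variable {σ₀ c₁ K : ℝ} {v vs v1 v2 : ℝ → ℝ → ℝ}

lemma Fr.anti (h : Fr σ₀ c₁ K v vs v1 v2) {ε : ℝ} (hε : 0 < ε) : AntitoneOn (MM c₁ ε v v1) (Ici σ₀) := by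
  refine antitoneOn_of_deriv_nonpos (convex_Ici _) (h.cM hε) ?_ ?_
  · intro s hs
    rw [interior_Ici] at hs
    obtain ⟨M', hM, _⟩ := h.dM hε hs
    exact hM.differentiableAt.differentiableWithinAt
  · intro s hs
    rw [interior_Ici] at hs
    obtain ⟨M', hM, hq⟩ := h.dM hε hs
    rw [hM.deriv]
    have h0 : 0 ≤ (- M') * (HH v s + ε) := le_trans (integral_nonneg fun y => sq_nonneg _) hq
    have := HH_nonneg v s
    have := nonneg_of_mul_nonneg_left h0 (by linarith)
    linarith

lemma Fr.mvt (h : Fr σ₀ c₁ K v vs v1 v2) {ε : ℝ} (hε : 0 < ε) {S : ℝ} (hS : σ₀ ≤ S) :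
    ∃ σ ∈ Ioo S (S + 1), ∫ y, (y * v1 σ y - v2 σ y - (HH v1 σ / (HH v σ + ε)) * v σ y) ^ 2 ∂gam
      ≤ (MM c₁ ε v v1 S - MM c₁ ε v v1 (S + 1)) * (HH v σ + ε) := by
  obtain ⟨σ, hσ, he⟩ := exists_deriv_eq_slope (MM c₁ ε v v1) (by linarith : S < S + 1)
    ((h.cM hε).mono fun x hx => le_trans hS hx.1) (fun s hs => by
      obtain ⟨M', hM, _⟩ := h.dM hε (lt_of_le_of_lt hS hs.1)
      exact hM.differentiableAt.differentiableWithinAt)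
  obtain ⟨M', hM, hq⟩ := h.dM hε (lt_of_le_of_lt hS hσ.1)
  refine ⟨σ, hσ, ?_⟩
  rw [hM.deriv] at he
  have : -M' = MM c₁ ε v v1 S - MM c₁ ε v v1 (S + 1) := by rw [he]; ring
  rw [← this]; exact hq

lemma MM_ge {c₁ ε σ : ℝ} (hε : 0 < ε) (v v1 : ℝ → ℝ → ℝ) :
    HH v1 σ / (HH v σ + ε) + 1 ≤ MM c₁ ε v v1 σ := by
  have h1 := HH_nonneg v σ
  have h2 := HH_nonneg v1 σ
  have h3 : 0 ≤ HH v1 σ / (HH v σ + ε) + 1 := by positivity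
  have h4 : 1 ≤ Real.exp (c₁ ^ 2 * Real.exp (-2 * σ)) := Real.one_le_exp (by positivity)
  exact le_mul_of_one_le_right h3 h4

lemma Fr.low (h : Fr σ₀ c₁ K v vs v1 v2) {ε : ℝ} (hε : 0 < ε) {σ : ℝ} (hσ : σ₀ ≤ σ) :
    (HH v σ₀ + ε) * Real.exp (-((2 + 3 * c₁ * Real.exp (-σ₀)) * MM c₁ ε v v1 σ₀) * (σ - σ₀)) ≤ HH v σ + ε := by
  set B := (2 + 3 * c₁ * Real.exp (-σ₀)) * MM c₁ ε v v1 σ₀ with hB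
  have hmono : MonotoneOn (fun s => (HH v s + ε) * Real.exp (B * (s - σ₀))) (Ici σ₀) := by
    have hder : ∀ s, σ₀ < s → HasDerivAt (fun s => (HH v s + ε) * Real.exp (B * (s - σ₀)))
        ((∫ y, vs s y * (v s y + v s y) ∂gam) * Real.exp (B * (s - σ₀)) +
          (HH v s + ε) * (Real.exp (B * (s - σ₀)) * B)) s := by
      intro s hs
      have := ((h.dH hs).add_const ε).fun_mul (((hasDerivAt_id' s).sub_const σ₀).const_mul B).exp
      exact this.congr_deriv (by ring)
    refine monotoneOn_of_deriv_nonneg (convex_Ici _) ?_ ?_ ?_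
    · exact (h.cH.add continuousOn_const).mul (by fun_prop)
    · intro s hs
      rw [interior_Ici] at hs
      exact (hder s hs).differentiableAt.differentiableWithinAt
    · intro s hs
      rw [interior_Ici] at hs
      rw [(hder s hs).deriv]
      have hs' : σ₀ ≤ s := le_of_lt hs
      have hc := h.hc
      set c := c₁ * Real.exp (-s) with hcd
      have hc0 : 0 ≤ c := by positivity
      have hcc : c ≤ c₁ * Real.exp (-σ₀) := by
        apply mul_le_mul_of_nonneg_left _ hc
        exact Real.exp_le_exp.2 (by linarith)
      have g0 := h.g0 hs'
      have g1 := h.g1 hs'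
      have gA := h.gA hs'
      have gs := h.gs hs'
      have hH := HH_nonneg v s
      have hD := HH_nonneg v1 s
      have i1 : ∫ y, v s y * (y * v1 s y - v2 s y) ∂gam = HH v1 s := by
        have := ibp (h.d1 s hs') (h.d2 s hs') g0 g1 g1 (h.g2 hs')
        rw [← this, HH]; congr 1; ext y; ring
      have i2 : ∫ y, ((-2) * (v s y * (y * v1 s y - v2 s y)) + (-c) * (3 * v s y ^ 2 + v1 s y ^ 2)) ∂gam
          ≤ ∫ y, vs s y * (v s y + v s y) ∂gam := by
        refine integral_mono (((g0.mul gA).smul _).add ((((g0.pow 2).smul 3).add (g1.pow 2)).smul _)).integrable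
          (gs.mul (g0.add g0)).integrable fun y => ?_
        have h1 := h.eq s hs' y
        rw [← hcd] at h1
        have h2 := mul_le_mul_of_nonneg_right h1 (abs_nonneg (v s y))
        rw [← abs_mul] at h2
        have h3 := neg_le_of_abs_le (le_refl |(vs s y + (y * v1 s y - v2 s y)) * v s y|)
        have h4 : 2 * ((|v s y| + |v1 s y|) * |v s y|) ≤ 3 * v s y ^ 2 + v1 s y ^ 2 := by
          nlinarith [sq_nonneg (|v s y| - |v1 s y|), sq_abs (v s y), sq_abs (v1 s y)]
        have h5 := mul_le_mul_of_nonneg_left h4 hc0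
        simp only
        linarith
      rw [integral_add ((g0.mul gA).smul _).integrable ((((g0.pow 2).smul 3).add (g1.pow 2)).smul _).integrable,
        integral_const_mul, integral_const_mul, integral_add ((g0.pow 2).smul 3).integrable (g1.pow 2).integrable,
        integral_const_mul, i1] at i2
      change _ * _ + -c * (3 * HH v s + HH v1 s) ≤ _ at i2
      have hM := h.anti hε self_mem_Ici hs' hs'
      have hM2 := MM_ge (c₁ := c₁) (σ := s) hε v v1
      have hB2 : (2 + 3 * c) * (HH v1 s / (HH v s + ε) + 1) ≤ B := by
        rw [hB]
        have : 0 ≤ HH v1 s / (HH v s + ε) + 1 := by positivity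
        apply mul_le_mul _ (hM2.trans hM) this (by positivity)
        linarith
      have h6 := mul_le_mul_of_nonneg_right hB2 (by linarith : 0 ≤ HH v s + ε)
      have h7 : (2 + 3 * c) * (HH v1 s / (HH v s + ε) + 1) * (HH v s + ε) = (2 + 3 * c) * (HH v1 s + HH v s + ε) := by
        have : HH v s + ε ≠ 0 := by positivity
        field_simp
        ring
      have h8 : 0 ≤ (∫ y, vs s y * (v s y + v s y) ∂gam) + (HH v s + ε) * B := by
        rw [h7] at h6
        have := mul_nonneg hc0 hD
        have := mul_nonneg hc0 hH
        have := mul_nonneg hc0 hε.le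
        linarith
      have := mul_nonneg h8 (Real.exp_pos (B * (s - σ₀))).le
      linarith
  clear_value B
  have := hmono self_mem_Ici hσ hσ
  simp only [sub_self, mul_zero, Real.exp_zero, mul_one] at this
  have e := mul_le_mul_of_nonneg_right this (Real.exp_pos (-(B * (σ - σ₀)))).le
  rw [mul_assoc, ← Real.exp_add] at e
  simpa using e

end SturmPf

namespace SturmPf
open Filter Topology MeasureTheory ProbabilityTheory

/-- smooth approximate solutions of a linear parabolic inequality -/
structure Cl (C a b : ℝ) (w wt wx wxx : ℝ → ℝ → ℝ) : Prop where
  dt : ∀ t ∈ Icc a b, ∀ x, HasDerivAt (fun s => w s x) (wt t x) t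
  dx : ∀ t ∈ Icc a b, ∀ x, HasDerivAt (w t) (wx t x) x
  dxx : ∀ t ∈ Icc a b, ∀ x, HasDerivAt (wx t) (wxx t x) x
  cw : ContinuousOn (fun p : ℝ × ℝ => w p.1 p.2) (Icc a b ×ˢ univ)
  ct : ContinuousOn (fun p : ℝ × ℝ => wt p.1 p.2) (Icc a b ×ˢ univ)
  cx : ContinuousOn (fun p : ℝ × ℝ => wx p.1 p.2) (Icc a b ×ˢ univ)
  cxx : ContinuousOn (fun p : ℝ × ℝ => wxx p.1 p.2) (Icc a b ×ˢ univ)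
  bdd : ∃ K, ∀ t ∈ Icc a b, ∀ x, |w t x| ≤ K ∧ |wt t x| ≤ K ∧ |wx t x| ≤ K ∧ |wxx t x| ≤ K
  hC : 0 ≤ C
  eq : ∀ t ∈ Icc a b, ∀ x, |wt t x - wxx t x| ≤ C * (|w t x| + |wx t x|)

/-- uniform `C¹` limits of such -/
structure SC (C a b : ℝ) (w wx : ℝ → ℝ → ℝ) : Prop where
  per : ∀ t, Function.Periodic (w t) 1
  dx : ∀ t ∈ Icc a b, ∀ x, HasDerivAt (w t) (wx t x) x
  cw : ContinuousOn (fun p : ℝ × ℝ => w p.1 p.2) (Icc a b ×ˢ univ)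
  cx : ContinuousOn (fun p : ℝ × ℝ => wx p.1 p.2) (Icc a b ×ˢ univ)
  ap : ∀ ε > 0, ∃ w' wt' wx' wxx', Cl C a b w' wt' wx' wxx' ∧
    ∀ t ∈ Icc a b, ∀ x, |w t x - w' t x| ≤ ε ∧ |wx t x - wx' t x| ≤ ε

noncomputable def sc (t₀ x₀ : ℝ) (w : ℝ → ℝ → ℝ) (σ y : ℝ) : ℝ :=
  w (t₀ - Real.exp (-σ) ^ 2 / 2) (x₀ + Real.exp (-σ) * y)

variable {C a b t₀ x₀ σ₀ : ℝ} {w wt wx wxx : ℝ → ℝ → ℝ}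

lemma tmem (ht : t₀ ≤ b) (hσ₀ : Real.exp (-σ₀) ^ 2 / 2 ≤ t₀ - a) {σ : ℝ} (hσ : σ₀ ≤ σ) :
    t₀ - Real.exp (-σ) ^ 2 / 2 ∈ Icc a b := by
  have h1 : Real.exp (-σ) ≤ Real.exp (-σ₀) := Real.exp_le_exp.2 (by linarith)
  have h2 := pow_le_pow_left₀ (Real.exp_pos (-σ)).le h1 2
  have := sq_nonneg (Real.exp (-σ))
  constructor <;> linarith

lemma sc_cs (ht : t₀ ≤ b) (hσ₀ : Real.exp (-σ₀) ^ 2 / 2 ≤ t₀ - a)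
    (hc : ContinuousOn (fun p : ℝ × ℝ => w p.1 p.2) (Icc a b ×ˢ univ)) (y : ℝ) :
    ContinuousOn (fun s => sc t₀ x₀ w s y) (Ici σ₀) := by
  have := hc.comp (f := fun s : ℝ => (t₀ - Real.exp (-s) ^ 2 / 2, x₀ + Real.exp (-s) * y)) (s := Ici σ₀)
    (by fun_prop) (fun s hs => ⟨tmem ht hσ₀ hs, mem_univ _⟩)
  exact this

lemma sl_cont (hc : ContinuousOn (fun p : ℝ × ℝ => w p.1 p.2) (Icc a b ×ˢ univ)) {t : ℝ} (ht : t ∈ Icc a b) :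
    Continuous (w t) := by
  have := hc.comp (f := fun x : ℝ => (t, x)) (s := univ) (by fun_prop) (fun s _ => ⟨ht, mem_univ _⟩)
  exact continuousOn_univ.1 this

lemma sc_cy (ht : t₀ ≤ b) (hσ₀ : Real.exp (-σ₀) ^ 2 / 2 ≤ t₀ - a)
    (hc : ContinuousOn (fun p : ℝ × ℝ => w p.1 p.2) (Icc a b ×ˢ univ)) {σ : ℝ} (hσ : σ₀ ≤ σ) :
    Continuous (sc t₀ x₀ w σ) := by
  have := sl_cont hc (tmem ht hσ₀ hσ)
  unfold sc
  fun_prop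

lemma Cl.chain (h : Cl C a b w wt wx wxx) {τ ξ : ℝ → ℝ} {τ' ξ' σ : ℝ} (hτ : HasDerivAt τ τ' σ)
    (hξ : HasDerivAt ξ ξ' σ) (hm : τ σ ∈ Ioo a b) :
    HasDerivAt (fun s => w (τ s) (ξ s)) (wt (τ σ) (ξ σ) * τ' + wx (τ σ) (ξ σ) * ξ') σ := by
  have hn : Icc a b ×ˢ (univ : Set ℝ) ∈ 𝓝 (τ σ, ξ σ) :=
    prod_mem_nhds (Icc_mem_nhds hm.1 hm.2) univ_mem
  have key := hasStrictFDerivAt_uncurry_coprod (𝕜 := ℝ) (u := (τ σ, ξ σ)) (f := w)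
    (f₁ := fun t x => ContinuousLinearMap.toSpanSingleton ℝ (wt t x))
    (f₂ := fun t x => ContinuousLinearMap.toSpanSingleton ℝ (wx t x))
    (by filter_upwards [hn] with p hp using (h.dt p.1 hp.1 p.2).hasFDerivAt)
    (by filter_upwards [hn] with p hp using (h.dx p.1 hp.1 p.2).hasFDerivAt)
    ((ContinuousLinearMap.toSpanSingletonCLE (𝕜 := ℝ) (E := ℝ)).continuous.continuousAt.comp (h.ct.continuousAt hn))
    ((ContinuousLinearMap.toSpanSingletonCLE (𝕜 := ℝ) (E := ℝ)).continuous.continuousAt.comp (h.cx.continuousAt hn))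
  have := key.hasFDerivAt.comp_hasDerivAt σ (hτ.prodMk hξ)
  refine this.congr_deriv ?_
  simp [Function.HasUncurry.uncurry]
  ring

lemma Cl.fr (h : Cl C a b w wt wx wxx) (ht : t₀ ≤ b) (hσ₀ : Real.exp (-σ₀) ^ 2 / 2 ≤ t₀ - a) :
    ∃ K, Fr σ₀ (C * (1 + Real.exp (-σ₀))) K (sc t₀ x₀ w)
      (fun σ y => Real.exp (-σ) ^ 2 * sc t₀ x₀ wt σ y - y * (Real.exp (-σ) * sc t₀ x₀ wx σ y))
      (fun σ y => Real.exp (-σ) * sc t₀ x₀ wx σ y)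
      (fun σ y => Real.exp (-σ) ^ 2 * sc t₀ x₀ wxx σ y) := by
  obtain ⟨K, hK⟩ := h.bdd
  set l := Real.exp (-σ₀) with hl
  have hl0 : 0 < l := Real.exp_pos _
  have hle : ∀ σ, σ₀ ≤ σ → Real.exp (-σ) ≤ l := fun σ hσ => Real.exp_le_exp.2 (by linarith)
  have hK0 : 0 ≤ K := le_trans (abs_nonneg _) (hK _ (tmem ht hσ₀ le_rfl) x₀).1
  have hb : ∀ σ, σ₀ ≤ σ → ∀ y, |sc t₀ x₀ w σ y| ≤ K ∧ |sc t₀ x₀ wt σ y| ≤ K ∧ |sc t₀ x₀ wx σ y| ≤ K ∧ |sc t₀ x₀ wxx σ y| ≤ K :=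
    fun σ hσ y => hK _ (tmem ht hσ₀ hσ) _
  have hl1 : ∀ σ, σ₀ ≤ σ → ∀ z, |z| ≤ K → |Real.exp (-σ) * z| ≤ l * K := by
    intro σ hσ z hz
    rw [abs_mul, Real.abs_exp]
    exact mul_le_mul (hle σ hσ) hz (abs_nonneg _) hl0.le
  have hl2 : ∀ σ, σ₀ ≤ σ → ∀ z, |z| ≤ K → |Real.exp (-σ) ^ 2 * z| ≤ l ^ 2 * K := by
    intro σ hσ z hz
    rw [abs_mul, abs_pow, Real.abs_exp]
    exact mul_le_mul (pow_le_pow_left₀ (Real.exp_pos _).le (hle σ hσ) 2) hz (abs_nonneg _) (by positivity)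
  have hlK : 0 ≤ l * K := by positivity
  have hlK2 : 0 ≤ l ^ 2 * K := by positivity
  refine ⟨K * (1 + l + l ^ 2), ?_, ?_, ?_, ?_, ?_, ?_, ?_, ?_, ?_, ?_, ?_, ?_, ?_, ?_, ?_⟩
  · -- time derivative: chain rule along a curve
    intro σ hσ y
    have hm : t₀ - Real.exp (-σ) ^ 2 / 2 ∈ Ioo a b := by
      have h1 : Real.exp (-σ) < Real.exp (-σ₀) := Real.exp_lt_exp.2 (by linarith)
      have h2 := pow_lt_pow_left₀ h1 (Real.exp_pos (-σ)).le (by norm_num : 2 ≠ 0)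
      have := pow_pos (Real.exp_pos (-σ)) 2
      constructor <;> linarith
    have h1 : HasDerivAt (fun s : ℝ => Real.exp (-s)) (- Real.exp (-σ)) σ := by
      have := (hasDerivAt_neg σ).exp
      exact this.congr_deriv (by ring)
    have := h.chain (((h1.fun_pow 2).div_const 2).const_sub t₀) ((h1.mul_const y).const_add x₀) hm
    exact this.congr_deriv (by simp only [sc]; push_cast; ring)
  · intro σ hσ y
    have := (h.dx _ (tmem ht hσ₀ hσ) (x₀ + Real.exp (-σ) * y)).comp y
      (((hasDerivAt_id' y).const_mul (Real.exp (-σ))).const_add x₀)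
    exact this.congr_deriv (by simp only [sc]; ring)
  · intro σ hσ y
    have := ((h.dxx _ (tmem ht hσ₀ hσ) (x₀ + Real.exp (-σ) * y)).comp y
      (((hasDerivAt_id' y).const_mul (Real.exp (-σ))).const_add x₀)).const_mul (Real.exp (-σ))
    exact this.congr_deriv (by simp only [sc]; ring)
  · intro y
    exact sc_cs ht hσ₀ h.cw y
  · intro y
    exact ContinuousOn.mul (by fun_prop) (sc_cs ht hσ₀ h.cx y)
  · intro y
    exact ContinuousOn.mul (by fun_prop) (sc_cs ht hσ₀ h.cxx y)
  · intro σ hσ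
    exact continuous_const.mul (sc_cy ht hσ₀ h.cxx hσ)
  · intro σ hσ
    have h1 := sc_cy (x₀ := x₀) ht hσ₀ h.ct hσ
    have h2 := sc_cy (x₀ := x₀) ht hσ₀ h.cx hσ
    fun_prop
  · intro σ hσ y
    have := (hb σ hσ y).1
    linarith
  · intro σ hσ y
    have := hl1 σ hσ _ (hb σ hσ y).2.2.1
    linarith
  · intro σ hσ y
    have := hl2 σ hσ _ (hb σ hσ y).2.2.2
    linarith
  · intro σ hσ y
    have h1 := hl2 σ hσ _ (hb σ hσ y).2.1
    have h2 := hl1 σ hσ _ (hb σ hσ y).2.2.1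
    have h3 := abs_sub (Real.exp (-σ) ^ 2 * sc t₀ x₀ wt σ y) (y * (Real.exp (-σ) * sc t₀ x₀ wx σ y))
    rw [abs_mul y] at h3
    have h4 := mul_le_mul_of_nonneg_left h2 (abs_nonneg y)
    have h5 : 0 ≤ K * (1 + l ^ 2) * |y| := by positivity
    linarith
  · positivity
  · have := h.hC
    positivity
  · intro σ hσ y
    have h1 := h.eq _ (tmem ht hσ₀ hσ) (x₀ + Real.exp (-σ) * y)
    have h2 := hle σ hσ
    have hp := Real.exp_pos (-σ)
    have hC := h.hC
    simp only [sc]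
    set W := w (t₀ - Real.exp (-σ) ^ 2 / 2) (x₀ + Real.exp (-σ) * y)
    set Wx := wx (t₀ - Real.exp (-σ) ^ 2 / 2) (x₀ + Real.exp (-σ) * y)
    set Wt := wt (t₀ - Real.exp (-σ) ^ 2 / 2) (x₀ + Real.exp (-σ) * y)
    set Wxx := wxx (t₀ - Real.exp (-σ) ^ 2 / 2) (x₀ + Real.exp (-σ) * y)
    set e := Real.exp (-σ)
    have e1 : e ^ 2 * Wt - y * (e * Wx) + (y * (e * Wx) - e ^ 2 * Wxx) = e ^ 2 * (Wt - Wxx) := by ring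
    rw [e1, abs_mul, abs_mul, abs_pow, abs_of_pos hp]
    have h3 := mul_le_mul_of_nonneg_left h1 (sq_nonneg e)
    refine h3.trans ?_
    have h4 : 0 ≤ C * e * |W| * (1 + l - e) := mul_nonneg (by positivity) (by linarith)
    have h5 : 0 ≤ C * e * (e * |Wx|) * l := by positivity
    linarith

end SturmPf

namespace SturmPf
open Filter Topology MeasureTheory ProbabilityTheory

lemma HH_lim {F : ℕ → ℝ → ℝ} {f : ℝ → ℝ} {K : ℝ} (hF : ∀ n, Continuous (F n)) (hb : ∀ n y, |F n y| ≤ K)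
    {δ : ℕ → ℝ} (hd : ∀ n y, |f y - F n y| ≤ δ n) (hδ : Tendsto δ atTop (𝓝 0)) :
    Tendsto (fun n => ∫ y, F n y ^ 2 ∂gam) atTop (𝓝 (∫ y, f y ^ 2 ∂gam)) := by
  refine tendsto_integral_of_dominated_convergence (fun _ => K ^ 2) ?_ (integrable_const _) ?_ ?_
  · intro n
    have := hF n
    exact (by fun_prop : Continuous _).aestronglyMeasurable
  · intro n
    refine Eventually.of_forall fun y => ?_
    rw [Real.norm_eq_abs, abs_pow]
    exact pow_le_pow_left₀ (abs_nonneg _) (hb n y) 2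
  · refine Eventually.of_forall fun y => ?_
    refine Tendsto.pow ?_ 2
    rw [tendsto_iff_dist_tendsto_zero]
    refine squeeze_zero (fun _ => dist_nonneg) (fun n => ?_) hδ
    rw [dist_comm, Real.dist_eq]; exact hd n y

lemma HH_pos {f : ℝ → ℝ} (hf : Continuous f) {K : ℝ} (hb : ∀ y, |f y| ≤ K) (hne : ∃ y, f y ≠ 0) :
    0 < ∫ y, f y ^ 2 ∂gam := by
  have hK : 0 ≤ K := le_trans (abs_nonneg _) (hb 0)
  have hg : GC f := GC_of_bdd hf hK hb
  rcases (integral_nonneg (μ := gam) (f := fun y => f y ^ 2) fun y => sq_nonneg _).lt_or_eq with h | h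
  · exact h
  · exfalso
    have h1 := (integral_eq_zero_iff_of_nonneg (fun y => sq_nonneg _) (hg.pow 2).integrable).1 h.symm
    have h2 : (fun y => f y ^ 2) =ᵐ[volume] (fun _ => 0) :=
      (gaussianReal_absolutelyContinuous' 0 (by norm_num)).ae_eq h1
    have h3 := Continuous.ae_eq_iff_eq volume (hf.pow 2) continuous_const |>.1 h2
    obtain ⟨y, hy⟩ := hne
    have := congrFun h3 y
    simp at this
    exact hy this

lemma SC.bdd {C a b : ℝ} {w wx : ℝ → ℝ → ℝ} (h : SC C a b w wx) :
    ∃ K, ∀ t ∈ Icc a b, ∀ x, |w t x| ≤ K ∧ |wx t x| ≤ K := by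
  obtain ⟨w', wt', wx', wxx', hc, hcl⟩ := h.ap 1 one_pos
  obtain ⟨K, hK⟩ := hc.bdd
  refine ⟨K + 1, fun t ht x => ?_⟩
  have h1 := hcl t ht x
  have h2 := hK t ht x
  have h3 := abs_sub_abs_le_abs_sub (w t x) (w' t x)
  have h4 := abs_sub_abs_le_abs_sub (wx t x) (wx' t x)
  constructor <;> linarith

lemma freq_arith {I Q H η ε L D : ℝ} (hfin : I ≤ 2 * Q + 2 * D ^ 2 * H) (hQ2 : Q ≤ 8 * η * H)
    (hab : D ^ 2 ≤ (η * (2 + L)) ^ 2) (hH0 : 0 ≤ H) (hη2 : η * (16 + 2 * (2 + L) ^ 2) ≤ ε ^ 2)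
    (hη0 : 0 < η) (hη1 : η ≤ 1) : I ≤ ε ^ 2 * H := by
  have h9 := mul_le_mul_of_nonneg_right hab hH0
  have h10 := mul_le_mul_of_nonneg_right hη2 hH0
  have h11 : (η * (2 + L)) ^ 2 * H ≤ η * (2 + L) ^ 2 * H := by
    apply mul_le_mul_of_nonneg_right _ hH0
    have : 0 ≤ η * (1 - η) * (2 + L) ^ 2 := mul_nonneg (mul_nonneg hη0.le (by linarith)) (sq_nonneg _)
    linarith
  linarith

lemma freq_arith2 (p q Λ L : ℝ) : (p - L * q) ^ 2 ≤ 2 * (p - Λ * q) ^ 2 + (2 * (Λ - L) ^ 2) * q ^ 2 := by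
  have := sq_nonneg ((p - Λ * q) - (Λ - L) * q)
  linarith

set_option maxHeartbeats 1000000 in
lemma freq0 {C a b t₀ : ℝ} {w wx : ℝ → ℝ → ℝ} (h : SC C a b w wx) (hat : a < t₀) (htb : t₀ ≤ b) (x₀ : ℝ)
    (hne : ∃ x, w a x ≠ 0) :
    ∃ L : ℝ, ∀ ε > 0, ∀ δ > 0, ∃ l : ℝ, 0 < l ∧ l < δ ∧ l ^ 2 / 2 < t₀ - a ∧
      ∃ w' wt' wx' wxx' : ℝ → ℝ → ℝ, Cl C a b w' wt' wx' wxx' ∧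
      0 < ∫ y, w' (t₀ - l ^ 2 / 2) (x₀ + l * y) ^ 2 ∂gam ∧
      (∀ t ∈ Icc a b, ∀ x,
        |w t x - w' t x| ≤ ε * √(∫ y, w' (t₀ - l ^ 2 / 2) (x₀ + l * y) ^ 2 ∂gam) ∧
        |wx t x - wx' t x| ≤ ε * √(∫ y, w' (t₀ - l ^ 2 / 2) (x₀ + l * y) ^ 2 ∂gam)) ∧
      ∫ y, (y * (l * wx' (t₀ - l ^ 2 / 2) (x₀ + l * y)) - l ^ 2 * wxx' (t₀ - l ^ 2 / 2) (x₀ + l * y)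
        - L * w' (t₀ - l ^ 2 / 2) (x₀ + l * y)) ^ 2 ∂gam
        ≤ ε ^ 2 * ∫ y, w' (t₀ - l ^ 2 / 2) (x₀ + l * y) ^ 2 ∂gam := by
  obtain ⟨K, hK⟩ := h.bdd
  have hapn : ∀ n : ℕ, ∃ w' wt' wx' wxx', Cl C a b w' wt' wx' wxx' ∧
      ∀ t ∈ Icc a b, ∀ x, |w t x - w' t x| ≤ 1 / ((n:ℝ) + 1) ∧ |wx t x - wx' t x| ≤ 1 / ((n:ℝ) + 1) :=
    fun n => h.ap _ (by positivity)
  choose W Wt Wx Wxx hCl hcl using hapn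
  have hen : ∀ n : ℕ, 0 < 1 / ((n:ℝ) + 1) := fun n => by positivity
  have hen1 : ∀ n : ℕ, 1 / ((n:ℝ) + 1) ≤ 1 := fun n => by
    rw [div_le_one (by positivity)]; linarith [n.cast_nonneg (α := ℝ)]
  have het : Tendsto (fun n : ℕ => 1 / ((n:ℝ) + 1)) atTop (𝓝 0) := tendsto_one_div_add_atTop_nhds_zero_nat
  -- initial time
  set σ₀ := - Real.log (√(2 * (t₀ - a))) with hσd
  have hs0 : 0 < √(2 * (t₀ - a)) := Real.sqrt_pos.2 (by linarith)
  have hσe : Real.exp (-σ₀) = √(2 * (t₀ - a)) := by rw [hσd, neg_neg, Real.exp_log hs0]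
  have hσ2 : Real.exp (-σ₀) ^ 2 / 2 = t₀ - a := by rw [hσe, Real.sq_sqrt (by linarith)]; ring
  have hσ₀ : Real.exp (-σ₀) ^ 2 / 2 ≤ t₀ - a := hσ2.le
  set c₁ := C * (1 + Real.exp (-σ₀)) with hc₁
  set v := sc t₀ x₀ w with hv
  set v1 := fun σ y => Real.exp (-σ) * sc t₀ x₀ wx σ y with hv1
  set V := fun n => sc t₀ x₀ (W n) with hV
  set V1 := fun n σ y => Real.exp (-σ) * sc t₀ x₀ (Wx n) σ y with hV1
  set V2 := fun n σ y => Real.exp (-σ) ^ 2 * sc t₀ x₀ (Wxx n) σ y with hV2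
  have hfr : ∀ n, ∃ vs K, Fr σ₀ c₁ K (V n) vs (V1 n) (V2 n) := fun n => by
    obtain ⟨K, hh⟩ := (hCl n).fr (x₀ := x₀) htb hσ₀
    exact ⟨_, K, hh⟩
  choose Vs KK hFr using hfr
  have hcv : ∀ σ, σ₀ ≤ σ → Continuous (v σ) := fun σ hσ => sc_cy htb hσ₀ h.cw hσ
  have hHlim : ∀ σ, σ₀ ≤ σ → Tendsto (fun n => HH (V n) σ) atTop (𝓝 (HH v σ)) := by
    intro σ hσ
    refine HH_lim (K := K + 1) (δ := fun n : ℕ => 1 / ((n:ℝ) + 1)) (fun n => ((hFr n).g0 hσ).1) ?_ ?_ het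
    · intro n y
      have h1 := (hcl n _ (tmem htb hσ₀ hσ) (x₀ + Real.exp (-σ) * y)).1
      have h2 := (hK _ (tmem htb hσ₀ hσ) (x₀ + Real.exp (-σ) * y)).1
      have h3 := abs_sub_abs_le_abs_sub (W n (t₀ - Real.exp (-σ) ^ 2 / 2) (x₀ + Real.exp (-σ) * y))
        (w (t₀ - Real.exp (-σ) ^ 2 / 2) (x₀ + Real.exp (-σ) * y))
      rw [abs_sub_comm] at h3
      have := hen1 n
      change |W n (t₀ - Real.exp (-σ) ^ 2 / 2) (x₀ + Real.exp (-σ) * y)| ≤ K + 1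
      linarith
    · intro n y
      exact (hcl n _ (tmem htb hσ₀ hσ) (x₀ + Real.exp (-σ) * y)).1
  have hDlim : ∀ σ, σ₀ ≤ σ → Tendsto (fun n => HH (V1 n) σ) atTop (𝓝 (HH v1 σ)) := by
    intro σ hσ
    refine HH_lim (K := Real.exp (-σ) * (K + 1)) (δ := fun n : ℕ => Real.exp (-σ) * (1 / ((n:ℝ) + 1)))
      (fun n => ((hFr n).g1 hσ).1) ?_ ?_ (by simpa using het.const_mul (Real.exp (-σ)))
    · intro n y
      have h1 := (hcl n _ (tmem htb hσ₀ hσ) (x₀ + Real.exp (-σ) * y)).2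
      have h2 := (hK _ (tmem htb hσ₀ hσ) (x₀ + Real.exp (-σ) * y)).2
      have h3 := abs_sub_abs_le_abs_sub (Wx n (t₀ - Real.exp (-σ) ^ 2 / 2) (x₀ + Real.exp (-σ) * y))
        (wx (t₀ - Real.exp (-σ) ^ 2 / 2) (x₀ + Real.exp (-σ) * y))
      rw [abs_sub_comm] at h3
      have := hen1 n
      change |Real.exp (-σ) * Wx n (t₀ - Real.exp (-σ) ^ 2 / 2) (x₀ + Real.exp (-σ) * y)| ≤ _
      rw [abs_mul, Real.abs_exp]
      apply mul_le_mul_of_nonneg_left _ (Real.exp_pos _).le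
      linarith
    · intro n y
      have := (hcl n _ (tmem htb hσ₀ hσ) (x₀ + Real.exp (-σ) * y)).2
      change |Real.exp (-σ) * wx (t₀ - Real.exp (-σ) ^ 2 / 2) (x₀ + Real.exp (-σ) * y) -
        Real.exp (-σ) * Wx n (t₀ - Real.exp (-σ) ^ 2 / 2) (x₀ + Real.exp (-σ) * y)| ≤ _
      rw [← mul_sub, abs_mul, Real.abs_exp]
      exact mul_le_mul_of_nonneg_left this (Real.exp_pos _).le
  have hH0 : 0 < HH v σ₀ := by
    refine HH_pos (hcv σ₀ le_rfl) (K := K) (fun y => (hK _ (tmem htb hσ₀ le_rfl) _).1) ?_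
    obtain ⟨x, hx⟩ := hne
    refine ⟨(x - x₀) / Real.exp (-σ₀), ?_⟩
    have : Real.exp (-σ₀) ≠ 0 := (Real.exp_pos _).ne'
    simp only [hv, sc, hσ2]
    rw [show t₀ - (t₀ - a) = a by ring, show x₀ + Real.exp (-σ₀) * ((x - x₀) / Real.exp (-σ₀)) = x by field_simp; ring]
    exact hx
  set en := fun n : ℕ => 1 / ((n:ℝ) + 1) with hend
  have hMlim : ∀ σ, σ₀ ≤ σ → 0 < HH v σ →
      Tendsto (fun n => MM c₁ (en n) (V n) (V1 n) σ) atTop (𝓝 (MM c₁ 0 v v1 σ)) := by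
    intro σ hσ hp
    unfold MM
    exact (((hDlim σ hσ).div ((hHlim σ hσ).add het) (by linarith)).add_const 1).mul_const _
  have hBlim := ((hMlim σ₀ le_rfl hH0).const_mul (2 + 3 * c₁ * Real.exp (-σ₀)))
  set B := (2 + 3 * c₁ * Real.exp (-σ₀)) * MM c₁ 0 v v1 σ₀ with hB
  have hlowlim : ∀ d : ℝ, Tendsto (fun n => (HH (V n) σ₀ + en n) *
      Real.exp (-((2 + 3 * c₁ * Real.exp (-σ₀)) * MM c₁ (en n) (V n) (V1 n) σ₀) * d)) atTop
      (𝓝 (HH v σ₀ * Real.exp (-B * d))) := by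
    intro d
    have h1 := (hHlim σ₀ le_rfl).add het
    rw [add_zero] at h1
    exact h1.mul ((Real.continuous_exp.tendsto _).comp (hBlim.neg.mul_const d))
  have hHpos : ∀ σ, σ₀ ≤ σ → 0 < HH v σ := by
    intro σ hσ
    have h1 : HH v σ₀ * Real.exp (-B * (σ - σ₀)) ≤ HH v σ + 0 :=
      le_of_tendsto_of_tendsto' (hlowlim (σ - σ₀)) ((hHlim σ hσ).add het) (fun n => (hFr n).low (hen n) hσ)
    have : 0 < HH v σ₀ * Real.exp (-B * (σ - σ₀)) := by positivity
    linarith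
  set M := MM c₁ 0 v v1 with hM
  have hMl : ∀ σ, σ₀ ≤ σ → Tendsto (fun n => MM c₁ (en n) (V n) (V1 n) σ) atTop (𝓝 (M σ)) :=
    fun σ hσ => hMlim σ hσ (hHpos σ hσ)
  have hMge : ∀ n σ, 1 ≤ MM c₁ (en n) (V n) (V1 n) σ := by
    intro n σ
    have := MM_ge (c₁ := c₁) (σ := σ) (hen n) (V n) (V1 n)
    have h1 := HH_nonneg (V n) σ
    have h2 := HH_nonneg (V1 n) σ
    have h3 : 0 ≤ HH (V1 n) σ / (HH (V n) σ + en n) := div_nonneg h2 (by have := hen n; positivity)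
    linarith
  have hanti : Antitone (fun k : ℕ => M (σ₀ + k)) := by
    refine antitone_nat_of_succ_le fun k => ?_
    have hk : σ₀ ≤ σ₀ + k := by linarith [k.cast_nonneg (α := ℝ)]
    push_cast
    refine le_of_tendsto_of_tendsto' (hMl (σ₀ + (k + 1)) (by linarith)) (hMl (σ₀ + k) hk) fun n => ?_
    exact (hFr n).anti (hen n) (mem_Ici.2 hk) (mem_Ici.2 (by linarith)) (by linarith)
  obtain ⟨L, hL⟩ : ∃ L, Tendsto (fun k : ℕ => M (σ₀ + k)) atTop (𝓝 L) := by
    refine ⟨_, tendsto_atTop_ciInf hanti ⟨1, ?_⟩⟩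
    rintro _ ⟨k, rfl⟩
    exact ge_of_tendsto' (hMl (σ₀ + k) (by linarith [k.cast_nonneg (α := ℝ)])) (fun n => hMge n _)
  have hL1 : 1 ≤ L := ge_of_tendsto' hL fun k =>
    ge_of_tendsto' (hMl (σ₀ + k) (by linarith [k.cast_nonneg (α := ℝ)])) (fun n => hMge n _)
  refine ⟨L - 1, fun ε hε δ hδ => ?_⟩
  set η := min 1 (ε ^ 2 / (16 + 2 * (2 + L) ^ 2)) with hη
  have hη0 : 0 < η := by rw [hη]; apply lt_min one_pos; positivity
  have hη1 : η ≤ 1 := min_le_left _ _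
  have hη2 : η * (16 + 2 * (2 + L) ^ 2) ≤ ε ^ 2 := by
    rw [← le_div_iff₀ (by positivity)]; exact min_le_right _ _
  -- choose S
  have hexpk : Tendsto (fun k : ℕ => Real.exp (-(σ₀ + k))) atTop (𝓝 0) := by
    refine Real.tendsto_exp_neg_atTop_nhds_zero.comp ?_
    exact tendsto_atTop_add_const_left _ _ tendsto_natCast_atTop_atTop
  have hexpk2 : Tendsto (fun k : ℕ => c₁ ^ 2 * Real.exp (-(σ₀ + k)) ^ 2) atTop (𝓝 0) := by
    simpa using (hexpk.pow 2).const_mul (c₁ ^ 2)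
  have hL' := (tendsto_add_atTop_iff_nat 1).2 hL
  obtain ⟨k, hk1, hk2, hk3, hk4⟩ := ((hexpk.eventually (gt_mem_nhds hδ)).and
    ((hexpk2.eventually (gt_mem_nhds hη0)).and ((Metric.tendsto_nhds.1 hL η hη0).and
      (Metric.tendsto_nhds.1 hL' η hη0)))).exists
  set S := σ₀ + (k:ℝ) with hS
  have hSσ : σ₀ ≤ S := by rw [hS]; linarith [k.cast_nonneg (α := ℝ)]
  have hS1 : σ₀ + ((k + 1 : ℕ) : ℝ) = S + 1 := by push_cast; rw [hS]; ring
  simp only [hS1] at hk4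
  rw [Real.dist_eq] at hk3 hk4
  set c₀ := HH v σ₀ * Real.exp (-B * (S + 1 - σ₀)) / 2 with hc₀
  have hc₀p : 0 < c₀ := by positivity
  have hev := ((hlowlim (S + 1 - σ₀)).eventually (lt_mem_nhds (by linarith :
      c₀ < HH v σ₀ * Real.exp (-B * (S + 1 - σ₀))))).and
    (((Metric.tendsto_nhds.1 (hMl S hSσ) η hη0)).and ((Metric.tendsto_nhds.1 (hMl (S + 1) (by linarith)) η hη0).and
    ((het.eventually (gt_mem_nhds (by positivity : 0 < c₀ / 2))).and
    (het.eventually (gt_mem_nhds (by positivity : 0 < ε * √(c₀ / 2)))))))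
  obtain ⟨n, hn1, hn2, hn3, hn4, hn5⟩ := hev.exists
  rw [Real.dist_eq] at hn2 hn3
  obtain ⟨σ, hσ, hQ⟩ := (hFr n).mvt (hen n) hSσ
  have hσσ : σ₀ ≤ σ := by linarith [hσ.1]
  have hlow := (hFr n).low (hen n) hσσ
  have hHn : c₀ / 2 < HH (V n) σ := by
    have h1 : (HH (V n) σ₀ + en n) * Real.exp (-((2 + 3 * c₁ * Real.exp (-σ₀)) * MM c₁ (en n) (V n) (V1 n) σ₀) * (S + 1 - σ₀))
        ≤ (HH (V n) σ₀ + en n) * Real.exp (-((2 + 3 * c₁ * Real.exp (-σ₀)) * MM c₁ (en n) (V n) (V1 n) σ₀) * (σ - σ₀)) := by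
      have h2 := HH_nonneg (V n) σ₀
      apply mul_le_mul_of_nonneg_left _ (by have := hen n; linarith)
      apply Real.exp_le_exp.2
      have h3 : 0 ≤ (2 + 3 * c₁ * Real.exp (-σ₀)) * MM c₁ (en n) (V n) (V1 n) σ₀ := by
        have := (hFr n).hc
        have := hMge n σ₀
        positivity
      have := mul_le_mul_of_nonneg_left (by linarith [hσ.2] : σ - σ₀ ≤ S + 1 - σ₀) h3
      linarith
    change en n < _ at hn4
    change _ ≤ HH (V n) σ + en n at hlow
    linarith
  set l := Real.exp (-σ) with hl
  have hlS : l < Real.exp (-S) := Real.exp_lt_exp.2 (by linarith [hσ.1])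
  have hl0 : 0 < l := Real.exp_pos _
  refine ⟨l, hl0, hlS.trans hk1, ?_, W n, Wt n, Wx n, Wxx n, hCl n, ?_, ?_, ?_⟩
  · have h1 : l < Real.exp (-σ₀) := Real.exp_lt_exp.2 (by linarith [hσ.1])
    have h2 := pow_lt_pow_left₀ h1 hl0.le (by norm_num : 2 ≠ 0)
    linarith
  · change 0 < HH (V n) σ
    linarith
  · intro t ht x
    change _ ≤ ε * √(HH (V n) σ) ∧ _ ≤ ε * √(HH (V n) σ)
    have h1 : ε * √(c₀ / 2) ≤ ε * √(HH (V n) σ) :=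
      mul_le_mul_of_nonneg_left (Real.sqrt_le_sqrt hHn.le) hε.le
    have h2 := hcl n t ht x
    exact ⟨by linarith [h2.1], by linarith [h2.2]⟩
  · change ∫ y, (y * V1 n σ y - V2 n σ y - (L - 1) * V n σ y) ^ 2 ∂gam ≤ ε ^ 2 * HH (V n) σ
    set Λ := HH (V1 n) σ / (HH (V n) σ + 1 / ((n:ℝ) + 1)) with hΛ
    have hMσ : MM c₁ (en n) (V n) (V1 n) σ = (Λ + 1) * Real.exp (c₁ ^ 2 * Real.exp (-2 * σ)) := rfl
    have ha1 := (hFr n).anti (hen n) (mem_Ici.2 hSσ) (mem_Ici.2 hσσ) hσ.1.le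
    have ha2 := (hFr n).anti (hen n) (mem_Ici.2 hσσ) (mem_Ici.2 (by linarith : σ₀ ≤ S + 1)) hσ.2.le
    have ha3 := MM_ge (c₁ := c₁) (σ := σ) (hen n) (V n) (V1 n)
    change Λ + 1 ≤ MM c₁ (en n) (V n) (V1 n) σ at ha3
    change _ ≤ MM c₁ (en n) (V n) (V1 n) S at ha1
    change MM c₁ (en n) (V n) (V1 n) (S + 1) ≤ MM c₁ (en n) (V n) (V1 n) σ at ha2
    rw [abs_lt] at hk3 hk4 hn2 hn3
    have hx : c₁ ^ 2 * Real.exp (-2 * σ) ≤ η := by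
      have e1 : Real.exp (-2 * σ) = l ^ 2 := by rw [hl, ← Real.exp_nat_mul]; congr 1; push_cast; ring
      rw [e1]
      have := mul_le_mul_of_nonneg_left (pow_le_pow_left₀ hl0.le hlS.le 2) (sq_nonneg c₁)
      linarith
    have hup : Λ - (L - 1) ≤ η * (2 + L) := by
      have : 0 ≤ η * L := by positivity
      linarith
    have hΛ0 : 0 ≤ Λ := div_nonneg (HH_nonneg _ _) (by have := HH_nonneg (V n) σ; positivity)
    have hdn : -(η * (2 + L)) ≤ Λ - (L - 1) := by
      have h1 : 1 - η ≤ Real.exp (-(c₁ ^ 2 * Real.exp (-2 * σ))) := by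
        have := Real.add_one_le_exp (-(c₁ ^ 2 * Real.exp (-2 * σ)))
        linarith
      have h2 : Λ + 1 = MM c₁ (en n) (V n) (V1 n) σ * Real.exp (-(c₁ ^ 2 * Real.exp (-2 * σ))) := by
        rw [hMσ, mul_assoc, ← Real.exp_add, add_neg_cancel, Real.exp_zero, mul_one]
      have h3 : L - 2 * η ≤ MM c₁ (en n) (V n) (V1 n) σ := by linarith
      have h4 : MM c₁ (en n) (V n) (V1 n) σ * (1 - η) ≤ Λ + 1 := by
        rw [h2]; exact mul_le_mul_of_nonneg_left h1 (by linarith [hMge n σ])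
      have h5 := mul_le_mul_of_nonneg_right h3 (by linarith : 0 ≤ 1 - η)
      have := sq_nonneg η
      linarith
    have hab : (Λ - (L - 1)) ^ 2 ≤ (η * (2 + L)) ^ 2 := sq_le_sq' hdn hup
    have hH0' := HH_nonneg (V n) σ
    have hQ2 : ∫ y, (y * V1 n σ y - V2 n σ y - Λ * V n σ y) ^ 2 ∂gam ≤ 8 * η * HH (V n) σ := by
      refine hQ.trans ?_
      have h1 : MM c₁ (en n) (V n) (V1 n) S - MM c₁ (en n) (V n) (V1 n) (S + 1) ≤ 4 * η := by linarith
      have h2 : HH (V n) σ + en n ≤ 2 * HH (V n) σ := by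
        change en n < _ at hn4
        linarith
      have := mul_le_mul h1 h2 (by have := hen n; linarith) (by positivity)
      change (MM c₁ (en n) (V n) (V1 n) S - MM c₁ (en n) (V n) (V1 n) (S + 1)) * (HH (V n) σ + en n) ≤ _
      linarith
    have gA := (hFr n).gA hσσ
    have g0 := (hFr n).g0 hσσ
    have hfin : ∫ y, (y * V1 n σ y - V2 n σ y - (L - 1) * V n σ y) ^ 2 ∂gam
        ≤ ∫ y, (2 * (y * V1 n σ y - V2 n σ y - Λ * V n σ y) ^ 2 + (2 * (Λ - (L - 1)) ^ 2) * V n σ y ^ 2) ∂gam := by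
      refine integral_mono ((gA.sub (g0.smul (L - 1))).pow 2).integrable
        ((((gA.sub (g0.smul Λ)).pow 2).smul 2).add ((g0.pow 2).smul _)).integrable fun y => ?_
      exact freq_arith2 _ _ _ _
    rw [integral_add (((gA.sub (g0.smul Λ)).pow 2).smul 2).integrable ((g0.pow 2).smul _).integrable,
      integral_const_mul, integral_const_mul] at hfin
    change _ ≤ _ + 2 * (Λ - (L - 1)) ^ 2 * HH (V n) σ at hfin
    exact freq_arith hfin hQ2 hab hH0' hη2 hη0 hη1

end SturmPf

namespace SturmPf
open Filter Topology MeasureTheory ProbabilityTheory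

/-- slices of classical approximants, rescaled -/
lemma Cl.slice {C a b : ℝ} {w wt wx wxx : ℝ → ℝ → ℝ} (h : Cl C a b w wt wx wxx) {t : ℝ} (ht : t ∈ Icc a b)
    (x₀ l : ℝ) :
    (∀ y, HasDerivAt (fun y => w t (x₀ + l * y)) (l * wx t (x₀ + l * y)) y) ∧
    (∀ y, HasDerivAt (fun y => l * wx t (x₀ + l * y)) (l ^ 2 * wxx t (x₀ + l * y)) y) ∧
    GC (fun y => w t (x₀ + l * y)) ∧ GC (fun y => l * wx t (x₀ + l * y)) ∧
    GC (fun y => l ^ 2 * wxx t (x₀ + l * y)) := by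
  obtain ⟨K, hK⟩ := h.bdd
  have hK0 : 0 ≤ K := le_trans (abs_nonneg _) (hK _ ht 0).1
  have c0 := sl_cont h.cw ht
  have c1 := sl_cont h.cx ht
  have c2 := sl_cont h.cxx ht
  refine ⟨fun y => ?_, fun y => ?_, ?_, ?_, ?_⟩
  · have := (h.dx _ ht (x₀ + l * y)).comp y (((hasDerivAt_id' y).const_mul l).const_add x₀)
    exact this.congr_deriv (by ring)
  · have := ((h.dxx _ ht (x₀ + l * y)).comp y (((hasDerivAt_id' y).const_mul l).const_add x₀)).const_mul l
    exact this.congr_deriv (by ring)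
  · exact GC_of_bdd (by fun_prop) hK0 (fun y => (hK _ ht _).1)
  · exact (GC_of_bdd (g := fun y => wx t (x₀ + l * y)) (by fun_prop) hK0 (fun y => (hK _ ht _).2.2.1)).smul l
  · exact (GC_of_bdd (g := fun y => wxx t (x₀ + l * y)) (by fun_prop) hK0 (fun y => (hK _ ht _).2.2.2)).smul (l ^ 2)

lemma dist_nat {L : ℝ} (h : ∀ m : ℕ, (m : ℝ) ≠ L) : ∃ d > 0, ∀ m : ℕ, d ≤ |(m:ℝ) - L| := by
  have hc : IsClosed (range ((↑) : ℕ → ℝ)) := Nat.isClosedEmbedding_coe_real.isClosed_range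
  have hL : L ∈ (range ((↑) : ℕ → ℝ))ᶜ := by rintro ⟨m, hm⟩; exact h m hm
  obtain ⟨d, hd, hb⟩ := Metric.isOpen_iff.1 hc.isOpen_compl L hL
  refine ⟨d, hd, fun m => ?_⟩
  by_contra hcon
  push Not at hcon
  exact hb (by simpa [Real.dist_eq] using hcon) ⟨m, rfl⟩

lemma freq2_arith {N Q A F M ε c : ℝ} {ε₁ : ℝ} (hN : 0 < N) (hF : 0 < F) (hM : 0 ≤ M) (hε₁ : 0 < ε₁) (h1 : ε₁ ≤ 1 / 2)
    (hQ : Q ≤ ε₁ ^ 2 * N) (hNA : N ≤ A ^ 2 * F + Q) (hc : c = 25 * √M * √(2 * F) + √(2 * F))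
    (hec : ε₁ * c ≤ ε) : A ≠ 0 ∧ ε₁ * √N ≤ ε * |A| ∧ 25 * √(M * Q) ≤ ε * |A| := by
  have h2 : ε₁ ^ 2 ≤ 1 / 4 := by nlinarith
  have h3 : N ≤ A ^ 2 * (2 * F) := by
    have := mul_le_mul_of_nonneg_right h2 hN.le
    have := mul_nonneg (sq_nonneg A) hF.le
    linarith
  have hA : A ≠ 0 := by
    rintro rfl
    simp at h3; linarith
  have h4 : √N ≤ |A| * √(2 * F) := by
    calc √N ≤ √(A ^ 2 * (2 * F)) := Real.sqrt_le_sqrt h3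
      _ = _ := by rw [Real.sqrt_mul (sq_nonneg A), Real.sqrt_sq_eq_abs]
  have h5 : √(M * Q) ≤ √M * (ε₁ * √N) := by
    calc √(M * Q) ≤ √(M * (ε₁ ^ 2 * N)) := Real.sqrt_le_sqrt (mul_le_mul_of_nonneg_left hQ hM)
      _ = _ := by rw [Real.sqrt_mul hM, Real.sqrt_mul (sq_nonneg _), Real.sqrt_sq hε₁.le]
  have h6 : ε₁ * √N ≤ ε₁ * (|A| * √(2 * F)) := mul_le_mul_of_nonneg_left h4 hε₁.le
  have h7 := mul_le_mul_of_nonneg_left h6 (Real.sqrt_nonneg M)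
  have h8 := mul_le_mul_of_nonneg_right hec (abs_nonneg A)
  have h9 : 0 ≤ √M * (ε₁ * (|A| * √(2 * F))) := by positivity
  have h10 : 0 ≤ (ε₁ * (|A| * √(2 * F))) := by positivity
  subst hc
  exact ⟨hA, by linarith, by linarith⟩

lemma freq2 {C a b t₀ x₀ : ℝ} {w wx : ℝ → ℝ → ℝ} (h : SC C a b w wx) (hat : a < t₀) (htb : t₀ ≤ b)
    (hne : ∃ x, w a x ≠ 0) : ∃ m : ℕ, ∀ ε > 0, ∀ δ > 0, ∃ l, 0 < l ∧ l < δ ∧ l ^ 2 / 2 < t₀ - a ∧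
      ∃ w' wt' wx' wxx' A, Cl C a b w' wt' wx' wxx' ∧ A ≠ 0 ∧
      (∀ t ∈ Icc a b, ∀ x, |w t x - w' t x| ≤ ε * |A| ∧ |wx t x - wx' t x| ≤ ε * |A|) ∧
      ∀ y, |w' (t₀ - l ^ 2 / 2) (x₀ + l * y) - A * hm m y| ≤ ε * |A| * bar 0 y := by
  obtain ⟨L, hL⟩ := freq0 (x₀ := x₀) h hat htb hne
  have hmem : ∀ l : ℝ, l ^ 2 / 2 < t₀ - a → t₀ - l ^ 2 / 2 ∈ Icc a b := by
    intro l hl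
    have := sq_nonneg l
    constructor <;> linarith
  have hnat : ∃ m : ℕ, (m:ℝ) = L := by
    by_contra hcon
    push Not at hcon
    obtain ⟨d, hd, hdm⟩ := dist_nat hcon
    obtain ⟨l, hl, -, hl2, w', wt', wx', wxx', hcl, hN, -, hQ⟩ := hL (d / 2) (by positivity) 1 one_pos
    obtain ⟨s1, s2, s3, s4, s5⟩ := hcl.slice (hmem l hl2) x₀ l
    have := spec s1 s2 s3 s4 s5 L d hd.le (fun m => Or.inl (hdm m))
    have h2 := this.trans hQ
    have h3 : (d / 2) ^ 2 < d ^ 2 := by nlinarith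
    have h4 := mul_lt_mul_of_pos_right h3 hN
    linarith
  obtain ⟨m, rfl⟩ := hnat
  refine ⟨m, fun ε hε δ hδ => ?_⟩
  have hF : (0:ℝ) < m.factorial := by exact_mod_cast m.factorial_pos
  set c := 25 * √((m:ℝ) + 2) * √(2 * (m.factorial : ℝ)) + √(2 * (m.factorial : ℝ)) with hc
  have hc0 : 0 < c := by positivity
  set ε₁ := min (1/2) (ε / c) with hε₁
  have hε₁0 : 0 < ε₁ := lt_min (by norm_num) (by positivity)
  obtain ⟨l, hl, hlδ, hl2, w', wt', wx', wxx', hcl, hN, hcl2, hQ⟩ := hL ε₁ hε₁0 δ hδ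
  obtain ⟨s1, s2, s3, s4, s5⟩ := hcl.slice (hmem l hl2) x₀ l
  obtain ⟨A, hA1, hA2⟩ := spec2 s1 s2 s3 s4 s5 m
  obtain ⟨hA, h1, h2⟩ := freq2_arith (ε := ε) (M := (m:ℝ) + 2) hN hF (by positivity) hε₁0 (min_le_left _ _) hQ hA2 hc
    (by rw [← le_div_iff₀ hc0]; exact min_le_right _ _)
  refine ⟨l, hl, hlδ, hl2, w', wt', wx', wxx', A, hcl, hA, fun t ht x => ?_, fun y => ?_⟩
  · have := hcl2 t ht x
    exact ⟨this.1.trans h1, this.2.trans h1⟩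
  · exact (hA1 y).trans (mul_le_mul_of_nonneg_right h2 (bar_pos _ _).le)

lemma pow_bar (m : ℕ) : ∃ c > 0, ∀ s ∈ Icc (0:ℝ) (5 / 8), ∀ y, (1 + |y|) ^ m ≤ c * bar s y := by
  refine ⟨m.factorial * Real.exp 2, by positivity, fun s hs y => ?_⟩
  have h1 := Real.pow_div_factorial_le_exp (1 + |y|) (by positivity) m
  rw [div_le_iff₀ (by positivity)] at h1
  have h2 : Real.exp (1 + |y|) ≤ Real.exp 2 * bar s y := by
    unfold bar
    rw [← Real.exp_add]
    apply Real.exp_le_exp.2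
    have h3 : y ^ 2 / (7 / 2) ≤ y ^ 2 / (7 / 2 - 5 * s) :=
      div_le_div_of_nonneg_left (sq_nonneg y) (by linarith [hs.2]) (by linarith [hs.1])
    have h4 := sq_nonneg (|y| - 7/4)
    have h5 := sq_abs y
    have := hs.1
    linarith
  have h3 := mul_le_mul_of_nonneg_right h2 (by positivity : (0:ℝ) ≤ m.factorial)
  linarith

lemma V_bar (m : ℕ) : ∃ c > 0, ∀ s ∈ Icc (0:ℝ) (5 / 8), ∀ y,
    |V m (s - 1/2) y| ≤ c * bar s y ∧ (1 + |y|) * |V m (s - 1/2) y| ≤ c * bar s y := by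
  obtain ⟨c1, hc1, h1⟩ := V_bound m
  obtain ⟨c2, hc2, h2⟩ := pow_bar (m + 1)
  refine ⟨(c1 + 1) * c2, by positivity, fun s hs y => ?_⟩
  have hv := h1 (s - 1/2) (by rw [abs_le]; constructor <;> linarith [hs.1, hs.2]) y
  have hp := mul_le_mul_of_nonneg_left (h2 s hs y) (by linarith : 0 ≤ c1 + 1)
  have hy : 0 ≤ |y| := abs_nonneg y
  have hpow : 0 ≤ (1 + |y|) ^ (m + 1) := by positivity
  have key : (1 + |y|) * |V m (s - 1/2) y| ≤ (c1 + 1) * c2 * bar s y := by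
    have := mul_le_mul_of_nonneg_left hv (by positivity : 0 ≤ 1 + |y|)
    rw [pow_succ] at hp hpow
    linarith
  refine ⟨?_, key⟩
  have := mul_nonneg hy (abs_nonneg (V m (s - 1/2) y))
  linarith

lemma bar_up {s y R : ℝ} (hs : s ∈ Icc (0:ℝ) (5/8)) (hy : |y| ≤ R) : bar s y ≤ Real.exp (R ^ 2 / (3 / 8) + 5) := by
  unfold bar
  apply Real.exp_le_exp.2
  have h1 : y ^ 2 / (7 / 2 - 5 * s) ≤ y ^ 2 / (3 / 8) :=
      div_le_div_of_nonneg_left (sq_nonneg y) (by norm_num) (by linarith [hs.2])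
  have h2 : y ^ 2 / (3 / 8) ≤ R ^ 2 / (3 / 8) := by
    apply div_le_div_of_nonneg_right _ (by norm_num)
    rw [← sq_abs]; exact pow_le_pow_left₀ (abs_nonneg _) hy 2
  linarith [hs.2]

/-- the parabolic estimate for a rescaled approximate solution close to a heat polynomial initially -/
lemma blow_cl (m : ℕ) (C : ℝ) (hC : 0 ≤ C) (ε R : ℝ) (hε : 0 < ε) (hR : 0 ≤ R) : ∃ ε₁ > 0, ∃ δ > 0, ∀ a b t₀ x₀ l A : ℝ,
    ∀ w wt wx wxx : ℝ → ℝ → ℝ, Cl C a b w wt wx wxx → 0 < l → l < δ → l ^ 2 / 2 < t₀ - a → l ^ 2 / 8 ≤ b - t₀ →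
    A ≠ 0 → (∀ y, |w (t₀ - l ^ 2 / 2) (x₀ + l * y) - A * hm m y| ≤ ε₁ * |A| * bar 0 y) →
    ∀ s ∈ Icc (0:ℝ) (5 / 8), ∀ y, |y| ≤ R →
      |w (t₀ - l ^ 2 / 2 + l ^ 2 * s) (x₀ + l * y) - A * V m (s - 1/2) y| ≤ ε * |A| ∧
      (1 / 8 ≤ s → |l * wx (t₀ - l ^ 2 / 2 + l ^ 2 * s) (x₀ + l * y) - A * (m * V (m - 1) (s - 1/2) y)| ≤ ε * |A|) := by
  obtain ⟨c1, hc1, hV1⟩ := V_bar m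
  obtain ⟨c2, hc2, hV2⟩ := V_bar (m - 1)
  obtain ⟨c3, hc3, hV3⟩ := pow_bar 1
  set B := Real.exp ((R + 1) ^ 2 / (3 / 8) + 5) with hB
  have hB1 : 1 ≤ B := Real.one_le_exp (by positivity)
  set E := Real.exp 2 * B with hE
  have hEB : B ≤ E := le_mul_of_one_le_left (by positivity) (Real.one_le_exp (by norm_num))
  have hE0 : 0 < E := by positivity
  set ε₁ := ε / (200 * E) with hε₁
  have hε₁0 : 0 < ε₁ := by positivity
  have hεE : ε₁ * E * 200 = ε := by rw [hε₁]; field_simp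
  set c4 := C * (c1 + m * c2) with hc4
  have hc40 : 0 ≤ c4 := by positivity
  set δ := min 1 (min (1 / (C + 1)) (ε₁ / (c4 + 1))) with hδ
  refine ⟨ε₁, hε₁0, δ, by positivity, ?_⟩
  intro a b t₀ x₀ l A w wt wx wxx h hl hlδ hla hlb hA hinit
  have hl1 : l ≤ 1 := hlδ.le.trans (min_le_left _ _)
  have hlC : C * l ≤ 1 := by
    have := hlδ.le.trans ((min_le_right _ _).trans (min_le_left _ _))
    rw [le_div_iff₀ (by positivity)] at this
    linarith
  have hlc : c4 * l ≤ ε₁ := by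
    have := hlδ.le.trans ((min_le_right _ _).trans (min_le_right _ _))
    rw [le_div_iff₀ (by positivity)] at this
    linarith
  have hA0 : 0 < |A| := abs_pos.2 hA
  set τ : ℝ → ℝ := fun s => t₀ - l ^ 2 / 2 + l ^ 2 * s with hτ
  have hl2 : 0 < l ^ 2 := by positivity
  have hmem : ∀ s ∈ Icc (0:ℝ) (5 / 8), τ s ∈ Icc a b := by
    intro s hs
    have h1 := mul_le_mul_of_nonneg_left hs.2 hl2.le
    have h2 := mul_nonneg hl2.le hs.1
    constructor <;> simp only [hτ] <;> linarith
  obtain ⟨K, hK⟩ := h.bdd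
  have hK0 : 0 ≤ K := le_trans (abs_nonneg _) (hK _ (hmem 0 (by norm_num)) 0).1
  set η := ε₁ * |A| with hη
  have hη0 : 0 < η := by positivity
  set g : ℝ → ℝ → ℝ := fun s y => w (τ s) (x₀ + l * y) - A * V m (s - 1/2) y with hg
  set gs : ℝ → ℝ → ℝ := fun s y => l ^ 2 * wt (τ s) (x₀ + l * y) - A * (m * (m - 1) * V (m - 2) (s - 1/2) y) with hgs
  set gy : ℝ → ℝ → ℝ := fun s y => l * wx (τ s) (x₀ + l * y) - A * (m * V (m - 1) (s - 1/2) y) with hgy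
  set gyy : ℝ → ℝ → ℝ := fun s y => l ^ 2 * wxx (τ s) (x₀ + l * y) - A * (m * (m - 1) * V (m - 2) (s - 1/2) y) with hgyy
  have hcont : ContinuousOn (fun p : ℝ × ℝ => g p.1 p.2) (Icc 0 (5 / 8) ×ˢ univ) := by
    refine ContinuousOn.sub ?_ (Continuous.continuousOn ?_)
    · exact h.cw.comp (f := fun p : ℝ × ℝ => (τ p.1, x₀ + l * p.2)) (by fun_prop) (fun p hp => ⟨hmem _ hp.1, mem_univ _⟩)
    · exact continuous_const.mul ((V_cont2 m).comp (f := fun p : ℝ × ℝ => (p.1 - 1/2, p.2)) (by fun_prop))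
  have hds : ∀ s ∈ Icc (0:ℝ) (5 / 8), ∀ y, HasDerivAt (fun r => g r y) (gs s y) s := by
    intro s hs y
    have h1 : HasDerivAt τ (l ^ 2) s := by
      have := ((hasDerivAt_id' s).const_mul (l ^ 2)).const_add (t₀ - l ^ 2 / 2)
      exact this.congr_deriv (by ring)
    have h2 := (h.dt _ (hmem s hs) (x₀ + l * y)).comp s h1
    have h3 := ((V_dt m (s - 1/2) y).comp s ((hasDerivAt_id' s).sub_const (1/2))).const_mul A
    exact (h2.sub h3).congr_deriv (by simp only [hgs]; ring)
  have hdy : ∀ s ∈ Icc (0:ℝ) (5 / 8), ∀ y, HasDerivAt (g s) (gy s y) y := by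
    intro s hs y
    exact ((h.slice (hmem s hs) x₀ l).1 y).sub ((V_dy m (s - 1/2) y).const_mul A)
  have hdyy : ∀ s ∈ Icc (0:ℝ) (5 / 8), ∀ y, HasDerivAt (gy s) (gyy s y) y := by
    intro s hs y
    exact ((h.slice (hmem s hs) x₀ l).2.1 y).sub ((V_dyy m (s - 1/2) y).const_mul A)
  have h0 : ∀ y, |g 0 y| ≤ η * bar 0 y := by
    intro y
    have := hinit y
    simp only [hg, hτ, mul_zero, add_zero]
    convert this using 4
    unfold hm; congr 1; norm_num
  have hgrow : ∀ s ∈ Icc (0:ℝ) (5 / 8), ∀ y, (K * c3 + |A| * c1) / η ≤ |y| →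
      |g s y| ≤ η * bar s y := by
    intro s hs y hy
    rw [div_le_iff₀ hη0] at hy
    have b1 : |g s y| ≤ K + |A| * |V m (s - 1/2) y| := by
      refine (abs_sub _ _).trans ?_
      rw [abs_mul]
      linarith [(hK _ (hmem s hs) (x₀ + l * y)).1]
    have hy1 : 0 < 1 + |y| := by positivity
    have b2 := mul_le_mul_of_nonneg_left b1 hy1.le
    have b3 := mul_le_mul_of_nonneg_left (hV1 s hs y).2 hA0.le
    have b4 := mul_le_mul_of_nonneg_left (hV3 s hs y) hK0
    rw [pow_one] at b4
    have hb := bar_pos s y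
    have b5 := mul_le_mul_of_nonneg_right hy hb.le
    have b6 : 0 < η * bar s y := by positivity
    refine le_of_mul_le_mul_left ?_ hy1
    linarith
  have he : ∀ s ∈ Icc (0:ℝ) (5 / 8), ∀ y, |gs s y - gyy s y| ≤ |g s y| + |gy s y| + η * bar s y := by
    intro s hs y
    have e : gs s y - gyy s y = l ^ 2 * (wt (τ s) (x₀ + l * y) - wxx (τ s) (x₀ + l * y)) := by
      simp only [hgs, hgyy]; ring
    have h1 := h.eq _ (hmem s hs) (x₀ + l * y)
    set p := w (τ s) (x₀ + l * y)
    set q := wx (τ s) (x₀ + l * y)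
    have hp : |p| ≤ |g s y| + |A| * (c1 * bar s y) := by
      have : p = g s y + A * V m (s - 1/2) y := by simp only [hg]; ring
      rw [this]
      refine (abs_add_le _ _).trans ?_
      rw [abs_mul]
      have := mul_le_mul_of_nonneg_left (hV1 s hs y).1 hA0.le
      linarith
    have hq : l * |q| ≤ |gy s y| + |A| * (m * (c2 * bar s y)) := by
      have : l * |q| = |gy s y + A * (m * V (m - 1) (s - 1/2) y)| := by
        rw [show gy s y + A * (m * V (m - 1) (s - 1/2) y) = l * q by simp only [hgy]; ring, abs_mul, abs_of_pos hl]
      rw [this]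
      refine (abs_add_le _ _).trans ?_
      rw [abs_mul A, abs_mul, Nat.abs_cast]
      have := mul_le_mul_of_nonneg_left (mul_le_mul_of_nonneg_left (hV2 s hs y).1 (m.cast_nonneg (α := ℝ))) hA0.le
      linarith
    rw [e, abs_mul, abs_of_pos hl2]
    have hb := bar_pos s y
    have h2 : l ^ 2 * |wt (τ s) (x₀ + l * y) - wxx (τ s) (x₀ + l * y)| ≤ C * l * (|p| + l * |q|) := by
      have a1 := mul_le_mul_of_nonneg_left h1 hl2.le
      have a2 : l * |p| ≤ |p| := by
        have := mul_le_mul_of_nonneg_right hl1 (abs_nonneg p)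
        linarith
      have a3 := mul_le_mul_of_nonneg_left a2 (by positivity : 0 ≤ C * l)
      linarith
    have h3 := mul_le_mul_of_nonneg_left (add_le_add hp hq) (by positivity : 0 ≤ C * l)
    have h4 := mul_le_mul_of_nonneg_right hlC (by positivity : 0 ≤ |g s y| + |gy s y|)
    have h5 := mul_le_mul_of_nonneg_right hlc (by positivity : 0 ≤ |A| * bar s y)
    have e5 : c4 * l * (|A| * bar s y) = C * l * (|A| * (c1 * bar s y) + |A| * (m * (c2 * bar s y))) := by
      rw [hc4]; ring
    have e6 : η * bar s y = ε₁ * (|A| * bar s y) := by rw [hη]; ring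
    linarith
  have key := bar_bound hη0 hcont hds hdy hdyy h0 hgrow he
  have key2 : ∀ s ∈ Icc (0:ℝ) (5 / 8), ∀ y, |y| ≤ R + 1 → |g s y| ≤ E * η ∧ η * bar s y ≤ E * η := by
    intro s hs y hy
    have h1 := key s hs y
    have h2 : bar s y ≤ B := bar_up hs hy
    have h3 : Real.exp (2 * s) ≤ Real.exp 2 := Real.exp_le_exp.2 (by linarith [hs.2])
    have h4 := mul_le_mul h3 (mul_le_mul_of_nonneg_left h2 hη0.le) (by have := bar_pos s y; positivity) (by positivity)
    have h5 := mul_le_mul_of_nonneg_left (h2.trans hEB) hη0.le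
    have e1 : Real.exp 2 * (η * B) = E * η := by rw [hE]; ring
    constructor <;> linarith
  have hEη : 200 * (E * η) = ε * |A| := by rw [← hεE, hη]; ring
  have hEη0 : 0 < E * η := by positivity
  intro s hs y hy
  refine ⟨?_, fun hs8 => ?_⟩
  · have := (key2 s hs y (by linarith)).1
    change |g s y| ≤ _
    linarith
  · change |gy s y| ≤ _
    have hsub : ∀ r ∈ Icc (s - 1/8) s, r ∈ Icc (0:ℝ) (5/8) := fun r hr => ⟨by linarith [hr.1], hr.2.trans hs.2⟩
    have hsuby : ∀ z ∈ Icc (y - 1) (y + 1), |z| ≤ R + 1 := by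
      intro z hz
      rw [abs_le] at hy ⊢
      constructor <;> linarith [hz.1, hz.2]
    have := grad_bound (g := g) (gs := gs) (gy := gy) (gyy := gyy) (s₁ := s) (y₀ := y) (δ := 1/8) (C := 1) (η := 2 * (E * η))
      (by norm_num) (by norm_num) (by positivity)
      (hcont.mono (fun p hp => ⟨hsub _ hp.1, mem_univ _⟩)) (fun r hr z _ => hds r (hsub r hr) z)
      (fun r hr z _ => hdy r (hsub r hr) z) (fun r hr z _ => hdyy r (hsub r hr) z)
      (fun r hr z hz => by linarith [(key2 r (hsub r hr) z (hsuby z hz)).1])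
      (fun r hr z hz => by
        have h1 := he r (hsub r hr) z
        have h2 := key2 r (hsub r hr) z (hsuby z hz)
        linarith [h2.1, h2.2])
    norm_num at this
    linarith

/-- blow-up: near every point the solution looks like a heat polynomial -/
lemma blow {C a b t₀ x₀ : ℝ} {w wx : ℝ → ℝ → ℝ} (h : SC C a b w wx) (hat : a < t₀) (htb : t₀ < b)
    (hne : ∃ x, w a x ≠ 0) : ∃ m : ℕ, ∀ ε > 0, ∀ R ≥ 0, ∀ δ > 0, ∃ l A, 0 < l ∧ l < δ ∧ A ≠ 0 ∧
      l ^ 2 / 2 < t₀ - a ∧ l ^ 2 / 8 < b - t₀ ∧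
      ∀ s ∈ Icc (0:ℝ) (5 / 8), ∀ y, |y| ≤ R →
      |w (t₀ - l ^ 2 / 2 + l ^ 2 * s) (x₀ + l * y) - A * V m (s - 1/2) y| ≤ ε * |A| ∧
      (1 / 8 ≤ s → |l * wx (t₀ - l ^ 2 / 2 + l ^ 2 * s) (x₀ + l * y) - A * (m * V (m - 1) (s - 1/2) y)| ≤ ε * |A|) := by
  obtain ⟨m, hm⟩ := freq2 (x₀ := x₀) h hat htb.le hne
  have hC : 0 ≤ C := by
    obtain ⟨_, _, _, _, hc, -⟩ := h.ap 1 one_pos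
    exact hc.hC
  refine ⟨m, fun ε hε R hR δ hδ => ?_⟩
  obtain ⟨ε₁, hε₁, δ₁, hδ₁, key⟩ := blow_cl m C hC (ε / 2) R (by positivity) hR
  obtain ⟨l, hl, hlδ, hl2, w', wt', wx', wxx', A, hcl, hA, happ, hinit⟩ := hm (min ε₁ (ε / 2)) (by positivity)
    (min δ (min δ₁ (min 1 (b - t₀)))) (lt_min hδ (lt_min hδ₁ (lt_min one_pos (by linarith))))
  have hlδ' := hlδ.trans_le (min_le_left _ _)
  have hlδ₁ := hlδ.trans_le ((min_le_right _ _).trans (min_le_left _ _))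
  have hl1 := hlδ.trans_le ((min_le_right _ _).trans ((min_le_right _ _).trans (min_le_left _ _)))
  have hlb := hlδ.trans_le ((min_le_right _ _).trans ((min_le_right _ _).trans (min_le_right _ _)))
  have hll : l ^ 2 ≤ l := by
    have := mul_le_mul_of_nonneg_left hl1.le hl.le
    linarith
  have hA0 : 0 < |A| := abs_pos.2 hA
  have hl28 : l ^ 2 / 8 < b - t₀ := by linarith
  refine ⟨l, A, hl, hlδ', hA, hl2, hl28, fun s hs y hy => ?_⟩
  have hmem : t₀ - l ^ 2 / 2 + l ^ 2 * s ∈ Icc a b := by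
    have hl2 : 0 < l ^ 2 := by positivity
    have h1 := mul_le_mul_of_nonneg_left hs.2 hl2.le
    have h2 := mul_nonneg hl2.le hs.1
    constructor <;> linarith
  have k1 := key a b t₀ x₀ l A w' wt' wx' wxx' hcl hl hlδ₁ hl2 hl28.le hA (fun z => (hinit z).trans
    (mul_le_mul_of_nonneg_right (mul_le_mul_of_nonneg_right (min_le_left _ _) hA0.le) (bar_pos _ _).le)) s hs y hy
  have k2 := happ _ hmem (x₀ + l * y)
  have k3 := mul_le_mul_of_nonneg_right (min_le_right ε₁ (ε / 2)) hA0.le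
  refine ⟨?_, fun h8 => ?_⟩
  · have := abs_sub_le (w (t₀ - l ^ 2 / 2 + l ^ 2 * s) (x₀ + l * y)) (w' (t₀ - l ^ 2 / 2 + l ^ 2 * s) (x₀ + l * y))
      (A * V m (s - 1/2) y)
    linarith [k1.1, k2.1]
  · have k4 := k1.2 h8
    have := abs_sub_le (l * wx (t₀ - l ^ 2 / 2 + l ^ 2 * s) (x₀ + l * y)) (l * wx' (t₀ - l ^ 2 / 2 + l ^ 2 * s) (x₀ + l * y))
      (A * (m * V (m - 1) (s - 1/2) y))
    rw [← mul_sub, abs_mul, abs_of_pos hl] at this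
    have h5 := mul_le_mul_of_nonneg_right hl1.le (abs_nonneg (wx (t₀ - l ^ 2 / 2 + l ^ 2 * s) (x₀ + l * y) - wx' (t₀ - l ^ 2 / 2 + l ^ 2 * s) (x₀ + l * y)))
    linarith [k2.2]

end SturmPf

namespace SturmPf
open Filter Topology MeasureTheory ProbabilityTheory

lemma GC_neg_of_integral_zero {g : ℝ → ℝ} (hg : GC g) (h0 : ∫ y, g y ∂gam = 0) (hne : ∃ y, g y ≠ 0) :
    ∃ y, g y < 0 := by
  by_contra hcon
  push Not at hcon
  have h1 := (integral_eq_zero_iff_of_nonneg hcon hg.integrable).1 h0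
  have h2 : g =ᵐ[volume] (fun _ => 0) :=
    (gaussianReal_absolutelyContinuous' 0 (by norm_num)).ae_eq h1
  have h3 := Continuous.ae_eq_iff_eq volume hg.1 continuous_const |>.1 h2
  obtain ⟨y, hy⟩ := hne
  exact hy (congrFun h3 y)

lemma hm_even_neg (m : ℕ) (hm0 : m ≠ 0) : ∃ y, hm m y < 0 := by
  refine GC_neg_of_integral_zero (hm_GC m) ?_ ⟨m + 1, ?_⟩
  · have := hm_orth m 0
    simp only [hm0, if_false] at this
    simpa [hm, V_zero] using this
  · have := (V_large m (-1/2) (m + 1) (by norm_num) le_rfl).1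
    unfold hm
    linarith

lemma hm_odd_neg (m : ℕ) (hm1 : m ≠ 1) (hodd : Odd m) : ∃ y, 0 < y ∧ hm m y < 0 := by
  obtain ⟨y, hy⟩ := GC_neg_of_integral_zero (g := fun y => hm m y * hm 1 y) ((hm_GC m).mul (hm_GC 1))
    (by have := hm_orth m 1; simpa only [hm1, if_false] using this) ⟨m + 1, by
      have := (V_large m (-1/2) (m + 1) (by norm_num) le_rfl).1
      unfold hm
      rw [V_one]
      positivity⟩
  have h1 : hm 1 y = y := rfl
  simp only [h1] at hy
  rcases lt_trichotomy y 0 with h | h | h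
  · refine ⟨-y, by linarith, ?_⟩
    unfold hm at hy ⊢
    rw [V_neg, hodd.neg_one_pow]
    nlinarith
  · rw [h] at hy; simp at hy
  · exact ⟨y, h, by by_contra hc; push Not at hc; have := mul_nonneg hc h.le; linarith⟩

lemma V_of_hm (m : ℕ) {y : ℝ} (h : hm m y < 0) : ∃ c > 0, V m (-3/8) (c * y) < 0 := by
  refine ⟨√(3/4), by positivity, ?_⟩
  have := V_scale m (√(3/4)) (-1/2) y
  rw [Real.sq_sqrt (by norm_num)] at this
  norm_num at this ⊢
  rw [this]
  unfold hm at h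
  norm_num at h
  exact mul_neg_of_pos_of_neg (by positivity) h

lemma V_lt_of_neg {m : ℕ} {y : ℝ} (h : V m (-3/8) y < 0) : y < m + 2 := by
  by_contra hc
  push Not at hc
  have := (V_large m (-3/8) y (by norm_num) (by linarith)).1
  linarith

lemma cpt_pos {g : ℝ → ℝ} (hg : Continuous g) (R : ℝ) (h : ∀ y, 0 < g y) : ∃ ρ > 0, ∀ y, |y| ≤ R → ρ ≤ g y := by
  rcases lt_or_ge R 0 with hR | hR
  · exact ⟨1, one_pos, fun y hy => by linarith [abs_nonneg y]⟩
  obtain ⟨z, -, hz⟩ := (isCompact_Icc (a := -R) (b := R)).exists_isMinOn ⟨0, by constructor <;> linarith⟩ hg.continuousOn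
  exact ⟨g z, h z, fun y hy => hz (abs_le.1 hy)⟩

lemma V_facts (m : ℕ) : ∃ ρ > 0, ρ ≤ 1 ∧
    (∀ y, |y| ≤ (m:ℝ) + 2 → ρ ≤ |V m (-3/8) y| ∨ ρ ≤ |m * V (m - 1) (-3/8) y|) ∧
    (Even m → m ≠ 0 → (∃ y : ℝ, |y| < m + 2 ∧ V m (-3/8) y ≤ -ρ) ∧ ∀ y, |y| ≤ (m:ℝ) + 2 → ρ ≤ V m (1/8) y) ∧
    (Odd m → m ≠ 1 → (∃ y : ℝ, 0 < y ∧ y < m + 2 ∧ V m (-3/8) y ≤ -ρ) ∧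
      ∀ y, |y| ≤ (m:ℝ) + 2 → ρ ≤ m * V (m - 1) (1/8) y) := by
  obtain ⟨ρ1, h1, h1'⟩ := cpt_pos (g := fun y => max |V m (-3/8) y| |m * V (m - 1) (-3/8) y|)
    (((V_cont m _).abs).max ((continuous_const.mul (V_cont (m-1) _)).abs)) (m + 2) (fun y => by
      cases m with
      | zero => simp [V_zero]
      | succ k =>
        by_contra hc
        push Not at hc
        have h2 := (le_max_left _ _).trans hc
        have h3 := (le_max_right _ _).trans hc
        have h2' := abs_nonpos_iff.1 h2
        have h3' := abs_nonpos_iff.1 h3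
        refine V_simple k (-3/8) y (by norm_num) ⟨h2', ?_⟩
        simp only [Nat.add_sub_cancel, mul_eq_zero] at h3'
        rcases h3' with h3' | h3'
        · exfalso; have : (0:ℝ) < ((k + 1 : ℕ) : ℝ) := by positivity
          linarith
        · exact h3')
  rcases Nat.even_or_odd m with he | ho
  · have hno : ¬ Odd m := Nat.not_odd_iff_even.2 he
    by_cases hm0 : m = 0
    · refine ⟨min ρ1 1, lt_min h1 one_pos, min_le_right _ _, fun y hy => ?_, fun _ h => absurd hm0 h, fun h => absurd h hno⟩
      have := h1' y hy
      rcases le_max_iff.1 this with h | h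
      · exact Or.inl ((min_le_left _ _).trans h)
      · exact Or.inr ((min_le_left _ _).trans h)
    obtain ⟨y, hy⟩ := hm_even_neg m hm0
    obtain ⟨c, hc, hcy⟩ := V_of_hm m hy
    obtain ⟨ρ2, h2, h2'⟩ := cpt_pos (V_cont m (1/8)) (m + 2) (fun y => by
      obtain ⟨k, rfl⟩ := he
      have := (V_pos k (1/8) y (by norm_num)).1
      rwa [two_mul] at this)
    have h3 : 0 < - V m (-3/8) (c * y) := by linarith
    have key : ∀ ρ', min ρ1 (min 1 (min ρ2 (- V m (-3/8) (c * y)))) = ρ' → ρ' ≤ ρ1 ∧ ρ' ≤ 1 ∧ ρ' ≤ ρ2 ∧ ρ' ≤ - V m (-3/8) (c * y) := by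
      rintro _ rfl; simp
    obtain ⟨k1, k2, k3, k4⟩ := key _ rfl
    refine ⟨_, lt_min h1 (lt_min one_pos (lt_min h2 h3)), k2, fun y hy => ?_, fun _ _ => ⟨⟨c * y, ?_, by linarith⟩, fun y hy => k3.trans (h2' y hy)⟩, fun h => absurd h hno⟩
    · have := h1' y hy
      rcases le_max_iff.1 this with h | h
      · exact Or.inl (k1.trans h)
      · exact Or.inr (k1.trans h)
    · rw [abs_lt]
      refine ⟨?_, V_lt_of_neg hcy⟩
      have : V m (-3/8) (-(c * y)) < 0 := by rw [V_neg, he.neg_one_pow, one_mul]; exact hcy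
      have := V_lt_of_neg this
      linarith
  · have hno : ¬ Even m := Nat.not_even_iff_odd.2 ho
    by_cases hm0 : m = 1
    · refine ⟨min ρ1 1, lt_min h1 one_pos, min_le_right _ _, fun y hy => ?_, fun h => absurd h hno, fun _ h => absurd hm0 h⟩
      have := h1' y hy
      rcases le_max_iff.1 this with h | h
      · exact Or.inl ((min_le_left _ _).trans h)
      · exact Or.inr ((min_le_left _ _).trans h)
    obtain ⟨y, hy0, hy⟩ := hm_odd_neg m hm0 ho
    obtain ⟨c, hc, hcy⟩ := V_of_hm m hy
    obtain ⟨ρ2, h2, h2'⟩ := cpt_pos (g := fun y => m * V (m-1) (1/8) y) (continuous_const.mul (V_cont (m-1) (1/8))) (m + 2) (fun y => by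
      obtain ⟨k, rfl⟩ := ho
      have := (V_pos k (1/8) y (by norm_num)).1
      simp only [Nat.add_sub_cancel]
      positivity)
    have h3 : 0 < - V m (-3/8) (c * y) := by linarith
    have key : ∀ ρ', min ρ1 (min 1 (min ρ2 (- V m (-3/8) (c * y)))) = ρ' → ρ' ≤ ρ1 ∧ ρ' ≤ 1 ∧ ρ' ≤ ρ2 ∧ ρ' ≤ - V m (-3/8) (c * y) := by
      rintro _ rfl; simp
    obtain ⟨k1, k2, k3, k4⟩ := key _ rfl
    refine ⟨_, lt_min h1 (lt_min one_pos (lt_min h2 h3)), k2, fun y hy => ?_, fun h => absurd h hno, fun _ _ => ⟨⟨c * y, by positivity, V_lt_of_neg hcy, by linarith⟩, fun y hy => k3.trans (h2' y hy)⟩⟩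
    have := h1' y hy
    rcases le_max_iff.1 this with h | h
    · exact Or.inl (k1.trans h)
    · exact Or.inr (k1.trans h)

lemma sgn_pos {p A v ρ : ℝ} (hA : A ≠ 0) (hρ : 0 < ρ) (h : |p - A * v| ≤ ρ / 2 * |A|) (hv : ρ ≤ v) : 0 < A * p := by
  have hA2 : 0 < A ^ 2 := by positivity
  have h1 : |A * (p - A * v)| ≤ ρ / 2 * A ^ 2 := by
    rw [abs_mul, ← sq_abs A]
    have := mul_le_mul_of_nonneg_left h (abs_nonneg A)
    linarith
  have h2 := (abs_le.1 h1).1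
  have h3 := mul_le_mul_of_nonneg_left hv hA2.le
  have h4 := mul_pos hA2 hρ
  linarith

lemma sgn_neg {p A v ρ : ℝ} (hA : A ≠ 0) (hρ : 0 < ρ) (h : |p - A * v| ≤ ρ / 2 * |A|) (hv : v ≤ -ρ) : A * p < 0 := by
  have := sgn_pos (p := -p) (v := -v) hA hρ (by rw [← abs_neg]; convert h using 2; ring) (by linarith)
  linarith

lemma mul_sgn_neg {A p q : ℝ} (hp : 0 < A * p) (hq : A * q < 0) : p * q < 0 := by
  have h1 := mul_neg_of_pos_of_neg hp hq
  by_contra hc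
  push Not at hc
  have := mul_nonneg (sq_nonneg A) hc
  linarith

lemma mul_sgn_pos {A p q : ℝ} (hp : 0 < A * p) (hq : 0 < A * q) : 0 < p * q := by
  have h1 := mul_pos hp hq
  by_contra hc
  push Not at hc
  have := mul_nonneg (sq_nonneg A) (by linarith : 0 ≤ -(p * q))
  linarith

lemma core {C a b t₀ x₀ θ : ℝ} {w wx : ℝ → ℝ → ℝ} (h : SC C a b w wx) (hat : a < t₀) (htb : t₀ < b)
    (hne : ∃ x, w a x ≠ 0) (hθ : 0 < θ) :
    ∃ r t' t'', 0 < r ∧ r < 1 / 4 ∧ a < t' ∧ t₀ - θ < t' ∧ t' < t₀ ∧ t₀ < t'' ∧ t'' < b ∧ t'' < t₀ + θ ∧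
      (∀ t ∈ Icc t' t'', w t (x₀ - r) ≠ 0 ∧ w t (x₀ + r) ≠ 0) ∧
      (∀ x ∈ Icc (x₀ - r) (x₀ + r), w t' x ≠ 0 ∨ wx t' x ≠ 0) ∧
      (w t₀ x₀ = 0 → wx t₀ x₀ = 0 →
        (∃ c ∈ Ioo (x₀ - r) (x₀ + r), w t' (x₀ - r) * w t' c < 0 ∧ w t' c * w t' (x₀ + r) < 0 ∧
          ∀ x ∈ Icc (x₀ - r) (x₀ + r), 0 < w t'' (x₀ - r) * w t'' x) ∨
        (∃ c₁ c₂, x₀ - r < c₁ ∧ c₁ < c₂ ∧ c₂ < x₀ + r ∧ w t' (x₀ - r) * w t' c₁ < 0 ∧ w t' c₁ * w t' c₂ < 0 ∧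
          w t' c₂ * w t' (x₀ + r) < 0 ∧ ∃ A : ℝ, A ≠ 0 ∧ StrictMonoOn (fun x => A * w t'' x) (Icc (x₀ - r) (x₀ + r)))) := by
  obtain ⟨m, hm⟩ := blow (x₀ := x₀) h hat htb hne
  obtain ⟨ρ, hρ, hρ1, f1, f2, f3⟩ := V_facts m
  set R : ℝ := m + 2 with hR
  have hR0 : 0 < R := by positivity
  obtain ⟨l, A, hl, hlδ, hA, hla, hlb, key⟩ := hm (ρ / 2) (by positivity) R hR0.le (min 1 (min θ (1 / (4 * R)))) (by positivity)
  have hl1 := hlδ.trans_le (min_le_left _ _)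
  have hlθ := hlδ.trans_le ((min_le_right _ _).trans (min_le_left _ _))
  have hlR := hlδ.trans_le ((min_le_right _ _).trans (min_le_right _ _))
  have hl2 : 0 < l ^ 2 := by positivity
  have hll : l ^ 2 ≤ l := by
    have := mul_le_mul_of_nonneg_left hl1.le hl.le
    linarith
  rw [lt_div_iff₀ (by positivity)] at hlR
  have hA0 : 0 < |A| := abs_pos.2 hA
  set T : ℝ → ℝ := fun s => t₀ - l ^ 2 / 2 + l ^ 2 * s with hT
  have e0 : T (1/2) = t₀ := by simp only [hT]; ring
  -- value at points of the window
  have hval : ∀ s ∈ Icc (0:ℝ) (5/8), ∀ x ∈ Icc (x₀ - l * R) (x₀ + l * R), ∃ y, |y| ≤ R ∧ x = x₀ + l * y := by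
    intro s hs x hx
    refine ⟨(x - x₀) / l, ?_, by field_simp; ring⟩
    rw [abs_div, abs_of_pos hl, div_le_iff₀ hl, abs_le]
    constructor <;> linarith [hx.1, hx.2]
  have hRp : ∀ s ∈ Icc (0:ℝ) (5/8), 0 < A * w (T s) (x₀ + l * R) := by
    intro s hs
    refine sgn_pos hA hρ (key s hs R (by rw [abs_of_pos hR0])).1 ?_
    exact hρ1.trans (V_large m _ _ (by linarith [hs.1]) (by linarith)).1
  have hRn : ∀ s ∈ Icc (0:ℝ) (5/8), (Even m → 0 < A * w (T s) (x₀ - l * R)) ∧ (Odd m → A * w (T s) (x₀ - l * R) < 0) := by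
    intro s hs
    have k := (key s hs (-R) (by rw [abs_neg, abs_of_pos hR0])).1
    rw [show x₀ + l * -R = x₀ - l * R by ring] at k
    have v := (V_large m (s - 1/2) R (by linarith [hs.1]) (by linarith)).1
    constructor
    · intro he
      refine sgn_pos hA hρ k ?_
      rw [V_neg, he.neg_one_pow]
      linarith
    · intro he
      refine sgn_neg hA hρ k ?_
      rw [V_neg, he.neg_one_pow]
      linarith
  have m8 : (1/8:ℝ) ∈ Icc (0:ℝ) (5/8) := by constructor <;> norm_num
  have m58 : (5/8:ℝ) ∈ Icc (0:ℝ) (5/8) := by constructor <;> norm_num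
  have m12 : (1/2:ℝ) ∈ Icc (0:ℝ) (5/8) := by constructor <;> norm_num
  have v8 : (1/8:ℝ) - 1/2 = -3/8 := by norm_num
  have v58 : (5/8:ℝ) - 1/2 = 1/8 := by norm_num
  have hlR0 : 0 < l * R := by positivity
  have et' : T (1/8) = t₀ - 3/8 * l ^ 2 := by simp only [hT]; ring
  have et'' : T (5/8) = t₀ + 1/8 * l ^ 2 := by simp only [hT]; ring
  refine ⟨l * R, T (1/8), T (5/8), hlR0, by linarith, by linarith, by linarith, by linarith, by linarith, by linarith, by linarith, ?_, ?_, ?_⟩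
  · intro t ht
    obtain ⟨s, hs, rfl⟩ : ∃ s ∈ Icc (0:ℝ) (5/8), t = T s := by
      refine ⟨(t - t₀ + l ^ 2 / 2) / l ^ 2, ⟨?_, ?_⟩, by simp only [hT]; field_simp; ring⟩
      · rw [le_div_iff₀ hl2]; linarith [ht.1]
      · rw [div_le_iff₀ hl2]; linarith [ht.2]
    refine ⟨?_, right_ne_zero_of_mul (hRp s hs).ne'⟩
    rcases Nat.even_or_odd m with he | ho
    · exact right_ne_zero_of_mul ((hRn s hs).1 he).ne'
    · exact right_ne_zero_of_mul ((hRn s hs).2 ho).ne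
  · intro x hx
    obtain ⟨y, hy, rfl⟩ := hval (1/8) m8 x hx
    have k := key (1/8) m8 y hy
    have k2 := k.2 le_rfl
    rw [v8] at k k2
    rcases f1 y hy with f | f
    · left
      intro h0
      have k1 := k.1
      simp only [hT] at h0
      rw [h0, zero_sub, abs_neg, abs_mul] at k1
      have := mul_le_mul_of_nonneg_left f hA0.le
      have := mul_pos hρ hA0
      linarith
    · right
      intro h0
      simp only [hT] at h0
      rw [h0, mul_zero, zero_sub, abs_neg, abs_mul] at k2
      have := mul_le_mul_of_nonneg_left f hA0.le
      have := mul_pos hρ hA0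
      linarith
  · intro z1 z2
    have k := key (1/2) m12 0 (by simpa using hR0.le)
    have k2 := k.2 (by norm_num)
    have k1 := k.1
    change |w (T (1/2)) _ - _| ≤ _ at k1
    change |l * wx (T (1/2)) _ - _| ≤ _ at k2
    rw [e0, mul_zero, add_zero] at k1 k2
    rw [z1, zero_sub, abs_neg, abs_mul] at k1
    rw [z2, mul_zero, zero_sub, abs_neg, abs_mul] at k2
    have hm0 : m ≠ 0 := by
      rintro rfl
      simp only [V_zero, abs_one] at k1
      have := mul_le_mul_of_nonneg_right hρ1 hA0.le
      linarith
    have hm1 : m ≠ 1 := by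
      rintro rfl
      simp only [Nat.cast_one, Nat.sub_self, V_zero, abs_one, mul_one] at k2
      have := mul_le_mul_of_nonneg_right hρ1 hA0.le
      linarith
    rcases Nat.even_or_odd m with he | ho
    · left
      obtain ⟨⟨y, hy, hyn⟩, hpos⟩ := f2 he hm0
      have hc : A * w (T (1/8)) (x₀ + l * y) < 0 := by
        refine sgn_neg hA hρ (key (1/8) m8 y hy.le).1 ?_
        rwa [v8]
      rw [abs_lt] at hy
      have y1 := mul_lt_mul_of_pos_left hy.1 hl
      have y2 := mul_lt_mul_of_pos_left hy.2 hl
      refine ⟨x₀ + l * y, ⟨by linarith, by linarith⟩, mul_sgn_neg ((hRn _ m8).1 he) hc, ?_, ?_⟩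
      · rw [mul_comm]; exact mul_sgn_neg (hRp _ m8) hc
      · intro x hx
        obtain ⟨z, hz, rfl⟩ := hval (5/8) m58 x hx
        refine mul_sgn_pos ((hRn _ m58).1 he) ?_
        refine sgn_pos hA hρ (key (5/8) m58 z hz).1 ?_
        rw [v58]; exact hpos z hz
    · right
      obtain ⟨⟨y, hy0, hy, hyn⟩, hpos⟩ := f3 ho hm1
      have hc : A * w (T (1/8)) (x₀ + l * y) < 0 := by
        refine sgn_neg hA hρ (key (1/8) m8 y (by rw [abs_of_pos hy0]; exact hy.le)).1 ?_
        rwa [v8]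
      have hc1 : 0 < A * w (T (1/8)) (x₀ + l * -y) := by
        refine sgn_pos hA hρ (key (1/8) m8 (-y) (by rw [abs_neg, abs_of_pos hy0]; exact hy.le)).1 ?_
        rw [v8, V_neg, ho.neg_one_pow]
        linarith
      have y1 := mul_lt_mul_of_pos_left hy hl
      have y2 := mul_pos hl hy0
      have n1 := (hRn _ m8).2 ho
      refine ⟨x₀ + l * -y, x₀ + l * y, by linarith, by linarith, by linarith, ?_, mul_sgn_neg hc1 hc, ?_, A, hA, ?_⟩
      · rw [mul_comm]; exact mul_sgn_neg hc1 n1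
      · rw [mul_comm]; exact mul_sgn_neg (hRp _ m8) hc
      · have htm : T (5/8) ∈ Icc a b := by constructor <;> linarith
        have hd : ∀ x, HasDerivAt (fun x => A * w (T (5/8)) x) (A * wx (T (5/8)) x) x := fun x => (h.dx _ htm x).const_mul A
        refine strictMonoOn_of_deriv_pos (convex_Icc _ _) (fun x _ => (hd x).continuousAt.continuousWithinAt) ?_
        intro x hx
        rw [(hd x).deriv]
        obtain ⟨z, hz, rfl⟩ := hval (5/8) m58 x (interior_subset hx)
        have k3 := (key (5/8) m58 z hz).2 (by norm_num)
        have := sgn_pos hA hρ k3 (by rw [v58]; exact hpos z hz)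
        have e : A * (l * wx (T (5/8)) (x₀ + l * z)) = l * (A * wx (T (5/8)) (x₀ + l * z)) := by ring
        change 0 < A * (l * wx (T (5/8)) (x₀ + l * z)) at this
        rw [e] at this
        exact pos_of_mul_pos_right this hl.le

end SturmPf

namespace SturmPf
open Filter Topology MeasureTheory ProbabilityTheory

lemma Cl.neg {C a b : ℝ} {w wt wx wxx : ℝ → ℝ → ℝ} (h : Cl C a b w wt wx wxx) :
    Cl C a b (fun t x => - w t x) (fun t x => - wt t x) (fun t x => - wx t x) (fun t x => - wxx t x) where
  dt t ht x := (h.dt t ht x).neg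
  dx t ht x := (h.dx t ht x).neg
  dxx t ht x := (h.dxx t ht x).neg
  cw := h.cw.neg
  ct := h.ct.neg
  cx := h.cx.neg
  cxx := h.cxx.neg
  bdd := by simpa only [abs_neg] using h.bdd
  hC := h.hC
  eq t ht x := by
    have := h.eq t ht x
    rw [abs_neg, abs_neg, ← abs_neg]
    convert this using 2
    ring

lemma SC.neg {C a b : ℝ} {w wx : ℝ → ℝ → ℝ} (h : SC C a b w wx) :
    SC C a b (fun t x => - w t x) (fun t x => - wx t x) where
  per t x := by have := h.per t x; simp only [this]
  dx t ht x := (h.dx t ht x).neg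
  cw := h.cw.neg
  cx := h.cx.neg
  ap ε hε := by
    obtain ⟨w', wt', wx', wxx', hc, hcl⟩ := h.ap ε hε
    refine ⟨_, _, _, _, hc.neg, fun t ht x => ?_⟩
    have := hcl t ht x
    simp only [neg_sub_neg]
    rw [abs_sub_comm, abs_sub_comm (wx' t x)]
    exact this

lemma SC.hC {C a b : ℝ} {w wx : ℝ → ℝ → ℝ} (h : SC C a b w wx) : 0 ≤ C := by
  obtain ⟨_, _, _, _, hc, -⟩ := h.ap 1 one_pos
  exact hc.hC

/-- no positive maximum of the damped solution over a backward box -/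
lemma trace_max {C a b s₁ x₁ δ : ℝ} {w wx : ℝ → ℝ → ℝ} (h : SC C a b w wx) (hδ : 0 < δ) (hδ1 : δ ≤ 1)
    (ha : a ≤ s₁ - δ) (hb : s₁ ≤ b) (hpos : 0 < w s₁ x₁)
    (hmax : ∀ s ∈ Icc (s₁ - δ) s₁, ∀ x ∈ Icc (x₁ - δ) (x₁ + δ),
      Real.exp (-((C + 1) * (s - a))) * w s x ≤ Real.exp (-((C + 1) * (s₁ - a))) * w s₁ x₁) : False := by
  have hC := h.hC
  set E : ℝ → ℝ := fun s => Real.exp (-((C + 1) * (s - a))) with hE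
  have hE0 : ∀ s, 0 < E s := fun s => Real.exp_pos _
  have hE1 : ∀ s, a ≤ s → E s ≤ 1 := fun s hs => by
    rw [← Real.exp_zero]
    apply Real.exp_le_exp.2
    have := mul_nonneg (by linarith : 0 ≤ C + 1) (by linarith : 0 ≤ s - a)
    linarith
  set H := E s₁ * w s₁ x₁ with hH
  have hH0 : 0 < H := mul_pos (hE0 _) hpos
  set μ := H / (8 * (C + 2)) with hμ
  have hμ0 : 0 < μ := by positivity
  have hμ1 : μ * (8 * (C + 2)) = H := by rw [hμ]; field_simp
  set ε := μ * δ ^ 2 / 4 with hε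
  have hε0 : 0 < ε := by positivity
  have hδ2 : δ ^ 2 ≤ δ := by
    have := mul_le_mul_of_nonneg_left hδ1 hδ.le
    linarith
  have hμδ : μ * δ ^ 2 ≤ μ * δ := mul_le_mul_of_nonneg_left hδ2 hμ0.le
  have hμδ1 : μ * δ ≤ μ := mul_le_of_le_one_right hμ0.le hδ1
  obtain ⟨w', wt', wx', wxx', hc, hcl⟩ := h.ap ε hε0
  have hsub : ∀ s ∈ Icc (s₁ - δ) s₁, s ∈ Icc a b := fun s hs => ⟨ha.trans hs.1, hs.2.trans hb⟩
  set q : ℝ → ℝ → ℝ := fun s x => E s * w' s x - μ * (x - x₁) ^ 2 - μ * (s₁ - s) with hq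
  have hcl' : ∀ s ∈ Icc (s₁ - δ) s₁, ∀ x, |E s * w s x - E s * w' s x| ≤ ε := by
    intro s hs x
    rw [← mul_sub, abs_mul, abs_of_pos (hE0 s)]
    have h1 := (hcl s (hsub s hs) x).1
    have h2 := mul_le_mul_of_nonneg_right (hE1 s (hsub s hs).1) (abs_nonneg (w s x - w' s x))
    linarith
  have hqc : ContinuousOn (fun p : ℝ × ℝ => q p.1 p.2) (Icc (s₁ - δ) s₁ ×ˢ Icc (x₁ - δ) (x₁ + δ)) := by
    have h1 : ContinuousOn (fun p : ℝ × ℝ => w' p.1 p.2) (Icc (s₁ - δ) s₁ ×ˢ Icc (x₁ - δ) (x₁ + δ)) :=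
      hc.cw.mono (prod_mono hsub (subset_univ _))
    have h2 : Continuous (fun p : ℝ × ℝ => E p.1) := by simp only [hE]; fun_prop
    exact ((h2.continuousOn.mul h1).sub (by fun_prop)).sub (by fun_prop)
  obtain ⟨⟨s, x⟩, ⟨hs, hx⟩, hm⟩ := (isCompact_Icc.prod isCompact_Icc).exists_isMaxOn
    ⟨(s₁, x₁), ⟨⟨by linarith, le_rfl⟩, ⟨by linarith, by linarith⟩⟩⟩ hqc
  simp only at hs hx
  have hm' : ∀ r ∈ Icc (s₁ - δ) s₁, ∀ z ∈ Icc (x₁ - δ) (x₁ + δ), q r z ≤ q s x := fun r hr z hz => hm (⟨hr, hz⟩ : (r, z) ∈ _ ×ˢ _)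
  have b1 := hm' s₁ ⟨by linarith, le_rfl⟩ x₁ ⟨by linarith, by linarith⟩
  have b2 := hcl' s₁ ⟨by linarith, le_rfl⟩ x₁
  have b3 := hcl' s hs x
  have b4 := hmax s hs x hx
  change E s * w s x ≤ H at b4
  change |H - E s₁ * w' s₁ x₁| ≤ ε at b2
  rw [abs_le] at b2 b3
  have hqs : q s₁ x₁ = E s₁ * w' s₁ x₁ := by simp only [hq]; ring
  have hqx : q s x = E s * w' s x - μ * (x - x₁) ^ 2 - μ * (s₁ - s) := rfl
  have n1 : 0 ≤ μ * (x - x₁) ^ 2 := by positivity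
  have n2 : 0 ≤ μ * (s₁ - s) := mul_nonneg hμ0.le (by linarith [hs.2])
  have hsum : μ * (x - x₁) ^ 2 + μ * (s₁ - s) ≤ μ * δ ^ 2 / 2 := by linarith
  have hμδ0 : 0 < μ * δ ^ 2 := by positivity
  have hs' : s₁ - δ < s := by
    by_contra hcon
    push Not at hcon
    have : μ * δ ≤ μ * (s₁ - s) := mul_le_mul_of_nonneg_left (by linarith) hμ0.le
    linarith
  have hx' : |x - x₁| < δ := by
    by_contra hcon
    push Not at hcon
    have : δ ^ 2 ≤ (x - x₁) ^ 2 := by rw [← sq_abs (x - x₁)]; exact pow_le_pow_left₀ hδ.le hcon 2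
    have := mul_le_mul_of_nonneg_left this hμ0.le
    linarith
  have hsI := hsub s hs
  -- spatial derivatives
  have d1 : ∀ z, HasDerivAt (q s) (E s * wx' s z - μ * (2 * (z - x₁))) z := by
    intro z
    have e1 := (hc.dx s hsI z).const_mul (E s)
    have e2 := (((hasDerivAt_id' z).sub_const x₁).fun_pow 2).const_mul μ
    exact ((e1.sub e2).sub_const _).congr_deriv (by push_cast; ring)
  have d2 : HasDerivAt (fun z => E s * wx' s z - μ * (2 * (z - x₁))) (E s * wxx' s x - μ * 2) x := by
    have e1 := (hc.dxx s hsI x).const_mul (E s)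
    have e2 := (((hasDerivAt_id' x).sub_const x₁).const_mul 2).const_mul μ
    exact (e1.sub e2).congr_deriv (by ring)
  have hloc : IsLocalMax (q s) x := by
    rw [abs_lt] at hx'
    filter_upwards [Icc_mem_nhds (by linarith : x₁ - δ < x) (by linarith : x < x₁ + δ)] with z hz
    exact hm' s hs z hz
  have c1 := hloc.hasDerivAt_eq_zero (d1 x)
  have c2 := second_deriv_max (Eventually.of_forall d1) d2 hloc
  have d3 : HasDerivAt (fun r => q r x) (E s * wt' s x - (C + 1) * (E s * w' s x) + μ) s := by
    have e0 : HasDerivAt E (-(C + 1) * E s) s := by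
      have := ((((hasDerivAt_id' s).sub_const a).const_mul (C + 1)).fun_neg).exp
      exact this.congr_deriv (by simp only [hE]; ring)
    have e1 := e0.fun_mul (hc.dt s hsI x)
    have e2 := ((hasDerivAt_id' s).const_sub s₁).const_mul μ
    exact ((e1.sub_const (μ * (x - x₁) ^ 2)).sub e2).congr_deriv (by ring)
  have c3 := left_max_deriv hs' d3 (fun r hr => hm' r ⟨hr.1, hr.2.trans hs.2⟩ x hx)
  have c4 := (abs_le.1 (hc.eq s hsI x)).2
  have c5 := mul_le_mul_of_nonneg_left c4 (hE0 s).le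
  have hwp : 0 < E s * w' s x := by
    have : ε ≤ μ := by linarith
    have : 0 ≤ μ * C := by positivity
    linarith
  have hwp' : 0 < w' s x := pos_of_mul_pos_right hwp (hE0 s).le
  rw [abs_of_pos hwp'] at c5
  have c6 : E s * |wx' s x| ≤ 2 * μ := by
    have : E s * |wx' s x| = |μ * (2 * (x - x₁))| := by
      rw [← abs_of_pos (hE0 s), ← abs_mul]
      congr 1; linarith
    rw [this, abs_mul, abs_of_pos hμ0, abs_mul, abs_two]
    have := mul_le_mul_of_nonneg_left hx'.le hμ0.le
    linarith
  have c7 := mul_le_mul_of_nonneg_left c6 hC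
  have : 0 ≤ μ * C := by positivity
  have : ε ≤ μ := by linarith
  linarith

/-- backward reachability inside the positivity set -/
def Rch (w : ℝ → ℝ → ℝ) (t₂ x₂ s x : ℝ) : Prop :=
  s ≤ t₂ ∧ ∃ γ : ℝ → ℝ, ContinuousOn γ (Icc s t₂) ∧ γ s = x ∧ γ t₂ = x₂ ∧ ∀ r ∈ Icc s t₂, 0 < w r (γ r)

lemma Rch.ext {w : ℝ → ℝ → ℝ} {t₂ x₂ s x s' x' : ℝ} (h : Rch w t₂ x₂ s x) (hs : s' < s)
    (hp : ∀ r ∈ Icc s' s, ∀ z ∈ uIcc x' x, 0 < w r z) : Rch w t₂ x₂ s' x' := by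
  obtain ⟨hst, γ, hc, h1, h2, h3⟩ := h
  have hss : 0 < s - s' := by linarith
  set ln : ℝ → ℝ := fun r => x' + (r - s') / (s - s') * (x - x') with hln
  have lns : ln s = x := by simp only [hln]; rw [div_self hss.ne']; ring
  refine ⟨hs.le.trans hst, fun r => γ (max r s) - x + ln (min r s), ?_, ?_, ?_, ?_⟩
  · refine ContinuousOn.add (ContinuousOn.sub ?_ continuousOn_const) (Continuous.continuousOn ?_)
    · exact hc.comp (by fun_prop) (fun r hr => ⟨le_max_right _ _, max_le hr.2 hst⟩)
    · simp only [hln]; fun_prop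
  · simp only [max_eq_right hs.le, min_eq_left hs.le, h1]
    simp [hln]
  · simp only [max_eq_left hst, min_eq_right hst, h2, lns]; ring
  · intro r hr
    rcases le_total r s with hrs | hrs
    · simp only [max_eq_right hrs, min_eq_left hrs, h1, sub_self, zero_add]
      refine hp r ⟨hr.1, hrs⟩ _ ?_
      have hq0 : 0 ≤ (r - s') / (s - s') := div_nonneg (by linarith [hr.1]) hss.le
      have hq1 : (r - s') / (s - s') ≤ 1 := by rw [div_le_one hss]; linarith
      rw [← segment_eq_uIcc]
      refine ⟨1 - (r - s') / (s - s'), (r - s') / (s - s'), by linarith, hq0, by ring, ?_⟩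
      simp only [hln, smul_eq_mul]; ring
    · simp only [max_eq_left hrs, min_eq_right hrs, lns, sub_add_cancel]
      exact h3 r ⟨hrs, hr.2⟩

lemma trace_pos {C a b t₁ t₂ x₂ : ℝ} {w wx : ℝ → ℝ → ℝ} (h : SC C a b w wx) (ha : a ≤ t₁) (h12 : t₁ ≤ t₂)
    (hb : t₂ ≤ b) (hpos : 0 < w t₂ x₂) : ∃ x, Rch w t₂ x₂ t₁ x := by
  set D : Set (ℝ × ℝ) := {p | t₁ ≤ p.1 ∧ ∃ n : ℤ, Rch w t₂ x₂ p.1 (p.2 + n)} with hD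
  set D0 : Set (ℝ × ℝ) := D ∩ (univ ×ˢ Icc 0 1) with hD0
  have hper : ∀ t x, ∀ n : ℤ, w t (x + n) = w t x := fun t x n => by
    have := (h.per t).int_mul n x
    simpa using this
  have hD0sub : D0 ⊆ Icc t₁ t₂ ×ˢ Icc 0 1 := by
    rintro ⟨s, x⟩ ⟨⟨h1, n, h2⟩, h3⟩
    exact ⟨⟨h1, h2.1⟩, h3.2⟩
  have hclsub : closure D0 ⊆ Icc t₁ t₂ ×ˢ Icc 0 1 := closure_minimal hD0sub (isClosed_Icc.prod isClosed_Icc)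
  have hcomp : IsCompact (closure D0) := (isCompact_Icc.prod isCompact_Icc).of_isClosed_subset isClosed_closure hclsub
  have hsubI : Icc t₁ t₂ ⊆ Icc a b := Icc_subset_Icc ha hb
  -- moving a point of D to the fundamental domain
  have hfr : ∀ s x, (s, x) ∈ D → (s, Int.fract x) ∈ D0 := by
    rintro s x ⟨h1, n, h2⟩
    refine ⟨⟨h1, n + ⌊x⌋, ?_⟩, mem_univ _, ⟨Int.fract_nonneg x, (Int.fract_lt_one x).le⟩⟩
    have : Int.fract x + ((n + ⌊x⌋ : ℤ) : ℝ) = x + n := by push_cast; linarith [Int.fract_add_floor x]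
    simp only [this]
    exact h2
  have hwfr : ∀ t x, w t (Int.fract x) = w t x := fun t x => by
    have := hper t (Int.fract x) ⌊x⌋
    rw [Int.fract_add_floor] at this
    exact this.symm
  have h20 : (t₂, x₂) ∈ D := ⟨h12, 0, le_rfl, fun _ => x₂, continuousOn_const, by simp, rfl, fun r hr => by
    rw [Icc_self, mem_singleton_iff] at hr
    rw [hr]; exact hpos⟩
  set H : ℝ × ℝ → ℝ := fun p => Real.exp (-((C + 1) * (p.1 - a))) * w p.1 p.2 with hH
  have hHc : ContinuousOn H (Icc a b ×ˢ univ) := by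
    refine ContinuousOn.mul (Continuous.continuousOn (by fun_prop)) h.cw
  obtain ⟨⟨s₁, x₁⟩, hmem, hmax⟩ := hcomp.exists_isMaxOn ⟨_, subset_closure (hfr _ _ h20)⟩
    (hHc.mono (hclsub.trans (prod_mono hsubI (subset_univ _))))
  have hmaxD : ∀ s x, (s, x) ∈ D → H (s, x) ≤ H (s₁, x₁) := by
    intro s x hsx
    have h1 := hmax (subset_closure (hfr s x hsx))
    have h2 : H (s, Int.fract x) = H (s, x) := by simp only [hH, hwfr]
    rw [mem_setOf_eq, h2] at h1
    exact h1
  have hs1 := (hclsub hmem).1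
  have hw1 : 0 < w s₁ x₁ := by
    have h1 := hmaxD _ _ h20
    have h2 : 0 < H (t₂, x₂) := mul_pos (Real.exp_pos _) hpos
    exact pos_of_mul_pos_right (h2.trans_le h1) (Real.exp_pos _).le
  -- positivity box
  obtain ⟨δ, hδ, hbox⟩ : ∃ δ > 0, ∀ s ∈ Icc a b, ∀ x, |s - s₁| ≤ δ → |x - x₁| ≤ δ → 0 < w s x := by
    have h1 := (h.cw (s₁, x₁) ⟨hsubI hs1, mem_univ _⟩).eventually (lt_mem_nhds hw1)
    obtain ⟨δ, hδ, hb⟩ := Metric.mem_nhdsWithin_iff.1 h1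
    refine ⟨δ / 2, by positivity, fun s hs x h2 h3 => ?_⟩
    have : (s, x) ∈ Metric.ball (s₁, x₁) δ ∩ Icc a b ×ˢ univ := by
      refine ⟨?_, hs, mem_univ _⟩
      rw [Metric.mem_ball, Prod.dist_eq, Real.dist_eq, Real.dist_eq]
      exact max_lt (by linarith) (by linarith)
    exact hb this
  have hnear : ∀ η > 0, ∃ s x, ∃ n : ℤ, t₁ ≤ s ∧ Rch w t₂ x₂ s (x + n) ∧ |s - s₁| < η ∧ |x - x₁| < η := by
    intro η hη
    obtain ⟨⟨s, x⟩, ⟨⟨h1, n, h2⟩, -⟩, hd⟩ := Metric.mem_closure_iff.1 hmem η hη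
    rw [dist_comm, Prod.dist_eq, Real.dist_eq, Real.dist_eq] at hd
    exact ⟨s, x, n, h1, h2, (le_max_left _ _).trans_lt hd, (le_max_right _ _).trans_lt hd⟩
  rcases hs1.1.eq_or_lt with he | hlt
  · -- the initial time is reached
    obtain ⟨s, x, n, h1, h2, h3, h4⟩ := hnear δ hδ
    rcases h1.eq_or_lt with h5 | h5
    · rw [← h5] at h2; exact ⟨_, h2⟩
    · refine ⟨x + n, h2.ext h5 fun r hr z hz => ?_⟩
      rw [uIcc_self, mem_singleton_iff] at hz
      rw [hz, hper]
      refine hbox r ⟨ha.trans hr.1, hr.2.trans (h2.1.trans hb)⟩ x ?_ h4.le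
      rw [abs_lt] at h3
      rw [abs_le]
      constructor <;> linarith [hr.1, hr.2]
  · exfalso
    set δ' := min (min δ 1) (s₁ - t₁) with hδ'
    have k1 : δ' ≤ δ := (min_le_left _ _).trans (min_le_left _ _)
    have k2 : δ' ≤ 1 := (min_le_left _ _).trans (min_le_right _ _)
    have k3 : δ' ≤ s₁ - t₁ := min_le_right _ _
    have k0 : 0 < δ' := lt_min (lt_min hδ one_pos) (by linarith)
    have hlt' : ∀ s ∈ Ico (s₁ - δ') s₁, ∀ x ∈ Icc (x₁ - δ') (x₁ + δ'), H (s, x) ≤ H (s₁, x₁) := by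
      intro s hs x hx
      obtain ⟨s', x', n, h1, h2, h3, h4⟩ := hnear (min δ (s₁ - s)) (lt_min hδ (by linarith [hs.2]))
      have h5 := h3.trans_le (min_le_left _ _)
      have h6 := h3.trans_le (min_le_right _ _)
      have h7 := h4.trans_le (min_le_left _ _)
      rw [abs_lt] at h5 h6 h7
      refine hmaxD s x ⟨by simp only; linarith [hs.1], n, h2.ext (by simp only; linarith) fun r hr z hz => ?_⟩
      simp only at hr hz
      rw [← hper r z (-n)]
      refine hbox r ⟨by linarith [hr.1, hs.1], hr.2.trans (h2.1.trans hb)⟩ _ ?_ ?_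
      · rw [abs_le]; constructor <;> linarith [hr.1, hr.2, hs.1]
      · push_cast
        have hz' : z ∈ Icc (x₁ - δ + n) (x₁ + δ + n) := by
          refine uIcc_subset_Icc ?_ ?_ hz
          · constructor <;> linarith [hx.1, hx.2]
          · constructor <;> linarith
        rw [abs_le]; constructor <;> linarith [hz'.1, hz'.2]
    refine trace_max h k0 k2 (by linarith) (hs1.2.trans hb) hw1 (x₁ := x₁) ?_
    intro s hs x hx
    rcases hs.2.eq_or_lt with h5 | h5
    · subst h5
      have hc : ContinuousWithinAt (fun r => H (r, x)) (Icc a b) s :=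
        (hHc (s, x) ⟨hsubI hs1, mem_univ _⟩).comp (f := fun r : ℝ => (r, x)) (by fun_prop) (fun r hr => ⟨hr, mem_univ _⟩)
      have hc2 : Tendsto (fun r => H (r, x)) (𝓝[<] s) (𝓝 (H (s, x))) := by
        refine hc.mono_left ?_
        refine nhdsWithin_le_iff.2 ?_
        filter_upwards [Ioo_mem_nhdsLT (by linarith : s - δ' < s)] with r hr
        exact ⟨by linarith [hr.1], by linarith [hr.2, hs1.2]⟩
      refine le_of_tendsto hc2 ?_
      filter_upwards [Ioo_mem_nhdsLT (by linarith : s - δ' < s)] with r hr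
      exact hlt' r ⟨hr.1.le, hr.2⟩ x hx
    · exact hlt' s ⟨hs.1, h5⟩ x hx

lemma trace {C a b t₁ t₂ x₂ : ℝ} {w wx : ℝ → ℝ → ℝ} (h : SC C a b w wx) (ha : a ≤ t₁) (h12 : t₁ ≤ t₂)
    (hb : t₂ ≤ b) (hne : w t₂ x₂ ≠ 0) :
    ∃ γ : ℝ → ℝ, ContinuousOn γ (Icc t₁ t₂) ∧ γ t₂ = x₂ ∧ ∀ s ∈ Icc t₁ t₂, w s (γ s) ≠ 0 := by
  rcases lt_or_gt_of_ne hne with hl | hl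
  · obtain ⟨x, -, γ, hc, -, h2, h3⟩ := trace_pos h.neg ha h12 hb (x₂ := x₂) (by linarith)
    exact ⟨γ, hc, h2, fun s hs => by have := h3 s hs; intro h0; simp only [h0] at this; linarith⟩
  · obtain ⟨x, -, γ, hc, -, h2, h3⟩ := trace_pos h ha h12 hb hl
    exact ⟨γ, hc, h2, fun s hs => (h3 s hs).ne'⟩

end SturmPf

namespace SturmPf
open Filter Topology MeasureTheory ProbabilityTheory

/-- alternating chain -/
def LC (φ : ℝ → ℝ) (n : ℕ) (x : ℕ → ℝ) : Prop :=
  ∀ i < n, x i < x (i + 1) ∧ φ (x i) * φ (x (i + 1)) < 0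

/-- alternating chain winding once around the circle -/
def ZC (φ : ℝ → ℝ) (k : ℕ) : Prop := ∃ x, LC φ k x ∧ x k = x 0 + 1

/-- alternating chain with given end points -/
def EC (φ : ℝ → ℝ) (A B : ℝ) (n : ℕ) : Prop := ∃ x, LC φ n x ∧ x 0 = A ∧ x n = B

lemma LC.mono {φ : ℝ → ℝ} {n : ℕ} {x : ℕ → ℝ} (h : LC φ n x) {i j : ℕ} (hij : i ≤ j) (hj : j ≤ n) : x i ≤ x j := by
  induction j, hij using Nat.le_induction with
  | base => exact le_rfl
  | succ j hij ih => exact (ih (by omega)).trans (h j (by omega)).1.le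

lemma LC.lt {φ : ℝ → ℝ} {n : ℕ} {x : ℕ → ℝ} (h : LC φ n x) {i j : ℕ} (hij : i < j) (hj : j ≤ n) : x i < x j :=
  (h i (by omega)).1.trans_le (h.mono (Nat.succ_le_of_lt hij) hj)

lemma LC.ne {φ : ℝ → ℝ} {n : ℕ} {x : ℕ → ℝ} (h : LC φ n x) (hn : 0 < n) {i : ℕ} (hi : i ≤ n) : φ (x i) ≠ 0 := by
  intro h0
  rcases hi.lt_or_eq with h1 | h1
  · have := (h i h1).2; rw [h0] at this; linarith
  · obtain ⟨m, rfl⟩ : ∃ m, n = m + 1 := ⟨n - 1, by omega⟩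
    have := (h m (by omega)).2; rw [← h1, h0] at this; linarith

lemma ZC.mem {φ : ℝ → ℝ} {k : ℕ} (h : ZC φ k) (hp : Function.Periodic φ 1) :
    ∃ x : Fin k → ℝ, StrictMono x ∧ (∀ i j : Fin k, x j < x i + 1) ∧
      ∀ i : Fin k, φ (x i) * φ (x (finRotate k i)) < 0 := by
  obtain ⟨y, hy, hk⟩ := h
  refine ⟨fun i => y i, fun i j hij => hy.lt hij j.2.le, fun i j => ?_, fun i => ?_⟩
  · have h1 := hy.lt j.2 le_rfl
    have h2 := hy.mono (Nat.zero_le i) i.2.le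
    linarith
  · obtain ⟨m, rfl⟩ : ∃ m, k = m + 1 := ⟨k - 1, by have := i.2; omega⟩
    rcases eq_or_ne i (Fin.last m) with rfl | hi
    · have := (hy m (by omega)).2
      rw [hk, hp] at this
      simpa using this
    · have h1 : ((finRotate (m + 1) i : Fin (m + 1)) : ℕ) = i + 1 := coe_finRotate_of_ne_last hi
      simp only [h1]
      exact (hy i i.2).2

lemma ZC.of {φ : ℝ → ℝ} {k : ℕ} (hk : 0 < k) (hp : Function.Periodic φ 1) {x : Fin k → ℝ} (h1 : StrictMono x)
    (h2 : ∀ i j : Fin k, x j < x i + 1) (h3 : ∀ i : Fin k, φ (x i) * φ (x (finRotate k i)) < 0) : ZC φ k := by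
  obtain ⟨m, rfl⟩ : ∃ m, k = m + 1 := ⟨k - 1, by omega⟩
  refine ⟨fun i => if h : i < m + 1 then x ⟨i, h⟩ else x 0 + 1, fun i hi => ?_, by simp⟩
  rcases Nat.lt_or_ge (i + 1) (m + 1) with h | h
  · simp only [hi, h, dif_pos]
    refine ⟨h1 (by simp [Fin.lt_def]), ?_⟩
    have := h3 ⟨i, hi⟩
    rwa [finRotate_of_lt (by omega)] at this
  · have him : i = m := by omega
    subst him
    simp only [hi, dif_pos, lt_irrefl, not_false_eq_true, dif_neg]
    refine ⟨h2 _ _, ?_⟩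
    have := h3 (Fin.last i)
    rw [finRotate_last] at this
    rw [hp]
    exact this

lemma ZC.le {φ : ℝ → ℝ} {k : ℕ} (h : ZC φ k) (hp : Function.Periodic φ 1) : (k : ℕ∞) ≤ zeroNumber φ := by
  unfold zeroNumber
  exact le_iSup₂_of_le k (h.mem hp) le_rfl

lemma zn_le {φ : ℝ → ℝ} {N : ℕ∞} (hp : Function.Periodic φ 1) (h : ∀ k, ZC φ k → (k : ℕ∞) ≤ N) : zeroNumber φ ≤ N := by
  unfold zeroNumber
  refine iSup₂_le fun k hk => ?_
  obtain ⟨x, h1, h2, h3⟩ := hk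
  rcases Nat.eq_zero_or_pos k with rfl | h0
  · simp
  · exact h k (ZC.of h0 hp h1 h2 h3)

lemma zn_mono {φ ψ : ℝ → ℝ} (hp : Function.Periodic φ 1) (hq : Function.Periodic ψ 1) (h : ∀ k, ZC φ k → ZC ψ k) :
    zeroNumber φ ≤ zeroNumber ψ := zn_le hp fun k hk => (h k hk).le hq

lemma ZC.two_le {φ : ℝ → ℝ} {k : ℕ} (h : ZC φ k) (hp : Function.Periodic φ 1) : 2 ≤ k := by
  obtain ⟨x, hx, hk⟩ := h
  by_contra h2
  have : k = 0 ∨ k = 1 := by omega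
  rcases this with rfl | rfl
  · linarith
  · have := (hx 0 one_pos).2
    simp only [zero_add] at this
    rw [hk, hp] at this
    linarith [mul_self_nonneg (φ (x 0))]

/-- the biinfinite extension -/
lemma ZC.ext {φ : ℝ → ℝ} {k : ℕ} (h : ZC φ k) (hp : Function.Periodic φ 1) :
    ∃ y : ℕ → ℝ, (∀ n, LC φ n y) ∧ ∀ i, y (i + k) = y i + 1 := by
  have hk2 := h.two_le hp
  obtain ⟨x, hx, hk⟩ := h
  have hk0 : 0 < k := by omega
  have hpn : ∀ (n : ℕ) (z : ℝ), φ (z + n) = φ z := fun n z => by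
    have := hp.nat_mul n z
    simpa using this
  refine ⟨fun i => x (i % k) + ((i / k : ℕ) : ℝ), fun n i _ => ?_, fun i => ?_⟩
  · simp only [hpn]
    have hm := Nat.mod_lt i hk0
    rcases Nat.lt_or_ge (i % k + 1) k with h | h
    · have h1 : (i + 1) % k = i % k + 1 := by
        rw [Nat.add_mod, Nat.mod_eq_of_lt (by omega : 1 < k), Nat.mod_eq_of_lt h]
      have h2 : (i + 1) / k = i / k := by
        rw [Nat.succ_div, if_neg, add_zero]
        intro h3
        have := Nat.mod_eq_zero_of_dvd h3
        omega
      rw [h1, h2]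
      have := hx _ hm
      exact ⟨by linarith [this.1], this.2⟩
    · have h0 : i % k + 1 = k := by omega
      have h1 : (i + 1) % k = 0 := by
        rw [Nat.add_mod, Nat.mod_eq_of_lt (by omega : 1 < k), h0, Nat.mod_self]
      have h2 : (i + 1) / k = i / k + 1 := by
        rw [Nat.succ_div, if_pos (Nat.dvd_of_mod_eq_zero h1)]
      rw [h1, h2]
      have := hx _ hm
      rw [h0, hk, hp] at this
      refine ⟨by push_cast; linarith [this.1], this.2⟩
  · simp only [Nat.add_mod_right, Nat.add_div_right _ hk0]
    push_cast
    ring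

/-- rotate a cyclic chain to start at a prescribed point -/
lemma ZC.rot {φ : ℝ → ℝ} {k : ℕ} (h : ZC φ k) (hp : Function.Periodic φ 1) {P : ℝ} (hP : φ P ≠ 0) : EC φ P (P + 1) k := by
  have hk2 := h.two_le hp
  obtain ⟨y, hy, hyk⟩ := h.ext hp
  -- normalise
  obtain ⟨z, hz, hzk, hz0, hz1⟩ : ∃ z : ℕ → ℝ, (∀ n, LC φ n z) ∧ (∀ i, z (i + k) = z i + 1) ∧ z 0 ≤ P ∧ P < z k := by
    have hpn : ∀ (n : ℤ) (z : ℝ), φ (z + n) = φ z := fun n z => by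
      have := hp.int_mul n z
      simpa using this
    refine ⟨fun i => y i + (⌊P - y 0⌋ : ℤ), fun n i hi => ?_, fun i => ?_, ?_, ?_⟩
    · simp only [hpn]
      have := hy n i hi
      exact ⟨by linarith [this.1], this.2⟩
    · simp only [hyk]; ring
    · simp only; linarith [Int.floor_le (P - y 0)]
    · have := hyk 0
      rw [zero_add] at this
      simp only [this]
      linarith [Int.lt_floor_add_one (P - y 0)]
  obtain ⟨i, hik, hi0, hi1⟩ : ∃ i < k, z i ≤ P ∧ P < z (i + 1) := by
    classical
    have hex : ∃ j, P < z j := ⟨k, hz1⟩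
    have h1 := Nat.find_spec hex
    have h2 : Nat.find hex ≠ 0 := by
      intro h0; rw [h0] at h1; linarith
    obtain ⟨m, hm⟩ := Nat.exists_eq_succ_of_ne_zero h2
    refine ⟨m, ?_, ?_, ?_⟩
    · have := Nat.find_min' hex hz1; omega
    · exact not_lt.1 (Nat.find_min hex (by omega))
    · rw [hm] at h1; exact h1
  have hz' : ∀ i, z i < z (i + 1) ∧ φ (z i) * φ (z (i + 1)) < 0 := fun i => hz (i + 1) i (by omega)
  have hs := (hz' i).2
  have h0 : φ (z i) ≠ 0 := by intro h0; rw [h0] at hs; linarith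
  have h1 : φ (z (i+1)) ≠ 0 := by intro h0; rw [h0] at hs; linarith
  obtain ⟨j, hj1, hj2, hj3⟩ : ∃ j, P < z (j + 1) ∧ z (j + (k - 1)) < P + 1 ∧ 0 < φ P * φ (z j) := by
    have hzk' : z (i + (k - 1)) < z (i + k) := by
      have := (hz' (i + (k - 1))).1
      rwa [show i + (k - 1) + 1 = i + k by omega] at this
    rcases lt_or_gt_of_ne (mul_ne_zero hP h0) with h2 | h2
    · refine ⟨i + 1, hi1.trans (hz' _).1, ?_, ?_⟩
      · rw [show i + 1 + (k - 1) = i + k by omega, hzk]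
        have : z i ≠ P := by
          rintro rfl; linarith [mul_self_nonneg (φ (z i))]
        have := lt_of_le_of_ne hi0 this
        linarith
      · have h3 := mul_pos_of_neg_of_neg h2 hs
        have h4 : φ P * φ (z i) * (φ (z i) * φ (z (i+1))) = (φ P * φ (z (i+1))) * (φ (z i))^2 := by ring
        rw [h4] at h3
        exact pos_of_mul_pos_left h3 (sq_nonneg _)
    · exact ⟨i, hi1, by linarith [hzk i], h2⟩
  have sg : ∀ q, φ (z j) * q < 0 → φ P * q < 0 := by
    intro q hq
    have h3 := mul_neg_of_pos_of_neg hj3 hq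
    have h4 : φ P * φ (z j) * (φ (z j) * q) = (φ P * q) * (φ (z j))^2 := by ring
    rw [h4] at h3
    by_contra h5
    exact absurd h3 (not_lt.2 (mul_nonneg (not_lt.1 h5) (sq_nonneg _)))
  refine ⟨fun n => if n = 0 then P else if n = k then P + 1 else z (j + n), fun n hn => ?_, by simp, by simp; omega⟩
  have hk0 : k ≠ 0 := by omega
  rcases Nat.eq_zero_or_pos n with rfl | hn0
  · simp only [zero_add, one_ne_zero, if_false, if_true, if_neg (show ¬ (1 = k) by omega)]
    exact ⟨hj1, sg _ (hz' j).2⟩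
  · beta_reduce
    rw [if_neg hn0.ne', if_neg hn.ne, if_neg (Nat.succ_ne_zero n)]
    split_ifs with h5
    · have h6 : n = k - 1 := by omega
      rw [h6]
      refine ⟨hj2, ?_⟩
      rw [hp, mul_comm]
      refine sg _ ?_
      have := (hz' (j + (k - 1))).2
      rw [show j + (k - 1) + 1 = j + k by omega, hzk, hp] at this
      linarith [mul_comm (φ (z j)) (φ (z (j + (k - 1))))]
    · exact hz' (j + n)

lemma sign_const {g : ℝ → ℝ} {a b s t : ℝ} (hc : ContinuousOn g (Icc a b)) (hne : ∀ r ∈ Icc a b, g r ≠ 0)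
    (hs : s ∈ Icc a b) (ht : t ∈ Icc a b) (h : 0 < g s) : 0 < g t := by
  by_contra h1
  have h2 := lt_of_le_of_ne (not_lt.1 h1) (hne t ht)
  have := isPreconnected_Icc.intermediate_value ht hs hc
  obtain ⟨r, hr, hr0⟩ := this ⟨h2.le, h.le⟩
  exact hne r hr hr0

lemma transport {w : ℝ → ℝ → ℝ} {a b s t : ℝ} {n : ℕ} {γ : ℕ → ℝ → ℝ} (hγ : ∀ i ≤ n, ContinuousOn (γ i) (Icc a b))
    (hw : ∀ i ≤ n, ContinuousOn (fun r => w r (γ i r)) (Icc a b)) (hne : ∀ i ≤ n, ∀ r ∈ Icc a b, w r (γ i r) ≠ 0)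
    (hs : s ∈ Icc a b) (ht : t ∈ Icc a b) (h : LC (w s) n (fun i => γ i s)) : LC (w t) n (fun i => γ i t) := by
  intro i hi
  have h1 := h i hi
  have hp : ∀ r ∈ Icc a b, w r (γ i r) * w r (γ (i+1) r) < 0 := by
    intro r hr
    have := sign_const (g := fun r => -(w r (γ i r) * w r (γ (i+1) r))) ((hw i hi.le).mul (hw (i+1) hi)).neg
      (fun r hr => neg_ne_zero.2 (mul_ne_zero (hne _ hi.le r hr) (hne _ hi r hr))) hs hr (by linarith [h1.2])
    linarith
  refine ⟨?_, hp t ht⟩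
  have := sign_const (g := fun r => γ (i+1) r - γ i r) ((hγ (i+1) hi).sub (hγ i hi.le)) (fun r hr h0 => by
    have h2 := hp r hr
    rw [sub_eq_zero.1 h0] at h2
    linarith [mul_self_nonneg (w r (γ i r))]) hs ht (by linarith [h1.1])
  linarith

end SturmPf

namespace SturmPf
open Filter Topology MeasureTheory ProbabilityTheory

/-- chains visit `S` a bounded number of times -/
def QB (φ : ℝ → ℝ) (S : Set ℝ) : Prop :=
  ∃ L : ℕ, ∀ n x, LC φ n x → ∀ s : Finset ℕ, (∀ i ∈ s, i ≤ n ∧ x i ∈ S) → s.card ≤ L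

lemma QB.mono {φ : ℝ → ℝ} {S T : Set ℝ} (h : QB φ T) (hST : S ⊆ T) : QB φ S := by
  obtain ⟨L, hL⟩ := h
  exact ⟨L, fun n x hx s hs => hL n x hx s fun i hi => ⟨(hs i hi).1, hST (hs i hi).2⟩⟩

lemma QB.union {φ : ℝ → ℝ} {S T : Set ℝ} (h : QB φ S) (h' : QB φ T) : QB φ (S ∪ T) := by
  classical
  obtain ⟨L, hL⟩ := h
  obtain ⟨M, hM⟩ := h'
  refine ⟨L + M, fun n x hx s hs => ?_⟩
  have h1 := hL n x hx (s.filter fun i => x i ∈ S) fun i hi => by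
    rw [Finset.mem_filter] at hi
    exact ⟨(hs i hi.1).1, hi.2⟩
  have h2 := hM n x hx (s.filter fun i => x i ∉ S) fun i hi => by
    rw [Finset.mem_filter] at hi
    exact ⟨(hs i hi.1).1, (hs i hi.1).2.resolve_left hi.2⟩
  rw [← Finset.card_filter_add_card_filter_not (s := s) (fun i => x i ∈ S)]
  omega

lemma QB.sign {φ : ℝ → ℝ} {S : Set ℝ} (hS : OrdConnected S) (h : ∀ x ∈ S, ∀ y ∈ S, 0 ≤ φ x * φ y) : QB φ S := by
  refine ⟨1, fun n x hx s hs => ?_⟩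
  have key : ∀ i ∈ s, ∀ j ∈ s, ¬ i < j := by
    intro i hi j hj hij
    have h1 := hs i hi
    have h2 := hs j hj
    have h3 : x (i + 1) ∈ S := hS.out h1.2 h2.2 ⟨hx.mono (Nat.le_succ i) (by omega), hx.mono hij h2.1⟩
    have := (hx i (by omega)).2
    linarith [h _ h1.2 _ h3]
  rw [Finset.card_le_one]
  intro i hi j hj
  have := key i hi j hj
  have := key j hj i hi
  omega

lemma QB.simple {φ : ℝ → ℝ} {p d : ℝ} (hd : HasDerivAt φ d p) (h : φ p ≠ 0 ∨ d ≠ 0) : ∃ U ∈ 𝓝 p, QB φ U := by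
  by_cases h0 : φ p = 0
  · have hd0 := h.resolve_left (fun h1 => h1 h0)
    -- sign of difference quotient
    have hs : ∀ᶠ x in 𝓝[≠] p, 0 < d * (φ x * (x - p)) := by
      have h1 := hasDerivAt_iff_tendsto_slope.1 hd
      have h2 : Tendsto (fun x => d * slope φ p x) (𝓝[≠] p) (𝓝 (d * d)) := h1.const_mul d
      filter_upwards [h2.eventually (lt_mem_nhds (mul_self_pos.2 hd0)), self_mem_nhdsWithin] with x hx hxp
      have hxp' : x - p ≠ 0 := sub_ne_zero.2 hxp
      rw [slope_def_field, h0, sub_zero] at hx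
      have h3 := mul_pos hx (sq_pos_of_ne_zero hxp')
      have h4 : d * (φ x / (x - p)) * (x - p) ^ 2 = d * (φ x * (x - p)) := by field_simp
      linarith
    rw [eventually_nhdsWithin_iff, Metric.eventually_nhds_iff] at hs
    obtain ⟨ε, hε, hs⟩ := hs
    have hs' : ∀ x, |x - p| < ε → x ≠ p → 0 < d * (φ x * (x - p)) := fun x h1 h2 => hs (by rwa [Real.dist_eq]) h2
    refine ⟨Ioo (p - ε) (p + ε), Ioo_mem_nhds (by linarith) (by linarith), ?_⟩
    have e : Ioo (p - ε) (p + ε) ⊆ (Ioo (p - ε) p ∪ Icc p p) ∪ Ioo p (p + ε) := by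
      intro x hx
      rcases lt_trichotomy x p with h | h | h
      · exact Or.inl (Or.inl ⟨hx.1, h⟩)
      · exact Or.inl (Or.inr ⟨h.ge, h.le⟩)
      · exact Or.inr ⟨h, hx.2⟩
    have fin : ∀ x y, |x - p| < ε → x ≠ p → |y - p| < ε → y ≠ p → 0 < (x - p) * (y - p) → 0 ≤ φ x * φ y := by
      intro x y h1 h2 h3 h4 h5
      have h6 := mul_pos (hs' x h1 h2) (hs' y h3 h4)
      have h7 : d * (φ x * (x - p)) * (d * (φ y * (y - p))) = (φ x * φ y) * ((d * d) * ((x - p) * (y - p))) := by ring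
      rw [h7] at h6
      have := mul_self_pos.2 hd0
      exact (pos_of_mul_pos_left h6 (mul_pos this h5).le).le
    refine QB.mono ((QB.union (QB.sign ordConnected_Ioo ?_) (QB.sign ordConnected_Icc ?_)).union (QB.sign ordConnected_Ioo ?_)) e
    · intro x hx y hy
      refine fin x y ?_ hx.2.ne ?_ hy.2.ne (mul_pos_of_neg_of_neg (by linarith [hx.2]) (by linarith [hy.2])) <;>
      rw [abs_lt] <;> constructor <;> linarith [hx.1, hx.2, hy.1, hy.2]
    · intro x hx y hy
      rw [le_antisymm hx.2 hx.1, le_antisymm hy.2 hy.1]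
      exact mul_self_nonneg _
    · intro x hx y hy
      refine fin x y ?_ hx.1.ne' ?_ hy.1.ne' (mul_pos (by linarith [hx.1]) (by linarith [hy.1])) <;>
      rw [abs_lt] <;> constructor <;> linarith [hx.1, hx.2, hy.1, hy.2]
  · have hc : ∀ᶠ x in 𝓝 p, 0 < φ p * φ x := by
      have : Tendsto (fun x => φ p * φ x) (𝓝 p) (𝓝 (φ p * φ p)) := hd.continuousAt.tendsto.const_mul _
      exact this.eventually (lt_mem_nhds (mul_self_pos.2 h0))
    rw [Metric.eventually_nhds_iff] at hc
    obtain ⟨ε, hε, hs⟩ := hc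
    refine ⟨Metric.ball p ε, Metric.ball_mem_nhds _ hε, QB.sign ?_ ?_⟩
    · rw [Real.ball_eq_Ioo]; exact ordConnected_Ioo
    · intro x hx y hy
      have h6 := mul_pos (hs hx) (hs hy)
      have h7 : φ p * φ x * (φ p * φ y) = (φ x * φ y) * (φ p * φ p) := by ring
      rw [h7] at h6
      exact (pos_of_mul_pos_left h6 (mul_self_nonneg _)).le

lemma QB.compact {φ : ℝ → ℝ} {K : Set ℝ} (hK : IsCompact K) (h : ∀ p ∈ K, ∃ U ∈ 𝓝 p, QB φ U) : QB φ K := by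
  refine hK.induction_on (p := QB φ) ⟨0, fun n x _ s hs => ?_⟩ (fun S T hST hT => hT.mono hST) (fun S T => QB.union) ?_
  · rw [Nat.le_zero, Finset.card_eq_zero, Finset.eq_empty_iff_forall_notMem]
    intro i hi
    exact (hs i hi).2
  · intro p hp
    obtain ⟨U, hU, hQ⟩ := h p hp
    exact ⟨U, mem_nhdsWithin_of_mem_nhds hU, hQ⟩

/-- it suffices to bound the length of chains inside an interval with non-vanishing end points -/
lemma QB.of_EC {φ : ℝ → ℝ} {A B : ℝ} {N : ℕ} (hA : φ A ≠ 0) (hB : φ B ≠ 0) (hAB : A < B)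
    (h : ∀ n, EC φ A B n → n ≤ N) : QB φ (Icc A B) := by
  classical
  -- step 1 : chains inside
  have h1 : ∀ n x, LC φ n x → (∀ i ≤ n, x i ∈ Icc A B) → n ≤ N := by
    intro n x hx hm
    rcases Nat.eq_zero_or_pos n with rfl | hn
    · exact Nat.zero_le _
    -- fix left end
    obtain ⟨n', hn', y, hy, hy0, hyn⟩ : ∃ n', n ≤ n' ∧ ∃ y, LC φ n' y ∧ y 0 = A ∧ y n' = x n := by
      have hx0 := hx.ne hn (Nat.zero_le n)
      rcases lt_or_gt_of_ne (mul_ne_zero hA hx0) with h2 | h2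
      · refine ⟨n + 1, by omega, fun i => if i = 0 then A else x (i - 1), fun i hi => ?_, by simp, by simp⟩
        rcases Nat.eq_zero_or_pos i with rfl | hi0
        · simp only [if_true, zero_add, one_ne_zero, if_false, Nat.sub_self]
          refine ⟨lt_of_le_of_ne (hm 0 (Nat.zero_le _)).1 ?_, h2⟩
          rintro rfl
          linarith [mul_self_nonneg (φ (x 0))]
        · simp only [hi0.ne', Nat.succ_ne_zero, if_false, Nat.add_sub_cancel]
          have := hx (i - 1) (by omega)
          rwa [Nat.sub_add_cancel hi0] at this
      · refine ⟨n, le_rfl, fun i => if i = 0 then A else x i, fun i hi => ?_, by simp, by simp [hn.ne']⟩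
        rcases Nat.eq_zero_or_pos i with rfl | hi0
        · simp only [if_true, zero_add, one_ne_zero, if_false]
          have h3 := hx 0 hn
          refine ⟨(hm 0 (Nat.zero_le _)).1.trans_lt h3.1, ?_⟩
          have h4 := mul_neg_of_pos_of_neg h2 h3.2
          have h5 : φ A * φ (x 0) * (φ (x 0) * φ (x (0 + 1))) = (φ A * φ (x (0+1))) * (φ (x 0) * φ (x 0)) := by ring
          rw [h5] at h4
          exact neg_of_mul_neg_left h4 (mul_self_nonneg _)
        · simp only [hi0.ne', Nat.succ_ne_zero, if_false]
          exact hx i hi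
    obtain ⟨m, rfl⟩ : ∃ m, n' = m + 1 := ⟨n' - 1, by omega⟩
    have hxB := (hm n le_rfl).2
    have hxn := hx.ne hn le_rfl
    rcases lt_or_gt_of_ne (mul_ne_zero hxn hB) with h2 | h2
    · have := h (m + 2) ⟨fun i => if i ≤ m + 1 then y i else B, fun i hi => ?_, by simp [hy0], by simp⟩
      · omega
      rcases Nat.lt_or_ge i (m + 1) with h3 | h3
      · simp only [show i ≤ m + 1 by omega, show i + 1 ≤ m + 1 by omega, if_true]
        exact hy i h3
      · have h4 : i = m + 1 := by omega
        subst h4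
        simp only [le_rfl, if_true, show ¬ (m + 1 + 1 ≤ m + 1) by omega, if_false, hyn]
        refine ⟨lt_of_le_of_ne hxB ?_, h2⟩
        rintro h5
        rw [h5] at h2
        linarith [mul_self_nonneg (φ B)]
    · have := h (m + 1) ⟨fun i => if i ≤ m then y i else B, fun i hi => ?_, by simp [hy0], by simp⟩
      · omega
      rcases Nat.lt_or_ge i m with h3 | h3
      · simp only [show i ≤ m by omega, show i + 1 ≤ m by omega, if_true]
        exact hy i (by omega)
      · have h4 : i = m := by omega
        subst h4
        simp only [le_rfl, if_true, show ¬ (i + 1 ≤ i) by omega, if_false]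
        have h3 := hy i (by omega)
        rw [hyn] at h3
        refine ⟨h3.1.trans_le hxB, ?_⟩
        have h4 := mul_neg_of_neg_of_pos h3.2 h2
        have h5 : φ (y i) * φ (x n) * (φ (x n) * φ B) = (φ (y i) * φ B) * (φ (x n) * φ (x n)) := by ring
        rw [h5] at h4
        exact neg_of_mul_neg_left h4 (mul_self_nonneg _)
  refine ⟨N + 1, fun n x hx s hs => ?_⟩
  rcases s.eq_empty_or_nonempty with rfl | hne
  · simp
  have hi := s.min'_mem hne
  have hj := s.max'_mem hne
  set i := s.min' hne with hi_def
  set j := s.max' hne with hj_def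
  have hij : i ≤ j := s.min'_le _ hj
  have hjn := (hs j hj).1
  have h2 := h1 (j - i) (fun l => x (i + l)) (fun l hl => hx (i + l) (by omega)) (fun l hl =>
    ⟨(hs i hi).2.1.trans (hx.mono (by omega) (by omega)), (hx.mono (by omega) hjn).trans (hs j hj).2.2⟩)
  have h3 : s ⊆ Finset.Icc i j := fun l hl => Finset.mem_Icc.2 ⟨s.min'_le _ hl, s.le_max' _ hl⟩
  have h4 := Finset.card_le_card h3
  rw [Nat.card_Icc] at h4
  omega

/-- local boundedness everywhere gives finiteness of the zero number -/
lemma zn_fin {φ : ℝ → ℝ} (hp : Function.Periodic φ 1) (h : ∀ p, ∃ U ∈ 𝓝 p, QB φ U) : zeroNumber φ ≠ ⊤ := by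
  obtain ⟨L, hL⟩ := QB.compact (φ := φ) (isCompact_Icc (a := (0:ℝ)) (b := 2)) (fun p _ => h p)
  have : zeroNumber φ ≤ (L : ℕ) := by
    refine zn_le hp fun k hk => ?_
    obtain ⟨x, hx, hxk⟩ := hk
    have hpn : ∀ (n : ℤ) (z : ℝ), φ (z + n) = φ z := fun n z => by
      have := hp.int_mul n z
      simpa using this
    have h1 := hL k (fun i => x i + ((-⌊x 0⌋ : ℤ) : ℝ)) (fun i hi => by
      simp only [hpn]
      have := hx i hi
      exact ⟨by linarith [this.1], this.2⟩) (Finset.range k) (fun i hi => by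
      rw [Finset.mem_range] at hi
      refine ⟨hi.le, ?_⟩
      have h1 := hx.mono (Nat.zero_le i) hi.le
      have h2 := hx.mono hi.le le_rfl
      have h3 := Int.floor_le (x 0)
      have h4 := Int.lt_floor_add_one (x 0)
      push_cast
      constructor <;> linarith)
    rw [Finset.card_range] at h1
    exact_mod_cast h1
  exact ne_top_of_le_ne_top (ENat.coe_ne_top L) this

end SturmPf

namespace SturmPf
open Filter Topology MeasureTheory ProbabilityTheory

/-- there is a non-vanishing curve over `[a,b]` through `(s,x)` -/
def Cv (w : ℝ → ℝ → ℝ) (a b s x : ℝ) : Prop :=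
  ∃ γ : ℝ → ℝ, ContinuousOn γ (Icc a b) ∧ ContinuousOn (fun r => w r (γ r)) (Icc a b) ∧ γ s = x ∧ ∀ r ∈ Icc a b, w r (γ r) ≠ 0

lemma zc_curves {w : ℝ → ℝ → ℝ} {a b s t : ℝ} {k : ℕ} (hp : ∀ r, Function.Periodic (w r) 1) (hs : s ∈ Icc a b)
    (ht : t ∈ Icc a b) (hcv : ∀ x, w s x ≠ 0 → Cv w a b s x) (h : ZC (w s) k) : ZC (w t) k := by
  have hk2 := h.two_le (hp s)
  obtain ⟨x, hx, hk⟩ := h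
  have h1 : ∀ i, ∃ γ : ℝ → ℝ, i ≤ k → ContinuousOn γ (Icc a b) ∧ ContinuousOn (fun r => w r (γ r)) (Icc a b) ∧
      γ s = x i ∧ ∀ r ∈ Icc a b, w r (γ r) ≠ 0 := by
    intro i
    by_cases hi : i ≤ k
    · obtain ⟨γ, h1⟩ := hcv (x i) (hx.ne (by omega) hi)
      exact ⟨γ, fun _ => h1⟩
    · exact ⟨0, fun h => absurd h hi⟩
  choose γ hγ using h1
  have h0 := hγ 0 (Nat.zero_le _)
  set δ : ℕ → ℝ → ℝ := fun i => if i = k then fun r => γ 0 r + 1 else γ i with hδ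
  have hδk : δ k = fun r => γ 0 r + 1 := by simp [hδ]
  have hδi : ∀ i, i ≠ k → δ i = γ i := fun i hi => by simp [hδ, hi]
  clear_value δ
  have hδs : ∀ i ≤ k, δ i s = x i := by
    intro i hi
    rcases eq_or_ne i k with rfl | hik
    · rw [hδk, hk]; simp [h0.2.2.1]
    · rw [hδi i hik]; exact (hγ i hi).2.2.1
  refine ⟨fun i => δ i t, transport (w := w) (a := a) (b := b) (s := s) ?_ ?_ ?_ hs ht ?_, ?_⟩
  · intro i hi
    rcases eq_or_ne i k with rfl | hik
    · rw [hδk]; exact h0.1.add continuousOn_const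
    · rw [hδi i hik]; exact (hγ i hi).1
  · intro i hi
    rcases eq_or_ne i k with rfl | hik
    · rw [hδk]; simp only [hp _ _]; exact h0.2.1
    · rw [hδi i hik]; exact (hγ i hi).2.1
  · intro i hi r hr
    rcases eq_or_ne i k with rfl | hik
    · rw [hδk]; simp only [hp _ _]; exact h0.2.2.2 r hr
    · rw [hδi i hik]; exact (hγ i hi).2.2.2 r hr
  · intro i hi
    simp only [hδs i hi.le, hδs (i+1) hi]
    exact hx i hi
  · simp only [hδk, hδi 0 (by omega)]

lemma ec_curves {w : ℝ → ℝ → ℝ} {a b s t A B : ℝ} {n : ℕ} (hs : s ∈ Icc a b)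
    (ht : t ∈ Icc a b) (hcv : ∀ x, w s x ≠ 0 → Cv w a b s x) (hA : ContinuousOn (fun r => w r A) (Icc a b))
    (hB : ContinuousOn (fun r => w r B) (Icc a b)) (hA0 : ∀ r ∈ Icc a b, w r A ≠ 0) (hB0 : ∀ r ∈ Icc a b, w r B ≠ 0)
    (h : EC (w s) A B n) : EC (w t) A B n := by
  obtain ⟨x, hx, hxA, hxB⟩ := h
  rcases Nat.eq_zero_or_pos n with rfl | hn
  · exact ⟨x, fun i hi => absurd hi (by omega), hxA, hxB⟩
  have h1 : ∀ i, ∃ γ : ℝ → ℝ, i ≤ n → ContinuousOn γ (Icc a b) ∧ ContinuousOn (fun r => w r (γ r)) (Icc a b) ∧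
      γ s = x i ∧ (∀ r ∈ Icc a b, w r (γ r) ≠ 0) ∧ (i = 0 → γ t = A) ∧ (i = n → γ t = B) := by
    intro i
    by_cases hi : i ≤ n
    · by_cases hi0 : i = 0
      · exact ⟨fun _ => A, fun _ => ⟨continuousOn_const, hA, by rw [hi0, hxA], hA0, fun _ => rfl, fun h => by omega⟩⟩
      by_cases hin : i = n
      · exact ⟨fun _ => B, fun _ => ⟨continuousOn_const, hB, by rw [hin, hxB], hB0, fun h => by omega, fun _ => rfl⟩⟩
      obtain ⟨γ, h1, h2, h3, h4⟩ := hcv (x i) (hx.ne (by omega) hi)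
      exact ⟨γ, fun _ => ⟨h1, h2, h3, h4, fun h => absurd h hi0, fun h => absurd h hin⟩⟩
    · exact ⟨0, fun h => absurd h hi⟩
  choose γ hγ using h1
  refine ⟨fun i => γ i t, transport (w := w) (a := a) (b := b) (s := s) (fun i hi => (hγ i hi).1) (fun i hi => (hγ i hi).2.1)
    (fun i hi => (hγ i hi).2.2.2.1) hs ht ?_, (hγ 0 (Nat.zero_le _)).2.2.2.2.1 rfl, (hγ n le_rfl).2.2.2.2.2 rfl⟩
  intro i hi
  simp only [(hγ i hi.le).2.2.1, (hγ (i+1) hi).2.2.1]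
  exact hx i hi

variable {C a b : ℝ} {w wx : ℝ → ℝ → ℝ}

lemma SC.cγ (h : SC C a b w wx) {c d : ℝ} (hc : a ≤ c) (hd : d ≤ b) {γ : ℝ → ℝ} (hγ : ContinuousOn γ (Icc c d)) :
    ContinuousOn (fun r => w r (γ r)) (Icc c d) :=
  h.cw.comp (f := fun r => (r, γ r)) (continuousOn_id.prodMk hγ) fun r hr => ⟨⟨hc.trans hr.1, hr.2.trans hd⟩, mem_univ _⟩

lemma SC.cv (h : SC C a b w wx) {t₁ t₂ : ℝ} (ha : a ≤ t₁) (h12 : t₁ ≤ t₂) (hb : t₂ ≤ b) {x : ℝ} (hx : w t₂ x ≠ 0) :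
    Cv w t₁ t₂ t₂ x := by
  obtain ⟨γ, h1, h2, h3⟩ := trace h ha h12 hb hx
  exact ⟨γ, h1, h.cγ ha hb h1, h2, h3⟩

lemma SC.zmono (h : SC C a b w wx) {t₁ t₂ : ℝ} (ha : a ≤ t₁) (h12 : t₁ ≤ t₂) (hb : t₂ ≤ b) :
    zeroNumber (w t₂) ≤ zeroNumber (w t₁) :=
  zn_mono (h.per _) (h.per _) fun _ hk => zc_curves h.per ⟨h12, le_rfl⟩ ⟨le_rfl, h12⟩ (fun _ hx => h.cv ha h12 hb hx) hk

lemma SC.ec (h : SC C a b w wx) {t₁ t₂ A B : ℝ} (ha : a ≤ t₁) (h12 : t₁ ≤ t₂) (hb : t₂ ≤ b)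
    (hA : ∀ r ∈ Icc t₁ t₂, w r A ≠ 0) (hB : ∀ r ∈ Icc t₁ t₂, w r B ≠ 0) {n : ℕ} (he : EC (w t₂) A B n) : EC (w t₁) A B n :=
  ec_curves ⟨h12, le_rfl⟩ ⟨le_rfl, h12⟩ (fun _ hx => h.cv ha h12 hb hx) (h.cγ ha hb continuousOn_const)
    (h.cγ ha hb continuousOn_const) hA hB he

lemma SC.fin (h : SC C a b w wx) (hne : ∃ x, w a x ≠ 0) {t₀ : ℝ} (hat : a < t₀) (htb : t₀ < b) :
    zeroNumber (w t₀) ≠ ⊤ := by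
  refine zn_fin (h.per _) fun x₀ => ?_
  obtain ⟨r, t', t'', hr, -, hat', -, ht', ht'', htb'', -, hlat, hsimp, -⟩ := core (x₀ := x₀) h hat htb hne one_pos
  refine ⟨Icc (x₀ - r) (x₀ + r), Icc_mem_nhds (by linarith) (by linarith), ?_⟩
  have hQ : QB (w t') (Icc (x₀ - r) (x₀ + r)) :=
    QB.compact isCompact_Icc fun p hp => QB.simple (h.dx t' ⟨hat'.le, by linarith⟩ p) (hsimp p hp)
  obtain ⟨L, hL⟩ := hQ
  have h0 := hlat t₀ ⟨ht'.le, ht''.le⟩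
  refine QB.of_EC (N := L) h0.1 h0.2 (by linarith) fun n hn => ?_
  obtain ⟨x, hx, hxA, hxB⟩ := h.ec hat'.le ht'.le htb.le (fun r hr => (hlat r ⟨hr.1, hr.2.trans ht''.le⟩).1)
    (fun r hr => (hlat r ⟨hr.1, hr.2.trans ht''.le⟩).2) hn
  have := hL n x hx (Finset.range n) fun i hi => by
    rw [Finset.mem_range] at hi
    exact ⟨hi.le, hxA ▸ hx.mono (Nat.zero_le _) hi.le, hxB ▸ hx.mono hi.le le_rfl⟩
  rwa [Finset.card_range] at this

lemma EC.append {φ : ℝ → ℝ} {A B D : ℝ} {n : ℕ} (h : EC φ A B n) (hBD : B < D) (hs : φ B * φ D < 0) : EC φ A D (n + 1) := by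
  obtain ⟨x, hx, h0, hn⟩ := h
  refine ⟨fun i => if i ≤ n then x i else D, fun i hi => ?_, by simp [h0], by simp⟩
  rcases Nat.lt_or_ge i n with h3 | h3
  · simp only [show i ≤ n by omega, show i + 1 ≤ n by omega, if_true]
    exact hx i (by omega)
  · have h4 : i = n := by omega
    subst h4
    simp only [le_rfl, if_true, show ¬ (i + 1 ≤ i) by omega, if_false, hn]
    exact ⟨hBD, hs⟩

lemma EC.zc {φ : ℝ → ℝ} {A : ℝ} {n : ℕ} (h : EC φ A (A + 1) n) : ZC φ n := by
  obtain ⟨x, hx, h0, hn⟩ := h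
  exact ⟨x, hx, by rw [h0, hn]⟩

lemma EC.refl (φ : ℝ → ℝ) (A : ℝ) : EC φ A A 0 := ⟨fun _ => A, fun i hi => absurd hi (by omega), rfl, rfl⟩

/-- drop the last point -/
lemma EC.init {φ : ℝ → ℝ} {A B : ℝ} {n : ℕ} (h : EC φ A B (n + 1)) : ∃ D, EC φ A D n ∧ D < B ∧ φ D * φ B < 0 := by
  obtain ⟨x, hx, h0, hn⟩ := h
  have := hx n (by omega)
  rw [hn] at this
  exact ⟨x n, ⟨x, fun i hi => hx i (by omega), h0, rfl⟩, this⟩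

lemma mul_sg {p q r : ℝ} (h1 : 0 < p * q) (h2 : r * q < 0) : r * p < 0 := by
  have h4 := mul_neg_of_pos_of_neg h1 h2
  have h5 : p * q * (r * q) = (r * p) * (q * q) := by ring
  rw [h5] at h4
  exact neg_of_mul_neg_left h4 (mul_self_nonneg _)

lemma zn_max {φ : ℝ → ℝ} (hp : Function.Periodic φ 1) (hf : zeroNumber φ ≠ ⊤) :
    ∃ k : ℕ, zeroNumber φ = k ∧ (k = 0 ∨ ZC φ k) := by
  by_contra hcon
  push Not at hcon
  obtain ⟨N, hN⟩ := ENat.ne_top_iff_exists.1 hf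
  have h1 := hcon N hN.symm
  have : zeroNumber φ ≤ ((N - 1 : ℕ) : ℕ∞) := by
    refine zn_le hp fun k hk => ?_
    have h2 := hk.le hp
    rw [← hN] at h2
    have h3 : k ≤ N := by exact_mod_cast h2
    have h4 : k ≠ N := by rintro rfl; exact h1.2 hk
    exact_mod_cast (by omega : k ≤ N - 1)
  rw [← hN] at this
  have h3 : N ≤ N - 1 := by exact_mod_cast this
  have := h1.1
  omega

lemma SC.drop (h : SC C a b w wx) (hne : ∃ x, w a x ≠ 0) {t₀ t₁ t₂ x₀ : ℝ} (ha : a ≤ t₁) (h1 : t₁ < t₀) (h2 : t₀ < t₂)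
    (hb : t₂ ≤ b) (h0 : w t₀ x₀ = 0) (hx0 : wx t₀ x₀ = 0) : zeroNumber (w t₂) < zeroNumber (w t₁) := by
  have hat : a < t₀ := by linarith
  have htb : t₀ < b := by linarith
  obtain ⟨r, t', t'', hr, hr4, hat', hθ', ht', ht'', htb'', hθ'', hlat, hsimp, hmul⟩ := core (x₀ := x₀) h hat htb hne
    (θ := min (t₀ - t₁) (t₂ - t₀)) (lt_min (by linarith) (by linarith))
  have hθ1 := min_le_left (t₀ - t₁) (t₂ - t₀)
  have hθ2 := min_le_right (t₀ - t₁) (t₂ - t₀)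
  refine (h.zmono (t₁ := t'') (by linarith) (by linarith) hb).trans_lt (lt_of_lt_of_le ?_
    (h.zmono (t₂ := t') ha (by linarith) (by linarith)))
  have hper' := h.per t'
  have hper'' := h.per t''
  obtain ⟨k, hk, hkz⟩ := zn_max hper'' (h.fin hne (by linarith) htb'')
  rw [hk]
  have htt : t' ≤ t'' := by linarith
  suffices hz : ZC (w t') (k + 2) by
    refine lt_of_lt_of_le ?_ (hz.le hper')
    exact_mod_cast (by omega : k < k + 2)
  have hl' := hlat t' ⟨le_rfl, htt⟩
  have hl'' := hlat t'' ⟨htt, le_rfl⟩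
  have hA1 : ∀ r' ∈ Icc t' t'', w r' (x₀ - r + 1) ≠ 0 := fun r' hr' => by rw [h.per]; exact (hlat r' hr').1
  have hB1 : ∀ r' ∈ Icc t' t'', w r' (x₀ + r) ≠ 0 := fun r' hr' => (hlat r' hr').2
  rcases hmul h0 hx0 with ⟨c, hc, hc1, hc2, hcs⟩ | ⟨c₁, c₂, hc1, hc12, hc2, hs1, hs2, hs3, M, hM, hmono⟩
  · rcases Nat.eq_zero_or_pos k with rfl | hkpos
    · have e1 := ((EC.refl (w t') (x₀ - r)).append hc.1 hc1).append (D := x₀ - r + 1) (by linarith [hc.2]) (by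
        rw [hper']; linarith [mul_comm (w t' (x₀ - r)) (w t' c)])
      exact e1.zc
    obtain ⟨m, rfl⟩ : ∃ m, k = m + 1 := ⟨k - 1, by omega⟩
    have hzk := hkz.resolve_left (by omega)
    obtain ⟨D, hD, hDB, hDs⟩ := (hzk.rot hper'' hl''.2).init
    rw [hper''] at hDs
    have hD1 : D < x₀ - r + 1 := by
      by_contra hcon
      have h5 := hcs (D - 1) ⟨by linarith, by linarith⟩
      rw [hper''.sub_eq] at h5
      have h6 := hcs (x₀ + r) ⟨by linarith, le_rfl⟩
      have h7 := mul_pos h5 h6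
      have h8 : w t'' (x₀ - r) * w t'' D * (w t'' (x₀ - r) * w t'' (x₀ + r))
        = (w t'' D * w t'' (x₀ + r)) * (w t'' (x₀ - r) * w t'' (x₀ - r)) := by ring
      rw [h8] at h7
      linarith [pos_of_mul_pos_left h7 (mul_self_nonneg _)]
    have e1 : EC (w t'') (x₀ + r) (x₀ - r + 1) (m + 1) := hD.append hD1 (by
      rw [hper'']
      exact mul_sg (hcs (x₀ + r) ⟨by linarith, le_rfl⟩) hDs)
    have e2 := h.ec hat'.le htt htb''.le hB1 hA1 e1
    have e3 := (e2.append (D := c + 1) (by linarith [hc.1]) (by rw [hper', hper']; exact hc1)).append (D := x₀ + r + 1)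
      (by linarith [hc.2]) (by rw [hper', hper']; exact hc2)
    exact e3.zc
  · have hABneg' : w t' (x₀ - r) * w t' (x₀ + r) < 0 := by
      have h5 := mul_pos_of_neg_of_neg hs1 hs2
      have h6 := mul_neg_of_pos_of_neg h5 hs3
      have h7 : w t' (x₀ - r) * w t' c₁ * (w t' c₁ * w t' c₂) * (w t' c₂ * w t' (x₀ + r)) =
        (w t' (x₀ - r) * w t' (x₀ + r)) * (w t' c₁ * w t' c₂) ^ 2 := by ring
      rw [h7] at h6
      exact neg_of_mul_neg_left h6 (sq_nonneg _)
    have hABneg : w t'' (x₀ - r) * w t'' (x₀ + r) < 0 := by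
      have := sign_const (g := fun s => -(w s (x₀ - r) * w s (x₀ + r))) (a := t') (b := t'')
        ((h.cγ hat'.le htb''.le continuousOn_const).mul (h.cγ hat'.le htb''.le continuousOn_const)).neg
        (fun s hs => neg_ne_zero.2 (mul_ne_zero (hlat s hs).1 (hlat s hs).2)) ⟨le_rfl, htt⟩ ⟨htt, le_rfl⟩ (by linarith)
      linarith
    rcases Nat.eq_zero_or_pos k with rfl | hkpos
    · have e1 := ((EC.refl (w t') (x₀ - r)).append hc1 hs1).append (D := x₀ - r + 1) (by linarith) (by
        rw [hper']; linarith [mul_comm (w t' (x₀ - r)) (w t' c₁)])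
      exact e1.zc
    have hzk := hkz.resolve_left (by omega)
    have hk2 := hzk.two_le hper''
    obtain ⟨m, rfl⟩ : ∃ m, k = m + 2 := ⟨k - 2, by omega⟩
    obtain ⟨D, hD, hDB, hDs⟩ := (hzk.rot hper'' hl''.2).init
    obtain ⟨E, hE, hED, hEs⟩ := hD.init
    rw [hper''] at hDs
    -- sign of `E` is the sign at `x₀ + r`
    have hEB : 0 < w t'' (x₀ + r) * w t'' E := by
      have h7 := mul_pos_of_neg_of_neg hDs hEs
      have h8 : w t'' D * w t'' (x₀ + r) * (w t'' E * w t'' D) = (w t'' (x₀ + r) * w t'' E) * (w t'' D * w t'' D) := by ring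
      rw [h8] at h7
      exact pos_of_mul_pos_left h7 (mul_self_nonneg _)
    have hEA : w t'' E * w t'' (x₀ - r) < 0 := by
      rw [mul_comm]
      exact mul_sg (p := w t'' E) (q := w t'' (x₀ + r)) (by linarith [mul_comm (w t'' E) (w t'' (x₀ + r))]) hABneg
    have hE1 : E < x₀ - r + 1 := by
      by_contra hcon
      push Not at hcon
      have m1 := hmono (a := E - 1) ⟨by linarith, by linarith⟩ (b := D - 1) ⟨by linarith, by linarith⟩ (by linarith)
      have m2 := hmono (a := D - 1) ⟨by linarith, by linarith⟩ (b := x₀ + r) ⟨by linarith, by linarith⟩ (by linarith)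
      simp only [hper''.sub_eq] at m1 m2
      -- E and B same sign, D opposite, D between
      have hM2 := mul_self_pos.2 hM
      have q1 : (M * w t'' D) * (M * w t'' (x₀ + r)) < 0 := by
        have := mul_neg_of_pos_of_neg hM2 hDs
        linarith [show (M * w t'' D) * (M * w t'' (x₀ + r)) = M * M * (w t'' D * w t'' (x₀ + r)) by ring]
      have q2 : 0 < (M * w t'' (x₀ + r)) * (M * w t'' E) := by
        have := mul_pos hM2 hEB
        linarith [show (M * w t'' (x₀ + r)) * (M * w t'' E) = M * M * (w t'' (x₀ + r) * w t'' E) by ring]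
      generalize M * w t'' D = d at *
      generalize M * w t'' (x₀ + r) = e at *
      generalize M * w t'' E = g at *
      rcases pos_and_pos_or_neg_and_neg_of_mul_pos q2 with ⟨p1, p2⟩ | ⟨p1, p2⟩
      · have : d < 0 := neg_of_mul_neg_left q1 p1.le
        linarith
      · have : 0 < d := by
          by_contra h9
          linarith [mul_nonneg_of_nonpos_of_nonpos (not_lt.1 h9) p1.le]
        linarith
    have e1 : EC (w t'') (x₀ + r) (x₀ - r + 1) (m + 1) := hE.append hE1 (by rw [hper'']; exact hEA)
    have e2 := h.ec hat'.le htt htb''.le hB1 hA1 e1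
    have e3 := ((e2.append (D := c₁ + 1) (by linarith) (by rw [hper', hper']; exact hs1)).append (D := c₂ + 1)
      (by linarith) (by rw [hper', hper']; exact hs2)).append (D := x₀ + r + 1) (by linarith) (by rw [hper', hper']; exact hs3)
    exact e3.zc

end SturmPf

namespace SturmPf
open Filter Topology MeasureTheory ProbabilityTheory

lemma unif {g : ℝ → ℝ → ℝ} {a b : ℝ} (hc : ContinuousOn (fun p : ℝ × ℝ => g p.1 p.2) (Icc a b ×ˢ univ))
    (hp : ∀ t ∈ Icc a b, Function.Periodic (g t) 1) {ε : ℝ} (hε : 0 < ε) :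
    ∃ η > 0, ∀ s ∈ Icc a b, ∀ t ∈ Icc a b, ∀ x y, |s - t| ≤ η → |x - y| ≤ η → |g s x - g t y| < ε := by
  have hK : IsCompact (Icc a b ×ˢ Icc (-1:ℝ) 2) := isCompact_Icc.prod isCompact_Icc
  have hu := hK.uniformContinuousOn_of_continuous (hc.mono (prod_mono le_rfl (subset_univ _)))
  rw [Metric.uniformContinuousOn_iff] at hu
  obtain ⟨δ, hδ, hu⟩ := hu ε hε
  refine ⟨min (δ / 2) 1, lt_min (by linarith) one_pos, fun s hs t ht x y hst hxy => ?_⟩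
  have h1 := min_le_left (δ / 2) 1
  have h2 := min_le_right (δ / 2) 1
  have hpn : ∀ t ∈ Icc a b, ∀ z : ℝ, g t (z - (⌊x⌋ : ℤ)) = g t z := fun t ht z => by
    have := (hp t ht).sub_int_mul_eq (x := z) ⌊x⌋
    simpa using this
  have h3 := Int.floor_le x
  have h4 := Int.lt_floor_add_one x
  have h5 := abs_le.1 (hxy.trans h2)
  have := hu (s, x - (⌊x⌋ : ℤ)) ⟨hs, by constructor <;> simp only <;> linarith⟩ (t, y - (⌊x⌋ : ℤ))
    ⟨ht, by constructor <;> simp only <;> linarith [h5.1, h5.2]⟩ (by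
      rw [Prod.dist_eq, max_lt_iff, Real.dist_eq, Real.dist_eq]
      refine ⟨by simp only; linarith, ?_⟩
      simp only [sub_sub_sub_cancel_right]
      linarith)
  simp only [hpn s hs, hpn t ht, Real.dist_eq] at this
  exact this

variable {C a b : ℝ} {w wx : ℝ → ℝ → ℝ}

lemma SC.perx (h : SC C a b w wx) {t : ℝ} (ht : t ∈ Icc a b) : Function.Periodic (wx t) 1 := by
  intro x
  have h1 := h.dx t ht (x + 1)
  have h2 := h1.comp_add_const x 1
  have h3 : (fun x => w t (x + 1)) = w t := funext fun x => h.per t x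
  rw [h3] at h2
  exact h2.unique (h.dx t ht x)

lemma SC.lsc (h : SC C a b w wx) {t₀ : ℝ} (hat : a < t₀) (htb : t₀ < b) (hf : zeroNumber (w t₀) ≠ ⊤) :
    ∀ᶠ t in 𝓝 t₀, zeroNumber (w t₀) ≤ zeroNumber (w t) := by
  obtain ⟨k, hk, hkz⟩ := zn_max (h.per t₀) hf
  rcases hkz with rfl | ⟨x, hx, hxk⟩
  · rw [hk]; simp
  have h1 : ∀ᶠ t in 𝓝 t₀, ∀ i ∈ Finset.range k, w t (x i) * w t (x (i + 1)) < 0 := by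
    rw [Filter.eventually_all_finset]
    intro i hi
    rw [Finset.mem_range] at hi
    have hc : ∀ y, ContinuousAt (fun t => w t y) t₀ := fun y =>
      (h.cγ le_rfl le_rfl continuousOn_const).continuousAt (Icc_mem_nhds hat htb)
    exact ((hc _).mul (hc _)).eventually (gt_mem_nhds (hx i hi).2)
  filter_upwards [h1] with t ht
  rw [hk]
  exact ZC.le ⟨x, fun i hi => ⟨(hx i hi).1, ht i (Finset.mem_range.2 hi)⟩, hxk⟩ (h.per t)

lemma SC.usc (h : SC C a b w wx) {t₀ : ℝ} (hat : a < t₀) (htb : t₀ < b) (hns : ∀ x, w t₀ x ≠ 0 ∨ wx t₀ x ≠ 0) :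
    ∃ t₁, a ≤ t₁ ∧ t₁ < t₀ ∧ zeroNumber (w t₁) ≤ zeroNumber (w t₀) := by
  have ht₀ : t₀ ∈ Icc a b := ⟨hat.le, htb.le⟩
  -- lower bound
  obtain ⟨m, hm, hmx⟩ : ∃ m > 0, ∀ x, 8 * m ≤ |w t₀ x| + |wx t₀ x| := by
    have hc : Continuous fun x => |w t₀ x| + |wx t₀ x| := (sl_cont h.cw ht₀).abs.add (sl_cont h.cx ht₀).abs
    obtain ⟨z, hz, hzm⟩ := isCompact_Icc.exists_isMinOn (nonempty_Icc.2 (zero_le_one (α := ℝ))) hc.continuousOn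
    refine ⟨(|w t₀ z| + |wx t₀ z|) / 8, ?_, fun x => ?_⟩
    · rcases hns z with h1 | h1
      · linarith [abs_pos.2 h1, abs_nonneg (wx t₀ z)]
      · linarith [abs_pos.2 h1, abs_nonneg (w t₀ z)]
    · have h1 := hzm (show Int.fract x ∈ Icc (0:ℝ) 1 from ⟨Int.fract_nonneg x, (Int.fract_lt_one x).le⟩)
      have e1 : w t₀ (Int.fract x) = w t₀ x := by
        have := (h.per t₀).sub_int_mul_eq (x := x) ⌊x⌋
        rw [mul_one] at this; exact this
      have e2 : wx t₀ (Int.fract x) = wx t₀ x := by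
        have := (h.perx ht₀).sub_int_mul_eq (x := x) ⌊x⌋
        rw [mul_one] at this; exact this
      simp only [mem_setOf_eq, e1, e2] at h1
      linarith
  obtain ⟨η₁, hη₁, hw⟩ := unif h.cw (fun t _ => h.per t) hm
  obtain ⟨η₂, hη₂, hwx⟩ := unif h.cx (fun t ht => h.perx ht) hm
  set η := min η₁ η₂ with hη
  have hη0 : 0 < η := lt_min hη₁ hη₂
  obtain ⟨η₃, hη₃, hw3⟩ := unif h.cw (fun t _ => h.per t) (mul_pos hm hη0)
  set δ := min (min η η₃) (t₀ - a) with hδ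
  have hδ0 : 0 < δ := lt_min (lt_min hη0 hη₃) (by linarith)
  have d1 : δ ≤ η := (min_le_left _ _).trans (min_le_left _ _)
  have d2 : δ ≤ η₃ := (min_le_left _ _).trans (min_le_right _ _)
  have d3 : δ ≤ t₀ - a := min_le_right _ _
  have e1 : η ≤ η₁ := min_le_left _ _
  have e2 : η ≤ η₂ := min_le_right _ _
  clear_value δ η
  refine ⟨t₀ - δ, by linarith, by linarith, ?_⟩
  set t₁ := t₀ - δ with ht₁
  have ht₁m : t₁ ∈ Icc a b := ⟨by linarith, by linarith⟩
  set τ : ℝ → ℝ := fun s => t₁ + max 0 (s - 1) * δ with hτ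
  have hτc : Continuous τ := by fun_prop
  have hτm : ∀ s ∈ Icc (0:ℝ) 2, τ s ∈ Icc t₁ t₀ := by
    intro s hs
    have h1 : 0 ≤ max 0 (s - 1) := le_max_left _ _
    have h2 : max 0 (s - 1) ≤ 1 := max_le zero_le_one (by linarith [hs.2])
    have h3 := mul_nonneg h1 hδ0.le
    have h4 := mul_le_of_le_one_left hδ0.le h2
    simp only [hτ]
    constructor <;> linarith
  have hτ0 : τ 0 = t₁ := by
    simp only [hτ]; rw [max_eq_left (by norm_num)]; ring
  have hτ2 : τ 2 = t₀ := by
    simp only [hτ]; rw [max_eq_right (by norm_num)]; linarith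
  have hτ1 : ∀ s ≤ 1, τ s = t₁ := fun s hs => by
    simp only [hτ]; rw [max_eq_left (by linarith)]; ring
  clear_value τ
  have hmem : ∀ s ∈ Icc (0:ℝ) 2, τ s ∈ Icc a b := fun s hs => ⟨ht₁m.1.trans (hτm s hs).1, (hτm s hs).2.trans htb.le⟩
  have hW : ∀ γ : ℝ → ℝ, Continuous γ → ContinuousOn (fun r => w (τ r) (γ r)) (Icc 0 2) := fun γ hγ =>
    h.cw.comp (f := fun r => (τ r, γ r)) (hτc.prodMk hγ).continuousOn fun r hr => ⟨hmem r hr, mem_univ _⟩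
  refine zn_mono (h.per _) (h.per _) fun k hk => ?_
  have := zc_curves (w := fun s => w (τ s)) (a := 0) (b := 2) (s := 0) (t := 2) (k := k) (fun r => h.per _) (by norm_num)
    (by norm_num) ?_ (by simp only [hτ0]; exact hk)
  · simp only [hτ2] at this; exact this
  intro p hp
  simp only [hτ0] at hp
  by_cases hcase : 4 * m ≤ |w t₀ p|
  · refine ⟨fun _ => p, continuousOn_const, hW _ continuous_const, rfl, fun r hr h0 => ?_⟩
    have h1 := hτm r hr
    have := hw (τ r) (hmem r hr) t₀ ht₀ p p (by rw [abs_le]; constructor <;> linarith [h1.1, h1.2]) (by simp [hη₁.le])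
    simp only at h0
    rw [h0, zero_sub, abs_neg] at this
    linarith
  have hD : 4 * m ≤ |wx t₀ p| := by linarith [hmx p]
  have hD0 : wx t₀ p ≠ 0 := fun h0 => by rw [h0, abs_zero] at hD; linarith
  obtain ⟨e, he, hes⟩ : ∃ e : ℝ, |e| = 1 ∧ 0 < e * (w t₁ p * wx t₀ p) := by
    rcases lt_or_gt_of_ne (mul_ne_zero hp hD0) with h1 | h1
    · exact ⟨-1, by simp, by linarith⟩
    · exact ⟨1, by simp, by linarith⟩
  -- mean value
  have hmv : ∀ σ ∈ Icc (0:ℝ) 1, |w t₁ p| + 3 * m * (σ * η) ≤ |w t₁ (p + σ * (e * η))| := by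
    intro σ hσ
    obtain ⟨q, hq, hqe⟩ : ∃ q, |q - p| ≤ η ∧ w t₁ (p + σ * (e * η)) = w t₁ p + wx t₁ q * (σ * (e * η)) := by
      have hg : ∀ s, HasDerivAt (fun s => w t₁ (p + s * (σ * (e * η)))) (wx t₁ (p + s * (σ * (e * η))) * (σ * (e * η))) s := by
        intro s
        have h1 : HasDerivAt (fun s => p + s * (σ * (e * η))) (σ * (e * η)) s := by
          simpa using ((hasDerivAt_id' s).mul_const (σ * (e * η))).const_add p
        exact (h.dx t₁ ht₁m _).comp s h1
      obtain ⟨s, hs, hse⟩ := exists_hasDerivAt_eq_slope _ _ (zero_lt_one (α := ℝ))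
        (fun s _ => (hg s).continuousAt.continuousWithinAt) (fun s _ => hg s)
      refine ⟨p + s * (σ * (e * η)), ?_, ?_⟩
      · rw [add_sub_cancel_left, abs_mul, abs_mul, abs_mul, he, abs_of_pos hη0, abs_of_pos hs.1, abs_of_nonneg hσ.1, one_mul]
        have h1 := mul_le_of_le_one_left hη0.le hσ.2
        have h2 := mul_le_of_le_one_left (mul_nonneg hσ.1 hη0.le) hs.2.le
        linarith
      · simp only [one_mul, zero_mul, add_zero, sub_zero, div_one] at hse
        linarith
    have hq2 := hwx t₁ ht₁m t₀ ht₀ q p (by rw [ht₁, abs_le]; constructor <;> linarith) (by linarith)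
    have hση := mul_nonneg hσ.1 hη0.le
    have hrw : wx t₁ q * (σ * (e * η)) = (e * wx t₁ q) * (σ * η) := by ring
    rw [hqe, hrw]
    -- sign of e * wx t₀ p equals the sign of w t₁ p
    rw [abs_lt] at hq2
    have habs : |e * wx t₀ p| = |wx t₀ p| := by rw [abs_mul, he, one_mul]
    have hdiff : |e * wx t₁ q - e * wx t₀ p| < m := by
      rw [← mul_sub, abs_mul, he, one_mul, abs_lt]; exact hq2
    rw [abs_lt] at hdiff
    have hes' : 0 < w t₁ p * (e * wx t₀ p) := by linarith [show e * (w t₁ p * wx t₀ p) = w t₁ p * (e * wx t₀ p) by ring]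
    rw [← habs] at hD
    rcases pos_and_pos_or_neg_and_neg_of_mul_pos hes' with ⟨p1, p2⟩ | ⟨p1, p2⟩
    · rw [abs_of_pos p2] at hD
      have h9 := mul_le_mul_of_nonneg_right (show 3 * m ≤ e * wx t₁ q by linarith) hση
      have h10 : 0 ≤ 3 * m * (σ * η) := by positivity
      rw [abs_of_pos p1, abs_of_pos (by linarith)]
      linarith
    · rw [abs_of_neg p2] at hD
      have h9 := mul_le_mul_of_nonneg_right (show 3 * m ≤ -(e * wx t₁ q) by linarith) hση
      have h10 : 0 ≤ 3 * m * (σ * η) := by positivity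
      rw [abs_of_neg p1, abs_of_neg (by linarith)]
      linarith
  have hγ : Continuous fun s : ℝ => p + min s 1 * (e * η) := by fun_prop
  refine ⟨fun s => p + min s 1 * (e * η), hγ.continuousOn, hW _ hγ, by simp, fun r hr h0 => ?_⟩
  simp only at h0
  rcases le_total r 1 with h1 | h1
  · rw [min_eq_left h1, hτ1 r h1] at h0
    have h2 := hmv r ⟨hr.1, h1⟩
    rw [h0, abs_zero] at h2
    have := abs_pos.2 hp
    have h10 : 0 ≤ 3 * m * (r * η) := by have := hr.1; positivity
    linarith
  · rw [min_eq_right h1] at h0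
    have h2 := hmv 1 ⟨zero_le_one, le_rfl⟩
    have h3 := hτm r hr
    have h4 := hw3 (τ r) (hmem r hr) t₁ ht₁m (p + 1 * (e * η)) (p + 1 * (e * η))
      (by rw [abs_le]; constructor <;> linarith [h3.1, h3.2]) (by simp [hη₃.le])
    rw [h0, zero_sub, abs_neg] at h4
    have := abs_pos.2 hp
    have := mul_pos hm hη0
    linarith

/-- assembly -/
theorem sturm_of_SC {T : ℝ} {w wx : ℝ → ℝ → ℝ}
    (h : ∀ a, 0 < a → a < T → ∃ C, SC C a T w wx) (hne : ∃ t ∈ Ioc 0 T, ∃ x, w t x ≠ 0) : SturmProperties T w := by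
  obtain ⟨ts, hts, xs, hxs⟩ := hne
  have hT : 0 < T := hts.1.trans_le hts.2
  have hnea : ∀ a, 0 < a → a < ts → ∃ x, w a x ≠ 0 := by
    intro a ha hat
    obtain ⟨C, hC⟩ := h a ha (hat.trans_le hts.2)
    obtain ⟨γ, -, -, h1⟩ := trace hC le_rfl hat.le hts.2 hxs
    exact ⟨γ a, h1 a ⟨le_rfl, hat.le⟩⟩
  have hgood : ∀ t ∈ Ioc 0 T, ∃ a, 0 < a ∧ a < t ∧ a < T ∧ (∃ x, w a x ≠ 0) ∧ ∃ C, SC C a T w wx := by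
    intro t ht
    have h1 : 0 < min t ts / 2 := by have := lt_min ht.1 hts.1; linarith
    have h2 := min_le_left t ts
    have h3 := min_le_right t ts
    exact ⟨min t ts / 2, h1, by linarith, by linarith [ht.2], hnea _ h1 (by linarith), h _ h1 (by linarith [ht.2])⟩
  have hmono : ∀ t₁ ∈ Ioc 0 T, ∀ t₂ ∈ Ioc 0 T, t₁ ≤ t₂ → zeroNumber (w t₂) ≤ zeroNumber (w t₁) := by
    intro t₁ ht₁ t₂ ht₂ h12
    obtain ⟨a, ha, hat, haT, -, C, hC⟩ := hgood t₁ ht₁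
    exact hC.zmono hat.le h12 ht₂.2
  have hfin : ∀ t ∈ Ioc 0 T, zeroNumber (w t) ≠ ⊤ := by
    intro t ht
    have ht2 : t / 2 ∈ Ioc 0 T := ⟨by linarith [ht.1], by linarith [ht.1, ht.2]⟩
    obtain ⟨a, ha, hat, haT, hx, C, hC⟩ := hgood _ ht2
    exact ne_top_of_le_ne_top (hC.fin hx hat (by linarith [ht.1, ht.2])) (hmono _ ht2 _ ht (by linarith [ht.1]))
  refine ⟨hfin, hmono, fun t₀ ht₀ => ⟨fun hdec => ?_, fun hmz t₁ ht₁ t₂ ht₂ h1 h2 => ?_⟩⟩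
  · obtain ⟨a, ha, hat, haT, hx, C, hC⟩ := hgood t₀ ⟨ht₀.1, ht₀.2.le⟩
    by_contra hcon
    have hns : ∀ x, w t₀ x ≠ 0 ∨ wx t₀ x ≠ 0 := by
      intro x
      by_contra h1
      push Not at h1
      exact hcon ⟨x, h1.1, by rw [(hC.dx t₀ ⟨hat.le, ht₀.2.le⟩ x).deriv]; exact h1.2⟩
    obtain ⟨t₁, h1, h2, h3⟩ := hC.usc hat ht₀.2 hns
    have h4 := (hC.lsc hat ht₀.2 (hfin t₀ ⟨ht₀.1, ht₀.2.le⟩)).filter_mono (nhdsWithin_le_nhds (s := Ioi t₀))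
    obtain ⟨t₂, h5, h6⟩ := (h4.and (Ioo_mem_nhdsGT ht₀.2)).exists
    have := hdec t₁ ⟨ha.trans_le h1, (h2.trans ht₀.2).le⟩ t₂ ⟨ht₀.1.trans h6.1, h6.2.le⟩ h2 h6.1
    exact absurd (h3.trans h5) (not_le.2 this)
  · obtain ⟨x₀, h0, hd⟩ := hmz
    obtain ⟨a, ha, hat, haT, hx, C, hC⟩ := hgood t₁ ht₁
    rw [(hC.dx t₀ ⟨by linarith, ht₀.2.le⟩ x₀).deriv] at hd
    exact hC.drop hx hat.le h1 h2 ht₂.2 h0 hd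

end SturmPf

namespace SturmPf
open Filter Topology MeasureTheory ProbabilityTheory

lemma ftay {f : ℝ → ℝ → ℝ → ℝ} (hf : ContDiff ℝ 2 (fun p : ℝ × ℝ × ℝ => f p.1 p.2.1 p.2.2))
    (hper : ∀ x u p, f (x + 1) u p = f x u p) (K : ℝ) :
    ∃ L M : ℝ, 0 ≤ L ∧ 0 ≤ M ∧ ∀ x u p, |u| ≤ K → |p| ≤ K →
      (∀ u' p', |u'| ≤ K → |p'| ≤ K → |f x u p - f x u' p'| ≤ L * (|u - u'| + |p - p'|)) ∧
      ∃ α β, |α| ≤ L ∧ |β| ≤ L ∧ ∀ u' p', |u'| ≤ K → |p'| ≤ K →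
        |f x u p - f x u' p' - (α * (u - u') + β * (p - p'))| ≤ M * (|u - u'| + |p - p'|) ^ 2 := by
  set F : ℝ × ℝ × ℝ → ℝ := fun p => f p.1 p.2.1 p.2.2 with hF
  set B : Set (ℝ × ℝ × ℝ) := Icc 0 1 ×ˢ Icc (-K) K ×ˢ Icc (-K) K with hB
  have hBc : IsCompact B := isCompact_Icc.prod (isCompact_Icc.prod isCompact_Icc)
  have hBv : Convex ℝ B := (convex_Icc _ _).prod ((convex_Icc _ _).prod (convex_Icc _ _))
  have hd : Differentiable ℝ F := hf.differentiable (by norm_num)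
  have hD1 : ContDiff ℝ 1 (fderiv ℝ F) := hf.fderiv_right (by norm_num)
  obtain ⟨L, hL⟩ := hBc.exists_bound_of_continuousOn hD1.continuous.continuousOn
  obtain ⟨M, hM⟩ := hD1.contDiffOn.exists_lipschitzOnWith (by norm_num) hBv hBc
  have hfr : ∀ x u p, f (Int.fract x) u p = f x u p := by
    intro x u p
    have h1 : Function.Periodic (fun x => f x u p) 1 := fun x => hper x u p
    have := h1.sub_int_mul_eq (x := x) ⌊x⌋
    rw [mul_one] at this; exact this
  have hmem : ∀ x u p, |u| ≤ K → |p| ≤ K → (Int.fract x, u, p) ∈ B := fun x u p hu hp =>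
    ⟨⟨Int.fract_nonneg x, (Int.fract_lt_one x).le⟩, abs_le.1 hu, abs_le.1 hp⟩
  have hnorm : ∀ y u p u' p' : ℝ, ‖((y, u, p) : ℝ × ℝ × ℝ) - (y, u', p')‖ ≤ |u - u'| + |p - p'| := by
    intro y u p u' p'
    simp only [Prod.mk_sub_mk, sub_self, Prod.norm_def, norm_zero, Real.norm_eq_abs]
    refine max_le (by positivity) (max_le ?_ ?_)
    · linarith [abs_nonneg (p - p')]
    · linarith [abs_nonneg (u - u')]
  refine ⟨max L 0, M, le_max_right _ _, M.2, fun x u p hu hp => ⟨fun u' p' hu' hp' => ?_, ?_⟩⟩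
  · have h1 := hBv.norm_image_sub_le_of_norm_fderiv_le (f := F) (fun z _ => hd z) (fun z hz => hL z hz)
      (hmem x u' p' hu' hp') (hmem x u p hu hp)
    simp only [hF, hfr, Real.norm_eq_abs] at h1
    have h2 := hnorm (Int.fract x) u p u' p'
    calc _ ≤ _ := h1
      _ ≤ max L 0 * _ := mul_le_mul_of_nonneg_right (le_max_left _ _) (norm_nonneg _)
      _ ≤ _ := mul_le_mul_of_nonneg_left h2 (le_max_right _ _)
  · set P : ℝ × ℝ × ℝ := (Int.fract x, u, p) with hP
    have hPB : P ∈ B := hmem x u p hu hp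
    have hop : ∀ v : ℝ × ℝ × ℝ, ‖v‖ ≤ 1 → |fderiv ℝ F P v| ≤ max L 0 := by
      intro v hv
      have h1 := (fderiv ℝ F P).le_opNorm v
      rw [Real.norm_eq_abs] at h1
      have h2 := hL P hPB
      have h3 := mul_le_of_le_one_right (norm_nonneg (fderiv ℝ F P)) hv
      exact (h1.trans h3).trans (h2.trans (le_max_left _ _))
    refine ⟨fderiv ℝ F P (0, 1, 0), fderiv ℝ F P (0, 0, 1), hop _ (by simp [Prod.norm_def]), hop _ (by simp [Prod.norm_def]),
      fun u' p' hu' hp' => ?_⟩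
    set Q : ℝ × ℝ × ℝ := (Int.fract x, u', p') with hQ
    have hQB : Q ∈ B := hmem x u' p' hu' hp'
    have hseg : segment ℝ P Q ⊆ B := hBv.segment_subset hPB hQB
    have h1 := (convex_segment P Q).norm_image_sub_le_of_norm_fderiv_le' (f := F) (φ := fderiv ℝ F P) (C := M * ‖Q - P‖)
      (fun z _ => hd z) (fun z hz => by
        have h2 := hM.norm_sub_le (hseg hz) hPB
        refine h2.trans (mul_le_mul_of_nonneg_left ?_ M.2)
        exact norm_sub_le_of_mem_segment hz) (right_mem_segment ℝ P Q) (left_mem_segment ℝ P Q)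
    have h2 : P - Q = (u - u') • ((0:ℝ), (1:ℝ), (0:ℝ)) + (p - p') • ((0:ℝ), (0:ℝ), (1:ℝ)) := by
      simp [hP, hQ]
    have h3 : fderiv ℝ F P (P - Q) = fderiv ℝ F P (0, 1, 0) * (u - u') + fderiv ℝ F P (0, 0, 1) * (p - p') := by
      rw [h2, map_add, map_smul, map_smul, smul_eq_mul, smul_eq_mul]; ring
    rw [h3] at h1
    have h4 : F P = f x u p := hfr x u p
    have h5 : F Q = f x u' p' := hfr x u' p'
    rw [h4, h5, Real.norm_eq_abs, norm_sub_rev Q P] at h1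
    refine h1.trans ?_
    have h6 := hnorm (Int.fract x) u p u' p'
    rw [mul_assoc, ← sq]
    exact mul_le_mul_of_nonneg_left (pow_le_pow_left₀ (norm_nonneg _) h6 2) M.2

lemma per_bdd {g : ℝ → ℝ → ℝ} {a b : ℝ} (hc : ContinuousOn (fun p : ℝ × ℝ => g p.1 p.2) (Icc a b ×ˢ univ))
    (hp : ∀ t, Function.Periodic (g t) 1) : ∃ K, ∀ t ∈ Icc a b, ∀ x, |g t x| ≤ K := by
  have hK : IsCompact (Icc a b ×ˢ Icc (0:ℝ) 1) := isCompact_Icc.prod isCompact_Icc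
  obtain ⟨K, hK⟩ := hK.exists_bound_of_continuousOn (hc.mono (prod_mono le_rfl (subset_univ _)))
  refine ⟨K, fun t ht x => ?_⟩
  have h1 := hK (t, Int.fract x) ⟨ht, Int.fract_nonneg x, (Int.fract_lt_one x).le⟩
  have := (hp t).sub_int_mul_eq (x := x) ⌊x⌋
  rw [mul_one] at this
  have h2 : g t (Int.fract x) = g t x := this
  simp only [h2, Real.norm_eq_abs] at h1
  exact h1

/-- time derivative etc. of `u` -/
noncomputable def Dt (u : ℝ → ℝ → ℝ) (t x : ℝ) : ℝ := deriv (fun s => u s x) t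
noncomputable def Dx (u : ℝ → ℝ → ℝ) (t x : ℝ) : ℝ := deriv (u t) x
noncomputable def Dxx (u : ℝ → ℝ → ℝ) (t x : ℝ) : ℝ := deriv (deriv (u t)) x

lemma per_deriv {φ : ℝ → ℝ} (h : Function.Periodic φ 1) : Function.Periodic (deriv φ) 1 := by
  intro x
  have := deriv_comp_add_const φ 1 x
  rw [← this]
  congr 1
  exact funext h

structure Sol (f : ℝ → ℝ → ℝ → ℝ) (T : ℝ) (u : ℝ → ℝ → ℝ) : Prop where
  p : ∀ t, Function.Periodic (u t) 1
  pt : ∀ t, Function.Periodic (Dt u t) 1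
  px : ∀ t, Function.Periodic (Dx u t) 1
  pxx : ∀ t, Function.Periodic (Dxx u t) 1
  dt : ∀ t ∈ Ioc 0 T, ∀ x, HasDerivAt (fun s => u s x) (Dt u t x) t
  dx : ∀ t ∈ Ioc 0 T, ∀ x, HasDerivAt (u t) (Dx u t x) x
  dxx : ∀ t ∈ Ioc 0 T, ∀ x, HasDerivAt (Dx u t) (Dxx u t x) x
  c : ContinuousOn (fun p : ℝ × ℝ => u p.1 p.2) (Icc 0 T ×ˢ univ)
  ct : ContinuousOn (fun p : ℝ × ℝ => Dt u p.1 p.2) (Ioc 0 T ×ˢ univ)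
  cx : ContinuousOn (fun p : ℝ × ℝ => Dx u p.1 p.2) (Ioc 0 T ×ˢ univ)
  cxx : ContinuousOn (fun p : ℝ × ℝ => Dxx u p.1 p.2) (Ioc 0 T ×ˢ univ)
  eq : ∀ t ∈ Ioc 0 T, ∀ x, Dt u t x = Dxx u t x + f x (u t x) (Dx u t x)

lemma Sol.of {f : ℝ → ℝ → ℝ → ℝ} {T : ℝ} {u : ℝ → ℝ → ℝ} (h : IsSolutionOn f T u) : Sol f T u := by
  obtain ⟨h1, h2, h3, h4, h5, h6, h7, h8⟩ := h
  refine ⟨h1, fun t x => ?_, fun t => per_deriv (h1 t), fun t => per_deriv (per_deriv (h1 t)), fun t ht x => (h3 t ht x).hasDerivAt,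
    fun t ht x => ((h4 t ht).differentiable (by norm_num) x).hasDerivAt, fun t ht x => ?_, h2, h5, h6, h7, h8⟩
  · unfold Dt
    congr 1
    exact funext fun s => h1 s x
  · have h9 : ContDiff ℝ 1 (deriv (u t)) := by
      have := h4 t ht
      rw [show (2 : WithTop ℕ∞) = 1 + 1 by norm_num, contDiff_succ_iff_deriv] at this
      exact this.2.2
    exact (h9.differentiable (by norm_num) x).hasDerivAt

/-- a common bound on a compact time interval -/
lemma Sol.bdd {f : ℝ → ℝ → ℝ → ℝ} {T a : ℝ} {u : ℝ → ℝ → ℝ} (h : Sol f T u) (ha : 0 < a) :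
    ∃ K, 0 ≤ K ∧ ∀ t ∈ Icc a T, ∀ x, |u t x| ≤ K ∧ |Dt u t x| ≤ K ∧ |Dx u t x| ≤ K ∧ |Dxx u t x| ≤ K := by
  have hs : Icc a T ×ˢ (univ : Set ℝ) ⊆ Ioc 0 T ×ˢ univ := prod_mono (fun t ht => ⟨ha.trans_le ht.1, ht.2⟩) le_rfl
  have hs0 : Icc a T ×ˢ (univ : Set ℝ) ⊆ Icc 0 T ×ˢ univ := prod_mono (fun t ht => ⟨ha.le.trans ht.1, ht.2⟩) le_rfl
  obtain ⟨K1, h1⟩ := per_bdd (h.c.mono hs0) h.p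
  obtain ⟨K2, h2⟩ := per_bdd (h.ct.mono hs) h.pt
  obtain ⟨K3, h3⟩ := per_bdd (h.cx.mono hs) h.px
  obtain ⟨K4, h4⟩ := per_bdd (h.cxx.mono hs) h.pxx
  refine ⟨max 0 (max (max K1 K2) (max K3 K4)), le_max_left _ _, fun t ht x => ⟨(h1 t ht x).trans ?_, (h2 t ht x).trans ?_,
    (h3 t ht x).trans ?_, (h4 t ht x).trans ?_⟩⟩ <;> simp

lemma sc_diff {f : ℝ → ℝ → ℝ → ℝ} (hf : ContDiff ℝ 2 (fun p : ℝ × ℝ × ℝ => f p.1 p.2.1 p.2.2))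
    (hper : ∀ x u p, f (x + 1) u p = f x u p) {T a : ℝ} {u v : ℝ → ℝ → ℝ} (hu : Sol f T u) (hv : Sol f T v) (ha : 0 < a) :
    ∃ C, SC C a T (fun t x => u t x - v t x) (fun t x => Dx u t x - Dx v t x) := by
  obtain ⟨K, hK0, hK⟩ := hu.bdd ha
  obtain ⟨K', hK0', hK'⟩ := hv.bdd ha
  obtain ⟨L, M, hL, -, hfL⟩ := ftay hf hper (max K K')
  have hs : Icc a T ×ˢ (univ : Set ℝ) ⊆ Ioc 0 T ×ˢ univ := prod_mono (fun t ht => ⟨ha.trans_le ht.1, ht.2⟩) le_rfl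
  have hs0 : Icc a T ×ˢ (univ : Set ℝ) ⊆ Icc 0 T ×ˢ univ := prod_mono (fun t ht => ⟨ha.le.trans ht.1, ht.2⟩) le_rfl
  have hm : ∀ t ∈ Icc a T, t ∈ Ioc 0 T := fun t ht => ⟨ha.trans_le ht.1, ht.2⟩
  have hcl : Cl L a T (fun t x => u t x - v t x) (fun t x => Dt u t x - Dt v t x) (fun t x => Dx u t x - Dx v t x)
      (fun t x => Dxx u t x - Dxx v t x) := by
    refine ⟨fun t ht x => (hu.dt t (hm t ht) x).fun_sub (hv.dt t (hm t ht) x), fun t ht x => (hu.dx t (hm t ht) x).fun_sub (hv.dx t (hm t ht) x),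
      fun t ht x => (hu.dxx t (hm t ht) x).fun_sub (hv.dxx t (hm t ht) x), (hu.c.mono hs0).sub (hv.c.mono hs0), (hu.ct.mono hs).sub (hv.ct.mono hs),
      (hu.cx.mono hs).sub (hv.cx.mono hs), (hu.cxx.mono hs).sub (hv.cxx.mono hs), ⟨K + K', fun t ht x => ?_⟩, hL, fun t ht x => ?_⟩
    · obtain ⟨a1, a2, a3, a4⟩ := hK t ht x
      obtain ⟨b1, b2, b3, b4⟩ := hK' t ht x
      exact ⟨(abs_sub _ _).trans (add_le_add a1 b1), (abs_sub _ _).trans (add_le_add a2 b2), (abs_sub _ _).trans (add_le_add a3 b3),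
        (abs_sub _ _).trans (add_le_add a4 b4)⟩
    · obtain ⟨a1, a2, a3, a4⟩ := hK t ht x
      obtain ⟨b1, b2, b3, b4⟩ := hK' t ht x
      have := (hfL x (u t x) (Dx u t x) (a1.trans (le_max_left _ _)) (a3.trans (le_max_left _ _))).1 (v t x) (Dx v t x)
        (b1.trans (le_max_right _ _)) (b3.trans (le_max_right _ _))
      simp only [hu.eq t (hm t ht) x, hv.eq t (hm t ht) x]
      refine le_trans (le_of_eq ?_) this
      congr 1; ring
  refine ⟨L, fun t => (hu.p t).sub (hv.p t), hcl.dx, hcl.cw, hcl.cx, fun ε hε => ⟨_, _, _, _, hcl, fun t ht x => ?_⟩⟩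
  simp [hε.le]

theorem part1 {f : ℝ → ℝ → ℝ → ℝ} (hf : ContDiff ℝ 2 (fun p : ℝ × ℝ × ℝ => f p.1 p.2.1 p.2.2))
    (hper : ∀ x u p, f (x + 1) u p = f x u p) {T : ℝ} (hT : 0 < T) {u v : ℝ → ℝ → ℝ} (hu : Sol f T u) (hv : Sol f T v)
    (hne : ¬ ∀ t ∈ Icc 0 T, ∀ x : ℝ, u t x = v t x) : SturmProperties T (fun t x => u t x - v t x) := by
  refine sturm_of_SC (fun a ha _ => sc_diff hf hper hu hv ha) ?_
  by_contra hcon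
  push Not at hcon
  refine hne fun t ht x => ?_
  rcases ht.1.eq_or_lt with h0 | h0
  · subst h0
    have hc : ∀ {g : ℝ → ℝ → ℝ}, Sol f T g → Tendsto (fun s => g s x) (𝓝[>] 0) (𝓝 (g 0 x)) := by
      intro g hg
      have h1 : ContinuousWithinAt (fun s => g s x) (Icc 0 T) 0 :=
        (hg.c (0, x) ⟨ht, mem_univ _⟩).comp (f := fun r : ℝ => (r, x)) (by fun_prop) (fun r hr => ⟨hr, mem_univ _⟩)
      refine h1.mono_left (nhdsWithin_le_iff.2 ?_)
      filter_upwards [Ioo_mem_nhdsGT hT] with s hs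
      exact ⟨hs.1.le, hs.2.le⟩
    refine tendsto_nhds_unique (hc hu) ((hc hv).congr' ?_)
    filter_upwards [Ioo_mem_nhdsGT hT] with s hs
    have := hcon s ⟨hs.1, hs.2.le⟩ x
    linarith
  · have := hcon t ⟨h0, ht.2⟩ x
    linarith

end SturmPf

namespace SturmPf
open Filter Topology MeasureTheory ProbabilityTheory

/-- backward difference quotient in time -/
noncomputable def qh (h : ℝ) (G : ℝ → ℝ → ℝ) (t x : ℝ) : ℝ := (G t x - G (t - h) x) / h

lemma qh_cont {G : ℝ → ℝ → ℝ} {T c a h : ℝ} (hc : 0 < c) (hh : 0 < h) (hca : c + h ≤ a)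
    (hG : ContinuousOn (fun p : ℝ × ℝ => G p.1 p.2) (Ioc 0 T ×ˢ univ)) :
    ContinuousOn (fun p : ℝ × ℝ => qh h G p.1 p.2) (Icc a T ×ˢ univ) := by
  unfold qh
  refine ContinuousOn.div_const (ContinuousOn.sub (hG.mono (prod_mono (fun t ht => ⟨?_, ht.2⟩) le_rfl)) ?_) h
  · linarith [ht.1]
  · exact hG.comp (f := fun p : ℝ × ℝ => (p.1 - h, p.2)) (by fun_prop) fun p hp =>
      ⟨⟨by simp only; linarith [hp.1.1], by simp only; linarith [hp.1.2]⟩, mem_univ _⟩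

lemma qh_bdd {G : ℝ → ℝ → ℝ} {T c a h K : ℝ} (hh : 0 < h) (hca : c + h ≤ a)
    (hG : ∀ t ∈ Icc c T, ∀ x, |G t x| ≤ K) : ∀ t ∈ Icc a T, ∀ x, |qh h G t x| ≤ 2 * K / h := by
  intro t ht x
  unfold qh
  rw [abs_div, abs_of_pos hh]
  refine div_le_div_of_nonneg_right ?_ hh.le
  have h1 := hG t ⟨by linarith [ht.1], ht.2⟩ x
  have h2 := hG (t - h) ⟨by linarith [ht.1], by linarith [ht.2]⟩ x
  exact (abs_sub _ _).trans (by linarith)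

lemma qh_cl {f : ℝ → ℝ → ℝ → ℝ} {T c a h K L : ℝ} {u : ℝ → ℝ → ℝ} (hu : Sol f T u) (hc : 0 < c) (hh : 0 < h) (hca : c + h ≤ a)
    (hL : 0 ≤ L) (hK : ∀ t ∈ Icc c T, ∀ x, |u t x| ≤ K ∧ |Dt u t x| ≤ K ∧ |Dx u t x| ≤ K ∧ |Dxx u t x| ≤ K)
    (hfL : ∀ x u p, |u| ≤ K → |p| ≤ K → ∀ u' p', |u'| ≤ K → |p'| ≤ K → |f x u p - f x u' p'| ≤ L * (|u - u'| + |p - p'|)) :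
    Cl L a T (qh h u) (qh h (Dt u)) (qh h (Dx u)) (qh h (Dxx u)) := by
  have hm : ∀ t ∈ Icc a T, t ∈ Ioc 0 T ∧ t - h ∈ Ioc 0 T := fun t ht =>
    ⟨⟨by linarith [ht.1], ht.2⟩, by linarith [ht.1], by linarith [ht.2]⟩
  have hs : Ioc 0 T ×ˢ (univ : Set ℝ) ⊆ Icc 0 T ×ˢ univ := prod_mono Ioc_subset_Icc_self le_rfl
  refine ⟨fun t ht x => ?_, fun t ht x => ?_, fun t ht x => ?_, qh_cont hc hh hca (hu.c.mono hs), qh_cont hc hh hca hu.ct,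
    qh_cont hc hh hca hu.cx, qh_cont hc hh hca hu.cxx, ⟨2 * K / h, fun t ht x => ⟨?_, ?_, ?_, ?_⟩⟩, hL, fun t ht x => ?_⟩
  · have h2 : HasDerivAt (fun s => u (s - h) x) (Dt u (t - h) x) t := (hu.dt _ (hm t ht).2 x).comp_sub_const t h
    exact ((hu.dt t (hm t ht).1 x).fun_sub h2).div_const h
  · exact ((hu.dx t (hm t ht).1 x).fun_sub (hu.dx _ (hm t ht).2 x)).div_const h
  · exact ((hu.dxx t (hm t ht).1 x).fun_sub (hu.dxx _ (hm t ht).2 x)).div_const h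
  · exact qh_bdd hh hca (fun t ht x => (hK t ht x).1) t ht x
  · exact qh_bdd hh hca (fun t ht x => (hK t ht x).2.1) t ht x
  · exact qh_bdd hh hca (fun t ht x => (hK t ht x).2.2.1) t ht x
  · exact qh_bdd hh hca (fun t ht x => (hK t ht x).2.2.2) t ht x
  · have k1 := hK t ⟨by linarith [ht.1], ht.2⟩ x
    have k2 := hK (t - h) ⟨by linarith [ht.1], by linarith [ht.2]⟩ x
    have := hfL x _ _ k1.1 k1.2.2.1 _ _ k2.1 k2.2.2.1
    have e1 : qh h (Dt u) t x - qh h (Dxx u) t x = (f x (u t x) (Dx u t x) - f x (u (t - h) x) (Dx u (t - h) x)) / h := by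
      unfold qh
      rw [hu.eq t (hm t ht).1 x, hu.eq _ (hm t ht).2 x]; ring
    rw [e1, abs_div, abs_of_pos hh]
    unfold qh
    rw [abs_div, abs_div, abs_of_pos hh, ← add_div, ← mul_div_assoc]
    exact div_le_div_of_nonneg_right this hh.le

/-- mean value theorem for the difference quotient -/
lemma qh_mv {f : ℝ → ℝ → ℝ → ℝ} {T h t : ℝ} {u : ℝ → ℝ → ℝ} (hu : Sol f T u) (hh : 0 < h) (h0 : 0 < t - h) (ht : t ≤ T) (x : ℝ) :
    ∃ s ∈ Icc (t - h) t, qh h u t x = Dt u s x := by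
  have hd : ∀ s ∈ Icc (t - h) t, HasDerivAt (fun s => u s x) (Dt u s x) s := fun s hs =>
    hu.dt s ⟨by linarith [hs.1], by linarith [hs.2]⟩ x
  obtain ⟨s, hs, hse⟩ := exists_hasDerivAt_eq_slope (fun s => u s x) (fun s => Dt u s x) (by linarith : t - h < t)
    (fun s hs => (hd s hs).continuousAt.continuousWithinAt) (fun s hs => hd s (Ioo_subset_Icc_self hs))
  refine ⟨s, Ioo_subset_Icc_self hs, ?_⟩
  rw [hse, qh]
  congr 1; ring

lemma qh_unif {f : ℝ → ℝ → ℝ → ℝ} {T c : ℝ} {u : ℝ → ℝ → ℝ} (hu : Sol f T u) (hc : 0 < c) {ε : ℝ} (hε : 0 < ε) :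
    ∃ η > 0, ∀ h, 0 < h → h ≤ η → ∀ t ∈ Icc (c + h) T, ∀ x, |qh h u t x - Dt u t x| ≤ ε := by
  obtain ⟨η, hη, h1⟩ := unif (a := c) (b := T) (hu.ct.mono (prod_mono (fun t ht => ⟨hc.trans_le ht.1, ht.2⟩) le_rfl)) (fun t _ => hu.pt t) hε
  refine ⟨η, hη, fun h hh hle t ht x => ?_⟩
  obtain ⟨s, hs, he⟩ := qh_mv hu hh (by linarith [ht.1]) ht.2 x
  rw [he]
  refine (h1 s ⟨by linarith [hs.1, ht.1], hs.2.trans ht.2⟩ t ⟨by linarith [ht.1], ht.2⟩ x x ?_ (by simp [hη.le])).le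
  rw [abs_le]; constructor <;> linarith [hs.1, hs.2]

lemma qh_res {f : ℝ → ℝ → ℝ → ℝ} {T h t x α β M K N : ℝ} {u : ℝ → ℝ → ℝ} (hu : Sol f T u) (hh : 0 < h) (hM : 0 ≤ M)
    (h0 : 0 < t - h) (ht : t ≤ T) (h1 : |qh h u t x| ≤ K) (h2 : |qh h (Dx u) t x| ≤ N)
    (hr : |f x (u t x) (Dx u t x) - f x (u (t - h) x) (Dx u (t - h) x) - (α * (u t x - u (t - h) x) + β * (Dx u t x - Dx u (t - h) x))|
      ≤ M * (|u t x - u (t - h) x| + |Dx u t x - Dx u (t - h) x|) ^ 2) :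
    |qh h (Dt u) t x - qh h (Dxx u) t x - (α * qh h u t x + β * qh h (Dx u) t x)| ≤ M * (K + N) ^ 2 * h := by
  have e1 : u t x - u (t - h) x = h * qh h u t x := by unfold qh; field_simp
  have e2 : Dx u t x - Dx u (t - h) x = h * qh h (Dx u) t x := by unfold qh; field_simp
  have e3 : f x (u t x) (Dx u t x) - f x (u (t - h) x) (Dx u (t - h) x) = h * (qh h (Dt u) t x - qh h (Dxx u) t x) := by
    unfold qh
    rw [hu.eq t ⟨by linarith, ht⟩ x, hu.eq (t - h) ⟨h0, by linarith⟩ x]; field_simp; ring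
  rw [e1, e2, e3, abs_mul, abs_mul, abs_of_pos hh] at hr
  have e4 : h * (qh h (Dt u) t x - qh h (Dxx u) t x) - (α * (h * qh h u t x) + β * (h * qh h (Dx u) t x)) =
    h * (qh h (Dt u) t x - qh h (Dxx u) t x - (α * qh h u t x + β * qh h (Dx u) t x)) := by ring
  rw [e4, abs_mul, abs_of_pos hh] at hr
  have e5 : M * (h * |qh h u t x| + h * |qh h (Dx u) t x|) ^ 2 = h * (M * (|qh h u t x| + |qh h (Dx u) t x|) ^ 2 * h) := by ring
  rw [e5] at hr
  refine (le_of_mul_le_mul_left hr hh).trans ?_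
  refine mul_le_mul_of_nonneg_right (mul_le_mul_of_nonneg_left ?_ hM) hh.le
  exact pow_le_pow_left₀ (by positivity) (add_le_add h1 h2) 2

lemma grad_strip {C T a b η δ : ℝ} {g gt gx gxx : ℝ → ℝ → ℝ} (hδ : 0 < δ) (hab : b - δ = a) (hC : 0 ≤ C) (hη : 0 < η)
    (hcont : ContinuousOn (fun p : ℝ × ℝ => g p.1 p.2) (Icc a T ×ˢ univ))
    (hds : ∀ s ∈ Icc a T, ∀ y, HasDerivAt (fun r => g r y) (gt s y) s)
    (hdy : ∀ s ∈ Icc a T, ∀ y, HasDerivAt (g s) (gx s y) y)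
    (hdyy : ∀ s ∈ Icc a T, ∀ y, HasDerivAt (gx s) (gxx s y) y)
    (hb : ∀ s ∈ Icc a T, ∀ y, |g s y| ≤ η)
    (he : ∀ s ∈ Icc a T, ∀ y, |gt s y - gxx s y| ≤ η + C * |gx s y|) :
    ∀ s ∈ Icc b T, ∀ y, |gx s y| ≤ (40 * (C + 1) + 2 / δ) * η := by
  intro s hs y
  have hm : ∀ r ∈ Icc (s - δ) s, r ∈ Icc a T := fun r hr => ⟨by linarith [hr.1, hs.1], hr.2.trans hs.2⟩
  exact grad_bound hδ hC hη (hcont.mono (prod_mono hm (subset_univ _))) (fun r hr z _ => hds r (hm r hr) z)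
    (fun r hr z _ => hdy r (hm r hr) z) (fun r hr z _ => hdyy r (hm r hr) z) (fun r hr z _ => hb r (hm r hr) z)
    (fun r hr z _ => he r (hm r hr) z)

/-- uniform Cauchy property of the difference quotients -/
lemma qh_cauchy {f : ℝ → ℝ → ℝ → ℝ} (hf : ContDiff ℝ 2 (fun p : ℝ × ℝ × ℝ => f p.1 p.2.1 p.2.2))
    (hper : ∀ x u p, f (x + 1) u p = f x u p) {T a : ℝ} {u : ℝ → ℝ → ℝ} (hu : Sol f T u) (ha : 0 < a) :
    ∃ L, (∀ h, 0 < h → h ≤ a → Cl L (4 * a) T (qh h u) (qh h (Dt u)) (qh h (Dx u)) (qh h (Dxx u))) ∧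
      ∀ ε > 0, ∃ η > 0, η ≤ a ∧ ∀ h, 0 < h → h ≤ η → ∀ h', 0 < h' → h' ≤ η → ∀ t ∈ Icc (4 * a) T, ∀ x,
        |qh h u t x - Dt u t x| ≤ ε ∧ |qh h (Dx u) t x - qh h' (Dx u) t x| ≤ ε := by
  obtain ⟨K, hK0, hK⟩ := hu.bdd ha
  obtain ⟨L, M, hL, hM, hfL⟩ := ftay hf hper K
  have hcl : ∀ h, 0 < h → h ≤ a → Cl L (2 * a) T (qh h u) (qh h (Dt u)) (qh h (Dx u)) (qh h (Dxx u)) := fun h hh hle =>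
    qh_cl hu ha hh (by linarith) hL hK fun x u p h1 h2 => (hfL x u p h1 h2).1
  -- uniform bounds
  have hqb : ∀ h, 0 < h → h ≤ a → ∀ t ∈ Icc (2 * a) T, ∀ x, |qh h u t x| ≤ K := by
    intro h hh hle t ht x
    obtain ⟨s, hs, he⟩ := qh_mv hu hh (by linarith [ht.1]) ht.2 x
    rw [he]
    exact (hK s ⟨by linarith [hs.1, ht.1], hs.2.trans ht.2⟩ x).2.1
  set η₀ := K + L * K + 1 with hη₀
  have hLK := mul_nonneg hL hK0
  set N := (40 * (L + 1) + 2 / a) * η₀ with hN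
  have hNb : ∀ h, 0 < h → h ≤ a → ∀ t ∈ Icc (3 * a) T, ∀ x, |qh h (Dx u) t x| ≤ N := by
    intro h hh hle
    have hc := hcl h hh hle
    refine grad_strip (C := L) (η := η₀) ha (by linarith) hL (by linarith) hc.cw hc.dt hc.dx hc.dxx (fun s hs y => ?_) (fun s hs y => ?_)
    · have := hqb h hh hle s hs y; linarith
    · have h1 := hc.eq s hs y
      have h2 := mul_le_mul_of_nonneg_left (hqb h hh hle s hs y) hL
      linarith
  clear_value N
  refine ⟨L, fun h hh hle => qh_cl hu ha hh (by linarith) hL hK fun x u p h1 h2 => (hfL x u p h1 h2).1, fun ε hε => ?_⟩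
  -- choice of smallness
  set G := 40 * (L + 1) + 2 / a with hG
  have hGp : 1 ≤ G := by
    have : 0 < 2 / a := by positivity
    linarith
  set Q := M * (K + N) ^ 2 with hQ
  have hQ0 : 0 ≤ Q := mul_nonneg hM (sq_nonneg _)
  clear_value Q
  set ζ := ε / G / 2 with hζ
  have hζ0 : 0 < ζ := by positivity
  have hζε : ζ ≤ ε := by
    rw [hζ]
    have := div_le_self hε.le hGp
    linarith
  set ε₁ := ζ / (2 * (1 + L)) with hε₁
  have hε₁0 : 0 < ε₁ := by positivity
  have hε₁e : (1 + L) * (2 * ε₁) = ζ := by rw [hε₁]; field_simp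
  have hε₁ε : ε₁ ≤ ζ := by linarith [mul_nonneg hL hε₁0.le]
  obtain ⟨η₁, hη₁, hun⟩ := qh_unif hu ha hε₁0
  refine ⟨min a (min η₁ (ζ / (2 * (Q + 1)))), lt_min ha (lt_min hη₁ (by positivity)), min_le_left _ _, ?_⟩
  have hsm : ∀ h, 0 < h → h ≤ min a (min η₁ (ζ / (2 * (Q + 1)))) → h ≤ a ∧ h ≤ η₁ ∧ Q * h ≤ ζ / 2 := by
    intro h hh hle
    refine ⟨hle.trans (min_le_left _ _), hle.trans ((min_le_right _ _).trans (min_le_left _ _)), ?_⟩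
    have h1 : h ≤ ζ / (2 * (Q + 1)) := hle.trans ((min_le_right _ _).trans (min_le_right _ _))
    rw [le_div_iff₀ (by positivity)] at h1
    linarith
  intro h hh hle h' hh' hle'
  obtain ⟨s1, s2, s3⟩ := hsm h hh hle
  obtain ⟨s1', s2', s3'⟩ := hsm h' hh' hle'
  have hcv : ∀ t ∈ Icc (3 * a) T, ∀ x, |qh h u t x - Dt u t x| ≤ ε₁ := fun t ht x => hun h hh s2 t ⟨by linarith [ht.1], ht.2⟩ x
  have hcv' : ∀ t ∈ Icc (3 * a) T, ∀ x, |qh h' u t x - Dt u t x| ≤ ε₁ := fun t ht x => hun h' hh' s2' t ⟨by linarith [ht.1], ht.2⟩ x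
  have hsub : Icc (3 * a) T ⊆ Icc (2 * a) T := Icc_subset_Icc (by linarith) le_rfl
  have hc := hcl h hh s1
  have hc' := hcl h' hh' s1'
  have hgd : ∀ t ∈ Icc (3 * a) T, ∀ x, |qh h u t x - qh h' u t x| ≤ 2 * ε₁ := by
    intro t ht x
    have h1 := abs_le.1 (hcv t ht x)
    have h2 := abs_le.1 (hcv' t ht x)
    rw [abs_le]; constructor <;> linarith [h1.1, h1.2, h2.1, h2.2]
  have hgr := grad_strip (C := L) (η := 2 * ζ) (T := T) (a := 3 * a) (b := 4 * a) (g := fun t x => qh h u t x - qh h' u t x)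
    (gt := fun t x => qh h (Dt u) t x - qh h' (Dt u) t x) (gx := fun t x => qh h (Dx u) t x - qh h' (Dx u) t x)
    (gxx := fun t x => qh h (Dxx u) t x - qh h' (Dxx u) t x) ha (by linarith) hL (by linarith)
    ((hc.cw.mono (prod_mono hsub le_rfl)).sub (hc'.cw.mono (prod_mono hsub le_rfl)))
    (fun s hs y => (hc.dt s (hsub hs) y).fun_sub (hc'.dt s (hsub hs) y))
    (fun s hs y => (hc.dx s (hsub hs) y).fun_sub (hc'.dx s (hsub hs) y))
    (fun s hs y => (hc.dxx s (hsub hs) y).fun_sub (hc'.dxx s (hsub hs) y)) ?_ ?_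
  · intro t ht x
    refine ⟨(hcv t ⟨by linarith [ht.1], ht.2⟩ x).trans (hε₁ε.trans hζε), (hgr t ht x).trans (le_of_eq ?_)⟩
    have : G ≠ 0 := by linarith
    have e : (40 * (L + 1) + 2 / a) * (2 * ζ) = ε := by
      try rw [← hG]
      rw [hζ]
      field_simp
    have e2 : (4 * a - 3 * a) = a := by ring
    try rw [e2]
    exact e
  · intro s hs y
    have := hgd s hs y
    have := mul_nonneg hL hε₁0.le
    linarith
  · intro s hs y
    have kb := hK s ⟨by linarith [hs.1], hs.2⟩ y
    have kb1 := hK (s - h) ⟨by linarith [hs.1], by linarith [hs.2]⟩ y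
    have kb2 := hK (s - h') ⟨by linarith [hs.1], by linarith [hs.2]⟩ y
    obtain ⟨α, β, hα, hβ, hr⟩ := (hfL y _ _ kb.1 kb.2.2.1).2
    have r1 := qh_res hu hh hM (by linarith [hs.1]) hs.2 (hqb h hh s1 s (hsub hs) y) (hNb h hh s1 s hs y) (hr _ _ kb1.1 kb1.2.2.1)
    have r2 := qh_res hu hh' hM (by linarith [hs.1]) hs.2 (hqb h' hh' s1' s (hsub hs) y) (hNb h' hh' s1' s hs y) (hr _ _ kb2.1 kb2.2.2.1)
    rw [← hQ] at r1 r2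
    have g0 := hgd s hs y
    have m1 : |α * (qh h u s y - qh h' u s y)| ≤ L * (2 * ε₁) := by
      rw [abs_mul]; exact mul_le_mul hα g0 (abs_nonneg _) hL
    have m2 : |β * (qh h (Dx u) s y - qh h' (Dx u) s y)| ≤ L * |qh h (Dx u) s y - qh h' (Dx u) s y| := by
      rw [abs_mul]; exact mul_le_mul_of_nonneg_right hβ (abs_nonneg _)
    have e0 : qh h (Dt u) s y - qh h' (Dt u) s y - (qh h (Dxx u) s y - qh h' (Dxx u) s y) =
      (qh h (Dt u) s y - qh h (Dxx u) s y - (α * qh h u s y + β * qh h (Dx u) s y))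
      - (qh h' (Dt u) s y - qh h' (Dxx u) s y - (α * qh h' u s y + β * qh h' (Dx u) s y))
      + α * (qh h u s y - qh h' u s y) + β * (qh h (Dx u) s y - qh h' (Dx u) s y) := by ring
    rw [e0]
    refine (abs_add_le _ _).trans ?_
    refine add_le_add ?_ m2
    refine (abs_add_le _ _).trans ?_
    have t1 := (abs_sub _ _).trans (add_le_add r1 r2)
    linarith

lemma sc_dt {f : ℝ → ℝ → ℝ → ℝ} (hf : ContDiff ℝ 2 (fun p : ℝ × ℝ × ℝ => f p.1 p.2.1 p.2.2))
    (hper : ∀ x u p, f (x + 1) u p = f x u p) {T a : ℝ} {u : ℝ → ℝ → ℝ} (hu : Sol f T u) (ha : 0 < a) :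
    ∃ C, SC C (4 * a) T (Dt u) (Dx (Dt u)) := by
  obtain ⟨L, hcl, hca⟩ := qh_cauchy hf hper hu ha
  set k : ℕ → ℝ := fun n => a / (n + 1) with hk
  have hk0 : ∀ n, 0 < k n := fun n => by simp only [hk]; positivity
  have hka : ∀ n, k n ≤ a := fun n => div_le_self ha.le (by linarith [Nat.cast_nonneg (α := ℝ) n])
  have hkt : Tendsto k atTop (𝓝 0) := by
    have := (tendsto_one_div_add_atTop_nhds_zero_nat (𝕜 := ℝ)).const_mul a
    simpa [hk, div_eq_mul_inv] using this
  clear_value k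
  set S : Set (ℝ × ℝ) := Icc (4 * a) T ×ˢ univ with hS
  have hUC : UniformCauchySeqOn (fun n (p : ℝ × ℝ) => qh (k n) (Dx u) p.1 p.2) atTop S := by
    rw [Metric.uniformCauchySeqOn_iff]
    intro ε hε
    obtain ⟨η, hη, -, h1⟩ := hca (ε / 2) (by linarith)
    obtain ⟨N, hN⟩ := eventually_atTop.1 (hkt.eventually (gt_mem_nhds hη))
    refine ⟨N, fun m hm n hn p hp => ?_⟩
    rw [Real.dist_eq]
    have := (h1 (k m) (hk0 m) (hN m hm).le (k n) (hk0 n) (hN n hn).le p.1 hp.1 p.2).2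
    linarith
  have hlim : ∀ p : ℝ × ℝ, ∃ l : ℝ, p ∈ S → Tendsto (fun n => qh (k n) (Dx u) p.1 p.2) atTop (𝓝 l) := by
    intro p
    by_cases hp : p ∈ S
    · obtain ⟨l, hl⟩ := cauchySeq_tendsto_of_complete (hUC.cauchySeq hp)
      exact ⟨l, fun _ => hl⟩
    · exact ⟨0, fun h => absurd h hp⟩
  choose G hG using hlim
  have hTU : TendstoUniformlyOn (fun n (p : ℝ × ℝ) => qh (k n) (Dx u) p.1 p.2) G atTop S :=
    hUC.tendstoUniformlyOn_of_tendsto fun p hp => hG p hp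
  have hlim0 : ∀ t ∈ Icc (4 * a) T, ∀ x, Tendsto (fun n => qh (k n) u t x) atTop (𝓝 (Dt u t x)) := by
    intro t ht x
    rw [Metric.tendsto_atTop]
    intro ε hε
    obtain ⟨η, hη, -, h1⟩ := hca (ε / 2) (by linarith)
    obtain ⟨N, hN⟩ := eventually_atTop.1 (hkt.eventually (gt_mem_nhds hη))
    refine ⟨N, fun m hm => ?_⟩
    rw [Real.dist_eq]
    have := (h1 (k m) (hk0 m) (hN m hm).le (k m) (hk0 m) (hN m hm).le t ht x).1
    linarith
  have hder : ∀ t ∈ Icc (4 * a) T, ∀ x, HasDerivAt (Dt u t) (G (t, x)) x := by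
    intro t ht x
    have h1 : TendstoUniformlyOn (fun n x => qh (k n) (Dx u) t x) (fun x => G (t, x)) atTop univ := by
      intro V hV
      filter_upwards [hTU V hV] with n hn y _
      exact hn (t, y) ⟨ht, mem_univ _⟩
    exact hasDerivAt_of_tendstoUniformlyOn isOpen_univ h1
      (Eventually.of_forall fun n y _ => (hcl (k n) (hk0 n) (hka n)).dx t ht y) (fun y _ => hlim0 t ht y) (mem_univ x)
  have hGe : ∀ t ∈ Icc (4 * a) T, ∀ x, Dx (Dt u) t x = G (t, x) := fun t ht x => (hder t ht x).deriv
  refine ⟨L, hu.pt, fun t ht x => ?_, hu.ct.mono (prod_mono (fun t ht => ⟨by linarith [ht.1], ht.2⟩) le_rfl), ?_, fun ε hε => ?_⟩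
  · rw [hGe t ht x]; exact hder t ht x
  · have h1 : ContinuousOn G S := hTU.continuousOn (Eventually.of_forall fun n => (hcl (k n) (hk0 n) (hka n)).cx).frequently
    exact h1.congr fun p hp => hGe p.1 hp.1 p.2
  · obtain ⟨η, hη, hηa, h1⟩ := hca ε hε
    refine ⟨_, _, _, _, hcl η hη hηa, fun t ht x => ⟨?_, ?_⟩⟩
    · rw [abs_sub_comm]; exact (h1 η hη le_rfl η hη le_rfl t ht x).1
    · rw [hGe t ht x, abs_sub_comm]
      have h2 : Tendsto (fun n => |qh η (Dx u) t x - qh (k n) (Dx u) t x|) atTop (𝓝 |qh η (Dx u) t x - G (t, x)|) :=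
        ((hG (t, x) ⟨ht, mem_univ _⟩).const_sub _).abs
      refine le_of_tendsto h2 ?_
      filter_upwards [hkt.eventually (gt_mem_nhds hη)] with n hn
      exact (h1 η hη le_rfl (k n) (hk0 n) hn.le t ht x).2

theorem part2 {f : ℝ → ℝ → ℝ → ℝ} (hf : ContDiff ℝ 2 (fun p : ℝ × ℝ × ℝ => f p.1 p.2.1 p.2.2))
    (hper : ∀ x u p, f (x + 1) u p = f x u p) {T : ℝ} {u : ℝ → ℝ → ℝ} (hu : Sol f T u)
    (hne : ¬ ∀ t₁ ∈ Icc 0 T, ∀ t₂ ∈ Icc 0 T, ∀ x : ℝ, u t₁ x = u t₂ x) : SturmProperties T (Dt u) := by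
  refine sturm_of_SC (wx := Dx (Dt u)) (fun a ha _ => ?_) ?_
  · have := sc_dt hf hper hu (a := a / 4) (by linarith)
    rwa [show 4 * (a / 4) = a by ring] at this
  · by_contra hcon
    push Not at hcon
    have h0 : ∀ t ∈ Icc 0 T, ∀ x, u t x = u 0 x := by
      intro t ht x
      rcases ht.1.eq_or_lt with h0 | h0
      · rw [h0]
      have hcc : ContinuousOn (fun s => u s x) (Icc 0 t) :=
        hu.c.comp (f := fun s : ℝ => (s, x)) (by fun_prop) fun s hs => ⟨⟨hs.1, hs.2.trans ht.2⟩, mem_univ _⟩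
      obtain ⟨s, hs, hse⟩ := exists_hasDerivAt_eq_slope (fun s => u s x) (fun s => Dt u s x) h0 hcc
        (fun s hs => hu.dt s ⟨hs.1, hs.2.le.trans ht.2⟩ x)
      rw [hcon s ⟨hs.1, hs.2.le.trans ht.2⟩ x, eq_comm, div_eq_zero_iff] at hse
      rcases hse with h | h <;> linarith
    exact hne fun t₁ h1 t₂ h2 x => by rw [h0 t₁ h1, h0 t₂ h2]

end SturmPf

/-- **Sturm lap-number property for differences of solutions and for `u_t`.**
Let `f ∈ C²(S¹×ℝ×ℝ,ℝ)` and let `u`, `v` be two classical solutions on `S¹ × [0,T]` of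
`u_t = u_xx + f(x,u,u_x)`.  If `u` is not identically equal to `v`, then `w = u - v`
satisfies the Sturm lap-number properties on `(0,T]`; the same conclusions hold for
`w = u_t`, provided `u` is not independent of `t`. -/
theorem sturm_difference_and_time_derivative
    (T : ℝ) (hT : 0 < T)
    (f : ℝ → ℝ → ℝ → ℝ)
    (hf_reg : ContDiff ℝ 2 (fun p : ℝ × ℝ × ℝ => f p.1 p.2.1 p.2.2))
    (hf_per : ∀ (x u p : ℝ), f (x + 1) u p = f x u p)
    (u v : ℝ → ℝ → ℝ)
    (hu : IsSolutionOn f T u) (hv : IsSolutionOn f T v) :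
    ((¬ ∀ t ∈ Icc 0 T, ∀ x : ℝ, u t x = v t x) →
        SturmProperties T (fun t x => u t x - v t x))
    ∧ ((¬ ∀ t₁ ∈ Icc 0 T, ∀ t₂ ∈ Icc 0 T, ∀ x : ℝ, u t₁ x = u t₂ x) →
        SturmProperties T (fun t x => deriv (fun s => u s x) t)) := by
  exact ⟨fun hne => SturmPf.part1 hf_reg hf_per hT (SturmPf.Sol.of hu) (SturmPf.Sol.of hv) hne,
    fun hne => SturmPf.part2 hf_reg hf_per (SturmPf.Sol.of hu) hne⟩
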